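/- arXiv:2008.02780 — 2 statements merged into one kernel-verified Lean document; each statement's English description precedes it below -/
import Mathlib

section
/- For any n ≥ k ≥ 3, every n-vertex graph with no cycle of length at least k has at most (k-1)(n-1)/2 edges. -/
namespace SimpleGraph

open Finset

variable {V : Type*} {G : SimpleGraph V}

/-- A path with at least three vertices and adjacent ends closes up to a cycle. -/
theorem exists_isCycle_of_isChain {l : List V} (hne : l ≠ []) (hc : l.IsChain G.Adj)
    (hd : l.Nodup) (hadj : G.Adj (l.getLast hne) (l.head hne)) (hl : 3 ≤ l.length) :
    ∃ (u : V) (p : G.Walk u u), p.IsCycle ∧ p.length = l.length := by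
  have hp : (Walk.ofSupport l hne hc).IsPath := by
    rwa [Walk.isPath_def, Walk.support_ofSupport]
  refine ⟨_, .cons hadj (.ofSupport l hne hc), (Walk.cons_isCycle_iff _ _).2 ⟨hp, fun h => ?_⟩, ?_⟩
  · have := hp.length_eq_one_of_mem_edges (Sym2.eq_swap ▸ h)
    grind
  · grind [Walk.length_cons]

/-- Rotating a path at a neighbour of its first vertex. -/
theorem isChain_adj_rotate {v : V} {C D : List V} (hc : (v :: C ++ D).IsChain G.Adj)
    (hadj : ∀ y ∈ D.head?, G.Adj v y) : ((v :: C).reverse ++ D).IsChain G.Adj := by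
  rw [List.isChain_append] at hc ⊢
  refine ⟨?_, hc.2.1, ?_⟩
  · rw [List.isChain_reverse]
    exact hc.1.imp fun a b h => h.symm
  · simpa using hadj

/-- A longest path in the induced graph on `S`, as a list of vertices. -/
theorem exists_longest_path (S : Finset V)
    (hS : ∃ u ∈ S, ∃ v ∈ S, G.Adj u v) :
    ∃ l : List V, 2 ≤ l.length ∧ l.IsChain G.Adj ∧ l.Nodup ∧ (∀ x ∈ l, x ∈ S) ∧
      ∀ l' : List V, l'.IsChain G.Adj → l'.Nodup → (∀ x ∈ l', x ∈ S) → l'.length ≤ l.length := by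
  classical
  obtain ⟨u, hu, v, hv, huv⟩ := hS
  let P : ℕ → Prop := fun m =>
    ∃ l : List V, l.length = m ∧ l.IsChain G.Adj ∧ l.Nodup ∧ ∀ x ∈ l, x ∈ S
  have hbound (l : List V) (hd : l.Nodup) (hl : ∀ x ∈ l, x ∈ S) : l.length ≤ #S := by
    rw [← List.toFinset_card_of_nodup hd]
    exact card_le_card fun x hx => hl x (by simpa using hx)
  have h2 : P 2 := ⟨[u, v], rfl, by simpa using huv, by simpa using huv.ne, by simp [hu, hv]⟩
  have h2S : 2 ≤ #S := by
    obtain ⟨l, hl, -, hd, hm⟩ := h2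
    exact hl ▸ hbound l hd hm
  obtain ⟨l, hl, hc, hd, hm⟩ := Nat.findGreatest_spec h2S h2
  refine ⟨l, hl ▸ Nat.le_findGreatest h2S h2, hc, hd, hm, fun l' hc' hd' hm' => ?_⟩
  rw [hl]
  exact Nat.le_findGreatest (hbound l' hd' hm') ⟨l', rfl, hc', hd', hm'⟩

/-- In a graph without cycles of length at least `k`, a set `S` spanning an edge contains a nonempty
proper subset `E` whose vertices have at most `#E` neighbours in `S`, all in a set `W ⊇ E` of fewer
than `k` vertices. Given a longest path `B ++ w :: A` in `S` with `B` of length about `k - 2`, one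
takes for `E` the first vertices of the paths `B' ++ w :: A` with `B'` a rearrangement of `B`. -/
theorem exists_endpoints [DecidableEq V] [DecidableRel G.Adj] {k : ℕ} (hk : 3 ≤ k)
    (hcyc : ∀ (u : V) (p : G.Walk u u), p.IsCycle → p.length < k) (S : Finset V)
    (hS : ∃ u ∈ S, ∃ v ∈ S, G.Adj u v) :
    ∃ E W : Finset V, E.Nonempty ∧ E ⊆ W ∧ E ⊂ S ∧ #W < k ∧
      ∀ v ∈ E, {u ∈ S | G.Adj v u} ⊆ W ∧ #{u ∈ S | G.Adj v u} ≤ #E := by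
  classical
  obtain ⟨l, hl2, hc, hd, hm, hmax⟩ := exists_longest_path S hS
  obtain ⟨B, w, A, rfl, hB0, hBk, hA⟩ : ∃ B w A, l = B ++ w :: A ∧ B ≠ [] ∧ B.length + 1 < k ∧
      (A = [] ∨ k ≤ B.length + 2) := by
    have hlt : min (l.length - 1) (k - 2) < l.length := by omega
    refine ⟨l.take (min (l.length - 1) (k - 2)), l[min (l.length - 1) (k - 2)],
      l.drop (min (l.length - 1) (k - 2) + 1), ?_, ?_, ?_, ?_⟩
    · simp
    · rw [← List.length_pos_iff]; simp; omega
    · simp; omega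
    · simp; omega
  let E : Finset V := {v ∈ B.toFinset | ∃ C, (v :: C).Perm B ∧ (v :: C ++ w :: A).IsChain G.Adj}
  let W : Finset V := insert w B.toFinset
  have hEB : E ⊆ B.toFinset := filter_subset _ _
  have hmem {v : V} {B' : List V} (hv : B'.head? = some v) (hp : B'.Perm B)
      (hc : (B' ++ w :: A).IsChain G.Adj) : v ∈ E := by
    obtain ⟨C, rfl⟩ := List.head?_eq_some_iff.1 hv
    simp only [E, mem_filter, List.mem_toFinset]
    exact ⟨hp.mem_iff.1 (by simp), C, hp, hc⟩
  have hwB : w ∉ B := by grind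
  refine ⟨E, W, ?_, hEB.trans (subset_insert _ _), ?_, ?_, fun v hv => ?_⟩
  · obtain ⟨v, C, rfl⟩ := List.exists_cons_of_ne_nil hB0
    exact ⟨v, hmem rfl (.refl _) hc⟩
  · refine Finset.ssubset_iff_subset_ne.2 ⟨fun x hx => hm x (by have := hEB hx; simp_all), ?_⟩
    rintro h
    have : w ∈ E := h ▸ hm w (by simp)
    exact hwB (by simpa using hEB this)
  · calc #W ≤ #B.toFinset + 1 := card_insert_le _ _
      _ ≤ B.length + 1 := by gcongr; exact List.toFinset_card_le B
      _ < k := hBk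
  obtain ⟨-, C, hp, hc'⟩ := by simpa only [E, mem_filter] using hv
  have hperm : (v :: C ++ w :: A).Perm (B ++ w :: A) := hp.append_right _
  have hd' : (v :: C ++ w :: A).Nodup := hperm.nodup_iff.2 hd
  have hlen : C.length + 1 = B.length := by simpa using hp.length_eq
  have hsub : {u ∈ S | G.Adj v u} ⊆ (C ++ [w]).toFinset := by
    intro u hu
    obtain ⟨huS, huv⟩ := mem_filter.1 hu
    have hul : u ∈ v :: C ++ w :: A := by
      by_contra hul
      have := hmax (u :: (v :: C ++ w :: A)) (by simpa using ⟨huv.symm, hc'⟩)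
        (List.nodup_cons.2 ⟨hul, hd'⟩)
        (by
          intro x hx
          rcases List.mem_cons.1 hx with rfl | hx
          · exact huS
          · exact hm x (hperm.mem_iff.1 hx))
      simp at this
      omega
    have huA : u ∉ A := by
      intro huA
      obtain ⟨A₁, A₂, rfl⟩ := List.append_of_mem huA
      have hpre : (v :: C ++ w :: A₁ ++ [u]) <+: (v :: C ++ w :: (A₁ ++ u :: A₂)) := ⟨A₂, by simp⟩
      obtain ⟨x, p, hpc, hpl⟩ := exists_isCycle_of_isChain (l := v :: C ++ w :: A₁ ++ [u])
        (by simp) (hc'.prefix hpre) (hd'.sublist hpre.sublist) (by simpa using huv.symm)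
        (by simp; omega)
      have := hcyc x p hpc
      simp at hpl hA
      omega
    have := huv.ne'
    simp at hul ⊢
    tauto
  constructor
  · refine hsub.trans fun x hx => ?_
    have : x ∈ v :: C → x ∈ B := hp.mem_iff.1
    simp [W] at hx ⊢
    grind
  set L := v :: C ++ w :: A with hL
  have hLlen : C.length + 1 < L.length := by simp [hL]
  let I : Finset (Fin (C.length + 1)) := {i | G.Adj v (L[i.1 + 1]'(by omega))}
  have h1 : #{u ∈ S | G.Adj v u} ≤ #I := by
    refine (card_le_card fun u hu => ?_).trans
      (card_image_le (s := I) (f := fun i => L[i.1 + 1]'(by omega)))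
    obtain ⟨j, hj, rfl⟩ := List.getElem_of_mem (List.mem_toFinset.1 (hsub hu))
    have hj' : j < C.length + 1 := by simpa using hj
    have he : L[j + 1]'(by omega) = (C ++ [w])[j] := by
      simp only [hL, List.append_cons C w A, List.cons_append, List.getElem_cons_succ]
      exact List.getElem_append_left hj
    refine mem_image.2 ⟨⟨j, hj'⟩, ?_, he⟩
    simp only [I, mem_filter, mem_univ, true_and, he]
    exact (mem_filter.1 hu).2
  refine h1.trans (card_le_card_of_injOn (fun i => L[i.1]'(by omega)) ?_ ?_)
  · intro i hi
    replace hi : G.Adj v (L[i.1 + 1]'(by omega)) := by simpa [I] using hi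
    have hi' : i.1 ≤ C.length := by omega
    have htake : v :: C.take i = L.take (i + 1) := by
      simp [hL, List.take_append_of_le_length hi']
    have hdrop : C.drop i ++ w :: A = L.drop (i + 1) := by
      simp [hL, List.drop_append_of_le_length hi']
    have hsplit : L = v :: C.take i ++ (C.drop i ++ w :: A) := by
      rw [htake, hdrop, List.take_append_drop]
    have hlast : (v :: C.take i).getLast? = some (L[i.1]'(by omega)) := by
      rw [htake, List.getLast?_take]
      simp [List.getElem?_eq_getElem (show i.1 < L.length by omega)]
    have hhead : (C.drop i ++ w :: A).head? = some (L[i.1 + 1]'(by omega)) := by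
      rw [hdrop, List.head?_drop, List.getElem?_eq_getElem]
    refine hmem (B' := (v :: C.take i).reverse ++ C.drop i) ?_ ?_ ?_
    · rw [List.head?_append, List.head?_reverse, hlast]
      rfl
    · refine List.Perm.trans ((List.reverse_perm _).append_right _) ?_
      simpa using hp
    · rw [List.append_assoc]
      refine isChain_adj_rotate (hsplit ▸ hc') fun y hy => ?_
      rw [hhead] at hy
      obtain rfl := Option.mem_some_iff.1 hy
      exact hi
  · intro i _ j _ hij
    exact Fin.ext ((hd'.getElem_inj_iff).1 hij)

/-- The Erdős–Gallai bound for the degree sum of the graph induced on a nonempty set. -/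
theorem sum_card_adj_le [DecidableEq V] [DecidableRel G.Adj] {k : ℕ} (hk : 3 ≤ k)
    (hcyc : ∀ (u : V) (p : G.Walk u u), p.IsCycle → p.length < k) (S : Finset V)
    (hS : S.Nonempty) :
    ∑ v ∈ S, #{u ∈ S | G.Adj v u} ≤ (k - 1) * (#S - 1) := by
  induction S using Finset.strongInduction with
  | H S ih =>
  by_cases h : ∃ u ∈ S, ∃ v ∈ S, G.Adj u v
  · obtain ⟨E, W, hE, hEW, hES, hW, hdeg⟩ := exists_endpoints hk hcyc S h
    have hT : (S \ E).Nonempty := sdiff_nonempty.2 hES.2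
    have hrec := ih (S \ E) (sdiff_ssubset hES.1 hE) hT
    have hcard := card_sdiff_add_card_eq_card hES.1
    have hsplit (v : V) : #{u ∈ S | G.Adj v u} =
        #{u ∈ S \ E | G.Adj v u} + #{u ∈ E | G.Adj v u} := by
      rw [← card_union_of_disjoint (disjoint_filter_filter sdiff_disjoint), ← filter_union,
        sdiff_union_of_subset hES.1]
    have hdouble : ∑ v ∈ S \ E, #{u ∈ E | G.Adj v u} = ∑ v ∈ E, #{u ∈ S \ E | G.Adj v u} := by
      have := sum_card_bipartiteAbove_eq_sum_card_bipartiteBelow (s := S \ E) (t := E) G.Adj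
      simpa only [bipartiteAbove, bipartiteBelow, G.adj_comm] using this
    have hdel : ∑ v ∈ E, (#{u ∈ S \ E | G.Adj v u} + #{u ∈ S | G.Adj v u}) ≤ #E * (k - 1) := by
      refine sum_le_card_nsmul _ _ _ fun v hv => ?_
      obtain ⟨hsub, hle⟩ := hdeg v hv
      have : #{u ∈ S \ E | G.Adj v u} ≤ #(W \ E) := by
        refine card_le_card fun u hu => ?_
        simp only [mem_filter, mem_sdiff] at hu ⊢
        exact ⟨hsub (by simp [hu]), hu.1.2⟩
      have := card_sdiff_add_card_eq_card hEW
      omega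
    have hpos := hT.card_pos
    calc ∑ v ∈ S, #{u ∈ S | G.Adj v u}
        = ∑ v ∈ S \ E, #{u ∈ S \ E | G.Adj v u} +
          ∑ v ∈ E, (#{u ∈ S \ E | G.Adj v u} + #{u ∈ S | G.Adj v u}) := by
          rw [← sum_sdiff hES.1, sum_congr rfl fun v (_ : v ∈ S \ E) => hsplit v, sum_add_distrib,
            sum_add_distrib, hdouble, add_assoc]
      _ ≤ (k - 1) * (#(S \ E) - 1) + #E * (k - 1) := add_le_add hrec hdel
      _ = (k - 1) * (#S - 1) := by
          rw [mul_comm #E, ← mul_add]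
          congr 1
          omega
  · push Not at h
    rw [sum_eq_zero fun v hv => card_eq_zero.2 (filter_eq_empty_iff.2 fun u hu => h v hv u hu)]
    exact Nat.zero_le _

end SimpleGraph

/-- Erdős–Gallai theorem for long cycles: for `n ≥ k ≥ 3`, an `n`-vertex graph
with no cycle of length at least `k` has at most `(k-1)(n-1)/2` edges. -/
theorem erdos_gallai_cycle {V : Type*} [Fintype V] [DecidableEq V]
    (G : SimpleGraph V) [DecidableRel G.Adj] (n k : ℕ)
    (hn : Fintype.card V = n) (hk : 3 ≤ k) (hkn : k ≤ n)
    (hcyc : ∀ (u : V) (p : G.Walk u u), p.IsCycle → p.length < k) :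
    2 * G.edgeFinset.card ≤ (k - 1) * (n - 1) := by
  have hne : Nonempty V := Fintype.card_pos_iff.1 (by omega)
  have h := G.sum_card_adj_le hk hcyc Finset.univ Finset.univ_nonempty
  rw [Finset.card_univ, hn] at h
  rw [← G.sum_degrees_eq_twice_card_edges]
  simpa only [← SimpleGraph.card_neighborFinset_eq_degree, SimpleGraph.neighborFinset_eq_filter]
    using h
end

section
/- For every ε > 0 there exist q and, for each k and r with r ≥ 3 and k ≥ (2+ε)r + q, a threshold n_{k,r} such that: if n ≥ n_{k,r}, k is odd, and H is a connected n-vertex r-uniform hypergraph with minimum degree at least 2 containing no Berge-path of length k and having more than (n - (k+3)/2)·C((k-3)/2, r-1) + C((k+3)/2, r) hyperedges, then H is a subhypergraph of H_{n,(k-1)/2}. -/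
def IsBergePath {V : Type*} (H : Finset (Finset V)) (t : ℕ)
    (v : Fin (t+1) → V) (e : Fin t → Finset V) : Prop :=
  Function.Injective v ∧ Function.Injective e ∧ (∀ i, e i ∈ H) ∧
    ∀ i : Fin t, v i.castSucc ∈ e i ∧ v i.succ ∈ e i

def HasBergePath {V : Type*} (H : Finset (Finset V)) (t : ℕ) : Prop :=
  ∃ v e, IsBergePath H t v e

def cnext {t : ℕ} (i : Fin t) : Fin t := ⟨(i.1 + 1) % t, Nat.mod_lt _ i.pos⟩

def cprev {t : ℕ} (i : Fin t) : Fin t := ⟨(i.1 + t - 1) % t, Nat.mod_lt _ i.pos⟩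

def IsBergeCycle {V : Type*} (H : Finset (Finset V)) (t : ℕ)
    (v : Fin t → V) (e : Fin t → Finset V) : Prop :=
  Function.Injective v ∧ Function.Injective e ∧ (∀ i, e i ∈ H) ∧
    ∀ i : Fin t, v i ∈ e i ∧ v (cnext i) ∈ e i

def HasBergeCycle {V : Type*} (H : Finset (Finset V)) (t : ℕ) : Prop :=
  ∃ v e, IsBergeCycle H t v e

def BergeConnected {V : Type*} (H : Finset (Finset V)) : Prop :=
  ∀ x y : V, x ≠ y → ∃ t v e, IsBergePath H t v e ∧ v 0 = x ∧ v (Fin.last t) = y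

/-- The hypergraph `H_{n,a}`: hyperedges are all `r`-subsets of `A` together with all
sets `{c} ∪ A'` for `c ∉ A` and `A'` an `(r-1)`-subset of `A`. -/
def HnaEdges {V : Type*} [Fintype V] [DecidableEq V] (r : ℕ) (A : Finset V) :
    Finset (Finset V) :=
  A.powersetCard r ∪
    Aᶜ.biUnion (fun c => (A.powersetCard (r - 1)).image (fun A' => insert c A'))

theorem HasBergePath.of_le {V : Type*} {H : Finset (Finset V)} {s t : ℕ} (h : HasBergePath H t)
    (hst : s ≤ t) : HasBergePath H s := by
  obtain ⟨p, f, hp, hf, hH, hinc⟩ := h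
  refine ⟨fun i => p (i.castLE (by omega)), fun i => f (i.castLE hst),
    fun i j hij => ?_, fun i j hij => ?_, fun i => hH _, fun i => ?_⟩
  · simpa using hp hij
  · simpa using hf hij
  · exact hinc (i.castLE hst)

section Paths

variable {V : Type*} [DecidableEq V]

/-- `PathOn H u w X E`: there is a Berge-path in `H` from `u` to `w` with vertex set `X` and
edge set `E`. -/
inductive PathOn (H : Finset (Finset V)) : V → V → Finset V → Finset (Finset V) → Prop
  | single (v : V) : PathOn H v v {v} ∅
  | cons {u v w : V} {X : Finset V} {E : Finset (Finset V)} {e : Finset V} :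
      PathOn H v w X E → e ∈ H → u ∈ e → v ∈ e → u ∉ X → e ∉ E →
      PathOn H u w (insert u X) (insert e E)

namespace PathOn

variable {H H' : Finset (Finset V)} {u v w x y : V} {X Y : Finset V} {E F : Finset (Finset V)}
  {e : Finset V}

theorem head_mem (h : PathOn H u w X E) : u ∈ X := by
  cases h <;> simp

theorem last_mem (h : PathOn H u w X E) : w ∈ X := by
  induction h <;> simp_all

theorem edges_subset (h : PathOn H u w X E) : E ⊆ H := by
  induction h with
  | single => simp
  | cons _ he _ _ _ _ ih => exact Finset.insert_subset he ih

theorem card_eq (h : PathOn H u w X E) : X.card = E.card + 1 := by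
  induction h with
  | single => simp
  | cons _ _ _ _ hu he ih => simp [hu, he, ih]

theorem mono (h : PathOn H u w X E) (hE : E ⊆ H') : PathOn H' u w X E := by
  induction h with
  | single => exact .single _
  | cons _ he hu hv hX hE' ih =>
    exact .cons (ih ((Finset.subset_insert _ _).trans hE)) (hE (by simp)) hu hv hX hE'

theorem append (h : PathOn H u v X E) (h' : PathOn H x w Y F) (he : e ∈ H) (hv : v ∈ e)
    (hx : x ∈ e) (hXY : Disjoint X Y) (hEF : Disjoint E F) (heE : e ∉ E) (heF : e ∉ F) :
    PathOn H u w (X ∪ Y) (insert e (E ∪ F)) := by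
  induction h with
  | single v =>
    have := PathOn.cons h' he hv hx (by simpa using hXY) heF
    convert this using 2
    · rfl
    · rw [Finset.empty_union]
  | @cons a b c X' E' f _ hf ha hb haX hfE ih =>
    rw [Finset.disjoint_insert_left] at hXY hEF
    have := PathOn.cons (ih hv hXY.2 hEF.2 (by simp_all)) hf ha hb (by simp_all)
      (by simp_all; rintro rfl; simp_all)
    convert this using 1
    · simp
    · rw [Finset.insert_union, Finset.insert_comm]

theorem snoc (h : PathOn H u v X E) (he : e ∈ H) (hv : v ∈ e) (hx : x ∈ e) (hX : x ∉ X)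
    (hE : e ∉ E) : PathOn H u x (insert x X) (insert e E) := by
  have := h.append (.single x) he hv hx (by simpa using hX) (by simp) hE (by simp)
  convert this using 1
  · rw [Finset.union_comm]; rfl
  · simp

theorem reverse (h : PathOn H u w X E) : PathOn H w u X E := by
  induction h with
  | single => exact .single _
  | cons _ he hu hv hX hE ih => exact ih.snoc he hv hu hX hE

theorem exists_berge (h : PathOn H u w X E) : ∀ t, E.card = t →
    ∃ (p : Fin (t + 1) → V) (f : Fin t → Finset V), IsBergePath H t p f ∧ p 0 = u ∧
      (∀ i, p i ∈ X) ∧ ∀ i, f i ∈ E := by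
  induction h with
  | single v =>
    rintro t rfl
    exact ⟨fun _ => v, Fin.elim0, ⟨fun i j _ => Subsingleton.elim (α := Fin 1) i j,
      fun i => i.elim0, fun i => i.elim0, fun i => i.elim0⟩, rfl, by simp, fun i => i.elim0⟩
  | @cons a b c X' E' f _ hf ha hb haX hfE ih =>
    rintro t rfl
    obtain ⟨p, g, ⟨hp, hg, hgH, hinc⟩, h0, hpX, hgE⟩ := ih _ rfl
    rw [Finset.card_insert_of_notMem hfE]
    refine ⟨Fin.cons a p, Fin.cons f g, ⟨?_, ?_, ?_, ?_⟩, by simp, ?_, ?_⟩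
    · rw [Fin.cons_injective_iff]
      exact ⟨by rintro ⟨i, rfl⟩; exact haX (hpX i), hp⟩
    · rw [Fin.cons_injective_iff]
      exact ⟨by rintro ⟨i, rfl⟩; exact hfE (hgE i), hg⟩
    · intro i
      refine Fin.cases ?_ ?_ i <;> simp [hf, hgH]
    · intro i
      refine Fin.cases ?_ (fun j => ?_) i
      · simp [ha, h0, hb]
      · simpa using hinc j
    · intro i
      refine Fin.cases ?_ ?_ i <;> simp [hpX]
    · intro i
      refine Fin.cases ?_ ?_ i <;> simp [hgE]

/-- Cutting a path at its first vertex in `R`. -/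
theorem exists_first (h : PathOn H u w X E) {R : Finset V} (hw : w ∈ R) :
    ∃ z ∈ R, ∃ Y ⊆ X, ∃ F ⊆ E, PathOn H u z Y F ∧ ∀ y ∈ Y, y ∈ R → y = z := by
  induction h with
  | single v => exact ⟨v, hw, {v}, subset_rfl, ∅, subset_rfl, .single v, by simp⟩
  | @cons a b c X' E' f _ hf ha hb haX hfE ih =>
    by_cases haR : a ∈ R
    · exact ⟨a, haR, {a}, by simp, ∅, by simp, .single a, by simp⟩
    · obtain ⟨z, hz, Y, hY, F, hF, hp, hR⟩ := ih hw
      refine ⟨z, hz, insert a Y, Finset.insert_subset_insert _ hY, insert f F,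
        Finset.insert_subset_insert _ hF,
        .cons hp hf ha hb (fun h => haX (hY h)) (fun h => hfE (hF h)), ?_⟩
      intro y hy hyR
      rcases Finset.mem_insert.1 hy with rfl | hy
      · exact absurd hyR haR
      · exact hR y hy hyR

/-- Each non-final vertex has a successor, at which the path can be split. -/
theorem exists_succ (h : PathOn H u w X E) : ∃ s : V → V, Set.InjOn s (X.erase w) ∧
    ∀ x ∈ X, x ≠ w → s x ∈ X ∧ s x ≠ u ∧ ∃ X₁ X₂ E₁ E₂ e, PathOn H u x X₁ E₁ ∧
      PathOn H (s x) w X₂ E₂ ∧ Disjoint X₁ X₂ ∧ Disjoint E₁ E₂ ∧ e ∉ E₁ ∧ e ∉ E₂ ∧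
      x ∈ e ∧ s x ∈ e ∧ X = X₁ ∪ X₂ ∧ E = insert e (E₁ ∪ E₂) := by
  induction h with
  | single v => exact ⟨id, by simp, by simp⟩
  | @cons a b c X' E' f hp hf ha hb haX hfE ih =>
    obtain ⟨s, hs, hx⟩ := ih
    have hac : a ≠ c := fun h => haX (h ▸ hp.last_mem)
    have hba : b ≠ a := fun h => haX (h ▸ hp.head_mem)
    have key : ∀ x ∈ X', x ≠ a := fun x hx h => haX (h ▸ hx)
    refine ⟨Function.update s a b, ?_, ?_⟩
    · intro x hx' y hy' hxy
      simp only [Finset.coe_erase, Finset.coe_insert, Set.mem_sdiff, Set.mem_insert_iff,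
        Finset.mem_coe, Set.mem_singleton_iff] at hx' hy'
      rcases hx' with ⟨rfl | hx1, hx2⟩ <;> rcases hy' with ⟨rfl | hy1, hy2⟩
      · rfl
      · rw [Function.update_self, Function.update_of_ne (key y hy1)] at hxy
        exact absurd hxy.symm (hx y hy1 hy2).2.1
      · rw [Function.update_self, Function.update_of_ne (key x hx1)] at hxy
        exact absurd hxy (hx x hx1 hx2).2.1
      · rw [Function.update_of_ne (key y hy1), Function.update_of_ne (key x hx1)] at hxy
        exact hs (by simp [hx1, hx2]) (by simp [hy1, hy2]) hxy
    · intro x hx' hxc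
      rcases Finset.mem_insert.1 hx' with rfl | hxX
      · rw [Function.update_self]
        refine ⟨by simp [hp.head_mem], hba, {x}, X', ∅, E', f, .single x, hp, by simpa,
          by simp, by simp, hfE, ha, hb, by rfl, by simp⟩
      · rw [Function.update_of_ne (key x hxX)]
        obtain ⟨h1, h2, X₁, X₂, E₁, E₂, e, h3, h4, h5, h6, h7, h8, h9, h10, rfl, rfl⟩ :=
          hx x hxX hxc
        simp only [Finset.mem_insert, Finset.mem_union, not_or] at hfE haX
        refine ⟨by simp [h1], fun h => key _ h1 h, insert a X₁, X₂, insert f E₁, E₂, e,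
          .cons h3 hf ha hb haX.1 hfE.2.1, h4, ?_, ?_, ?_, h8, h9, h10, ?_, ?_⟩
        · rw [Finset.disjoint_insert_left]; exact ⟨haX.2, h5⟩
        · rw [Finset.disjoint_insert_left]; exact ⟨hfE.2.2, h6⟩
        · simp [h7, Ne.symm hfE.1]
        · simp
        · rw [Finset.insert_union, Finset.insert_comm]

end PathOn

theorem IsBergePath.pathOn {H : Finset (Finset V)} : ∀ {t : ℕ} {p : Fin (t + 1) → V}
    {f : Fin t → Finset V}, IsBergePath H t p f →
    PathOn H (p 0) (p (Fin.last t)) (Finset.univ.image p) (Finset.univ.image f)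
  | 0, p, f, _ => by
    have h1 : Finset.univ.image p = {p 0} := by
      ext x; simp only [Finset.mem_image, Finset.mem_univ, true_and, Finset.mem_singleton]
      constructor
      · rintro ⟨i, rfl⟩; rw [Subsingleton.elim (α := Fin 1) i 0]
      · rintro rfl; exact ⟨0, rfl⟩
    rw [h1]
    simpa using PathOn.single (p 0)
  | t + 1, p, f, ⟨hp, hf, hH, hinc⟩ => by
    have ih := IsBergePath.pathOn (H := H) (p := fun i => p i.succ) (f := fun i => f i.succ)
      ⟨fun i j h => by simpa using hp h, fun i j h => by simpa using hf h, fun i => hH _,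
        fun i => by simpa using hinc i.succ⟩
    have := PathOn.cons ih (hH 0) (hinc 0).1 (hinc 0).2
      (by simp only [Finset.mem_image, Finset.mem_univ, true_and, not_exists]
          intro i h; exact Fin.succ_ne_zero i (hp h))
      (by simp only [Finset.mem_image, Finset.mem_univ, true_and, not_exists]
          intro i h; exact Fin.succ_ne_zero i (hf h))
    have hX : Finset.univ.image p =
        insert (p 0) (Finset.univ.image fun i : Fin (t + 1) => p (Fin.succ i)) := by
      rw [Fin.univ_succ, Finset.cons_eq_insert, Finset.image_insert, Finset.map_eq_image,
        Finset.image_image]; rfl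
    have hE : Finset.univ.image f =
        insert (f 0) (Finset.univ.image fun i : Fin t => f (Fin.succ i)) := by
      rw [Fin.univ_succ, Finset.cons_eq_insert, Finset.image_insert, Finset.map_eq_image,
        Finset.image_image]; rfl
    rw [hX, hE]
    exact this

theorem PathOn.card_le {H : Finset (Finset V)} {k : ℕ} (hk : ¬ HasBergePath H k) {u w : V}
    {X : Finset V} {E : Finset (Finset V)} (h : PathOn H u w X E) : X.card ≤ k := by
  by_contra! hlt
  obtain ⟨p, f, hpf, -⟩ := h.exists_berge _ rfl
  have := h.card_eq
  exact hk (HasBergePath.of_le ⟨p, f, hpf⟩ (by omega))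

/-- In a connected hypergraph a nonempty set `R` is reached from any vertex by a path meeting `R`
only in its last vertex. -/
theorem BergeConnected.exists_path {H : Finset (Finset V)} (hH : BergeConnected H)
    {R : Finset V} (hR : R.Nonempty) (u : V) :
    ∃ z ∈ R, ∃ X E, PathOn H u z X E ∧ ∀ y ∈ X, y ∈ R → y = z := by
  obtain ⟨z₀, hz₀⟩ := hR
  by_cases h : u = z₀
  · subst h
    exact ⟨u, hz₀, {u}, ∅, .single u, by simp⟩
  · obtain ⟨t, p, f, hp, rfl, rfl⟩ := hH u z₀ h
    obtain ⟨z, hz, Y, -, F, -, h1, h2⟩ := hp.pathOn.exists_first hz₀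
    exact ⟨z, hz, Y, F, h1, h2⟩

end Paths

section Blocks

variable {V : Type*} [DecidableEq V]

/-- Every proper nonempty part of `C` is left by an edge of `H` inside `C`. -/
def CutConnected (H : Finset (Finset V)) (C : Finset V) : Prop :=
  ∀ X ⊆ C, X.Nonempty → X ≠ C → ∃ e ∈ H, (e ∩ X).Nonempty ∧ (e ∩ (C \ X)).Nonempty

/-- The edges meeting `C`. -/
def edgesMeeting (H : Finset (Finset V)) (C : Finset V) : Finset (Finset V) :=
  H.filter fun e => (e ∩ C).Nonempty

/-- The edges meeting `S` and contained in `S ∪ A`. -/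
def blockEdges (H : Finset (Finset V)) (A S : Finset V) : Finset (Finset V) :=
  H.filter fun e => e ⊆ S ∪ A ∧ (e ∩ S).Nonempty

/-- There are `K` pairwise disjoint nonempty sets `S` off `A` with at least `D * |S|` block
edges. -/
def HasBlocks (H : Finset (Finset V)) (A : Finset V) (K D : ℕ) : Prop :=
  ∃ 𝒮 : Finset (Finset V), K ≤ 𝒮.card ∧ (𝒮 : Set (Finset V)).PairwiseDisjoint id ∧
    ∀ S ∈ 𝒮, S.Nonempty ∧ Disjoint S A ∧ D * S.card ≤ (blockEdges H A S).card

theorem BergeConnected.cutConnected_univ [Fintype V] {H : Finset (Finset V)}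
    (hH : BergeConnected H) : CutConnected H Finset.univ := by
  rintro X - ⟨x, hx⟩ hXu
  obtain ⟨y, hy⟩ : ∃ y, y ∉ X := by
    by_contra! h
    exact hXu (Finset.eq_univ_iff_forall.2 h)
  obtain ⟨z, hz, Y, F, hp, -⟩ := hH.exists_path (R := Xᶜ) ⟨y, by simpa using hy⟩ x
  clear hXu hy
  induction hp with
  | single v => simp_all
  | @cons a b c X' E' f _ hf ha hb haX hfE ih =>
    by_cases hbX : b ∈ X
    · exact ih hbX hz
    · exact ⟨f, hf, ⟨a, by simp [ha, hx]⟩, ⟨b, by simp [hb, hbX]⟩⟩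

theorem exists_pieces (H : Finset (Finset V)) (U : Finset V) :
    ∃ P : Finset (Finset V), (∀ C ∈ P, C.Nonempty ∧ C ⊆ U ∧ CutConnected H C ∧
      ∀ e ∈ H, (e ∩ C).Nonempty → e ∩ U ⊆ C) ∧ (P : Set (Finset V)).PairwiseDisjoint id ∧
      P.biUnion id = U := by
  induction U using Finset.strongInduction with
  | H U ih =>
    by_cases hU : U.Nonempty
    swap
    · exact ⟨∅, by simp, by simp, by simpa using (Finset.not_nonempty_iff_eq_empty.1 hU).symm⟩
    by_cases hc : CutConnected H U
    · refine ⟨{U}, ?_, by simp, by simp⟩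
      simp only [Finset.mem_singleton, forall_eq]
      exact ⟨hU, subset_rfl, hc, fun e _ _ => Finset.inter_subset_right⟩
    · unfold CutConnected at hc
      push Not at hc
      obtain ⟨X, hXU, hX, hne, hcut⟩ := hc
      have hssub : X ⊂ U := Finset.ssubset_iff_subset_ne.2 ⟨hXU, hne⟩
      have hssub' : U \ X ⊂ U := Finset.sdiff_ssubset hXU hX
      obtain ⟨P, hP, hPd, hPU⟩ := ih X hssub
      obtain ⟨Q, hQ, hQd, hQU⟩ := ih (U \ X) hssub'
      refine ⟨P ∪ Q, ?_, ?_, ?_⟩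
      · intro C hC
        rcases Finset.mem_union.1 hC with hC | hC
        · obtain ⟨h1, h2, h3, h4⟩ := hP C hC
          refine ⟨h1, h2.trans hXU, h3, fun e he hec => ?_⟩
          refine subset_trans ?_ (h4 e he hec)
          have h5 := hcut e he (hec.mono (Finset.inter_subset_inter_left h2))
          intro y hy
          by_contra hyX
          simp only [Finset.mem_inter] at hy hyX
          have : y ∈ e ∩ (U \ X) := by simp; tauto
          simp_all
        · obtain ⟨h1, h2, h3, h4⟩ := hQ C hC
          refine ⟨h1, h2.trans Finset.sdiff_subset, h3, fun e he hec => ?_⟩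
          refine subset_trans ?_ (h4 e he hec)
          intro y hy
          simp only [Finset.mem_inter, Finset.mem_sdiff] at hy ⊢
          refine ⟨hy.1, hy.2, fun hyX => ?_⟩
          have h5 := hcut e he ⟨y, by simp [hy.1, hyX]⟩
          have := hec.mono (Finset.inter_subset_inter_left h2)
          simp_all
      · rw [Finset.coe_union, Set.pairwiseDisjoint_union]
        refine ⟨hPd, hQd, fun C hC C' hC' _ => ?_⟩
        exact Finset.disjoint_of_subset_left (hP C hC).2.1
          (Finset.disjoint_of_subset_right (hQ C' hC').2.1 Finset.disjoint_sdiff)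
      · rw [Finset.union_biUnion, hPU, hQU, Finset.union_sdiff_of_subset hXU]

theorem edge_bound_of_pieces {H : Finset (Finset V)} {A W C : Finset V} {N K D s M : ℕ}
    {P : Finset (Finset V)} (hP : ∀ C' ∈ P, C'.Nonempty ∧ C' ⊆ C \ W)
    (hPd : (P : Set (Finset V)).PairwiseDisjoint id) (hPU : P.biUnion id = C \ W)
    (hWC : W ⊆ C) (hAC : Disjoint A C) (hAW : (A ∪ W).card ≤ N)
    (hloc : ∀ e ∈ H, (e ∩ C).Nonempty → e ⊆ C ∪ A)
    (hloc' : ∀ C' ∈ P, ∀ e ∈ H, (e ∩ C').Nonempty → e ⊆ C' ∪ (A ∪ W))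
    (hstar : ¬ HasBlocks H (A ∪ W) K D)
    (hrec : ∀ C' ∈ P, s * (edgesMeeting H C').card + C'.card ≤ s * D * C'.card + M) :
    (2 * s + 2 * M) * (edgesMeeting H C).card + C.card ≤ (2 * s + 2 * M) * D * C.card +
      (K * ((2 * s + 2 * M) * 2 ^ (2 * M + N) + 2 * M) + (2 * s + 2 * M) * 2 ^ N + N) := by
  set s' := 2 * s + 2 * M with hs'
  set B := P.filter (fun C' => C'.card ≤ 2 * M ∧ D * C'.card ≤ (edgesMeeting H C').card) with hB
  have hBK : B.card < K := by
    by_contra! hK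
    refine hstar ⟨B, hK, hPd.subset (by rw [hB]; exact Finset.filter_subset _ _), fun S hS => ?_⟩
    rw [hB, Finset.mem_filter] at hS
    refine ⟨(hP S hS.1).1, ?_, ?_⟩
    · have h1 := (hP S hS.1).2
      rw [Finset.disjoint_left] at hAC ⊢
      intro x hx hx'
      have := h1 hx
      simp only [Finset.mem_sdiff, Finset.mem_union] at this hx'
      exact hx'.elim (fun h => hAC h this.1) this.2
    · convert hS.2.2 using 2
      ext e
      simp only [blockEdges, edgesMeeting, Finset.mem_filter]
      exact ⟨fun h => ⟨h.1, h.2.2⟩, fun h => ⟨h.1, hloc' S hS.1 e h.1 h.2, h.2⟩⟩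
  have hone : ∀ C' ∈ P, s' * (edgesMeeting H C').card + C'.card ≤ s' * D * C'.card +
      if C' ∈ B then s' * 2 ^ (2 * M + N) + 2 * M else 0 := by
    intro C' hC'
    split_ifs with h
    · rw [hB, Finset.mem_filter] at h
      have : (edgesMeeting H C').card ≤ 2 ^ (2 * M + N) := by
        calc _ ≤ (C' ∪ (A ∪ W)).powerset.card := by
              apply Finset.card_le_card
              intro e he
              simp only [edgesMeeting, Finset.mem_filter] at he
              exact Finset.mem_powerset.2 (hloc' C' hC' e he.1 he.2)
          _ = 2 ^ (C' ∪ (A ∪ W)).card := Finset.card_powerset _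
          _ ≤ _ := by
              apply Nat.pow_le_pow_right (by norm_num)
              exact (Finset.card_union_le _ _).trans (add_le_add h.2.1 hAW)
      have := Nat.mul_le_mul_left s' this
      have := h.2.1
      omega
    · rw [hB, Finset.mem_filter] at h
      have hr := hrec C' hC'
      by_cases hc : C'.card ≤ 2 * M
      · have hlt : (edgesMeeting H C').card + 1 ≤ D * C'.card := by
          by_contra! hh; exact h ⟨hC', hc, by omega⟩
        have h1 := Nat.mul_le_mul_left s' hlt
        have h2 : C'.card ≤ s' := by omega
        have h3 : s' * (D * C'.card) = s' * D * C'.card := by ring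
        have h4 : s' * ((edgesMeeting H C').card + 1) = s' * (edgesMeeting H C').card + s' := by
          ring
        omega
      · have h1 : 2 * s * (edgesMeeting H C').card + C'.card ≤ 2 * s * D * C'.card := by
          have e1 : 2 * s * (edgesMeeting H C').card = 2 * (s * (edgesMeeting H C').card) := by ring
          have e2 : 2 * s * D * C'.card = 2 * (s * D * C'.card) := by ring
          omega
        have h2 : (edgesMeeting H C').card ≤ D * C'.card := by
          rcases Nat.eq_zero_or_pos s with rfl | hs
          · simp at h1; omega
          · by_contra! hh
            have := Nat.mul_le_mul_left (2 * s) hh.le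
            have e2 : 2 * s * D * C'.card = 2 * s * (D * C'.card) := by ring
            omega
        have h3 := Nat.mul_le_mul_left (2 * M) h2
        have e1 : s' * (edgesMeeting H C').card = 2 * s * (edgesMeeting H C').card +
          2 * M * (edgesMeeting H C').card := by rw [hs']; ring
        have e2 : s' * D * C'.card = 2 * s * D * C'.card + 2 * M * (D * C'.card) := by
          rw [hs']; ring
        omega
  have hsum := Finset.sum_le_sum hone
  rw [Finset.sum_add_distrib, Finset.sum_add_distrib, ← Finset.mul_sum, ← Finset.mul_sum,
    ← Finset.sum_filter] at hsum
  have hcard : ∑ C' ∈ P, C'.card = (C \ W).card := by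
    rw [← hPU, Finset.card_biUnion (fun x hx y hy hxy => hPd hx hy hxy)]; rfl
  have hfB : P.filter (· ∈ B) = B := by
    ext; simp [hB]
  rw [hfB, Finset.sum_const, hcard, smul_eq_mul] at hsum
  have hE : (edgesMeeting H C).card ≤ ∑ C' ∈ P, (edgesMeeting H C').card + 2 ^ N := by
    calc _ ≤ (P.biUnion (edgesMeeting H) ∪ (A ∪ W).powerset).card := by
          apply Finset.card_le_card
          intro e he
          simp only [edgesMeeting, Finset.mem_filter] at he
          have h1 := hloc e he.1 he.2
          by_cases h2 : e ⊆ A ∪ W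
          · exact Finset.mem_union_right _ (Finset.mem_powerset.2 h2)
          · apply Finset.mem_union_left
            obtain ⟨x, hx, hx'⟩ := Finset.not_subset.1 h2
            have hxC : x ∈ C \ W := by
              have := h1 hx
              simp only [Finset.mem_union, Finset.mem_sdiff] at *; tauto
            rw [← hPU, Finset.mem_biUnion] at hxC
            obtain ⟨C', hC', hxC'⟩ := hxC
            exact Finset.mem_biUnion.2 ⟨C', hC', Finset.mem_filter.2
              ⟨he.1, x, Finset.mem_inter.2 ⟨hx, hxC'⟩⟩⟩
      _ ≤ _ := by
          refine (Finset.card_union_le _ _).trans (add_le_add Finset.card_biUnion_le ?_)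
          rw [Finset.card_powerset]
          exact Nat.pow_le_pow_right (by norm_num) hAW
  have hW : W.card ≤ N := (Finset.card_le_card Finset.subset_union_right).trans hAW
  have hCW : (C \ W).card + W.card = C.card := Finset.card_sdiff_add_card_eq_card hWC
  have h1 := Nat.mul_le_mul_left s' hE
  rw [mul_add] at h1
  have h2 := Nat.mul_le_mul_right (s' * 2 ^ (2 * M + N) + 2 * M) hBK.le
  have h3 : s' * D * (C \ W).card ≤ s' * D * C.card := Nat.mul_le_mul_left _ (by omega)
  omega

theorem edge_bound_of_path (r k N K D : ℕ) : ∀ j : ℕ, ∃ s M : ℕ, 0 < s ∧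
    ∀ (V : Type) [DecidableEq V] (H : Finset (Finset V)) (A C X : Finset V) (u w : V)
      (E : Finset (Finset V)) (f : Finset V), (∀ h ∈ H, h.card = r) → ¬ HasBergePath H k →
      (∀ A' : Finset V, A'.card ≤ N → ¬ HasBlocks H A' K D) → PathOn H u w X E →
      k + 1 ≤ X.card + j → f ∈ H → u ∈ f → Disjoint X C → (∀ e ∈ E, Disjoint e C) →
      (f ∩ C).Nonempty → CutConnected H C → (∀ e ∈ H, (e ∩ C).Nonempty → e ⊆ C ∪ A) →
      Disjoint A C → A.card + r * j ≤ N →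
      s * (edgesMeeting H C).card + C.card ≤ s * D * C.card + M := by
  intro j
  induction j with
  | zero =>
    refine ⟨1, 0, one_pos, ?_⟩
    intro V _ H A C X u w E f _ hk _ hp hX
    have := hp.card_le hk
    omega
  | succ j ih =>
    obtain ⟨s, M, hs, ih⟩ := ih
    refine ⟨2 * s + 2 * M, K * ((2 * s + 2 * M) * 2 ^ (2 * M + N) + 2 * M) +
      (2 * s + 2 * M) * 2 ^ N + N, by omega, ?_⟩
    intro V _ H A C X u w E f hr hk hstar hp hX hf hu hXC hEC hfC hC hloc hAC hAN
    obtain ⟨P, hP, hPd, hPU⟩ := exists_pieces H (C \ (f ∩ C))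
    have hWcard : (f ∩ C).card ≤ r := by
      rw [← hr f hf]; exact Finset.card_le_card Finset.inter_subset_left
    have hAW : (A ∪ f ∩ C).card + r * j ≤ N := by
      have := Finset.card_union_le A (f ∩ C)
      rw [mul_add, mul_one] at hAN
      omega
    have hloc' : ∀ C' ∈ P, ∀ e ∈ H, (e ∩ C').Nonempty → e ⊆ C' ∪ (A ∪ f ∩ C) := by
      intro C' hC' e he hec x hx
      have h1 := (hP C' hC').2.2.2 e he hec
      have h2 := hloc e he (hec.mono (Finset.inter_subset_inter_left
        ((hP C' hC').2.1.trans Finset.sdiff_subset))) hx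
      simp only [Finset.mem_union, Finset.mem_inter] at h2 ⊢
      by_cases h3 : x ∈ f
      · tauto
      · rcases h2 with h2 | h2
        · exact Or.inl (h1 (by simp [hx, h2, h3]))
        · tauto
    refine edge_bound_of_pieces (fun C' hC' => ⟨(hP C' hC').1, (hP C' hC').2.1⟩) hPd hPU
      Finset.inter_subset_right hAC (by omega) hloc hloc' (hstar _ (by omega)) ?_
    intro C' hC'
    obtain ⟨h1, h2, h3, h4⟩ := hP C' hC'
    have hC'C : C' ⊆ C := h2.trans Finset.sdiff_subset
    have hne : C' ≠ C := by
      rintro rfl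
      obtain ⟨x, hx⟩ := hfC
      have := h2 (Finset.mem_inter.1 hx).2
      simp_all
    obtain ⟨f', hf', hf'1, x, hx⟩ := hC C' hC'C h1 hne
    have hf'e := h4 f' hf' hf'1
    simp only [Finset.mem_inter, Finset.mem_sdiff] at hx
    have hxf : x ∈ f := by
      by_contra hxf
      exact hx.2.2 (hf'e (by simp [hx, hxf]))
    have hxX : x ∉ X := fun h => Finset.disjoint_left.1 hXC h hx.2.1
    have hfE : f ∉ E := by
      intro h
      obtain ⟨y, hy⟩ := hfC
      rw [Finset.mem_inter] at hy
      exact Finset.disjoint_left.1 (hEC f h) hy.1 hy.2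
    refine ih V H (A ∪ f ∩ C) C' _ x w _ f' hr hk hstar (.cons hp hf hxf hu hxX hfE) ?_ hf' hx.1
      ?_ ?_ hf'1 h3 (hloc' C' hC') ?_ hAW
    · rw [Finset.card_insert_of_notMem hxX]; omega
    · rw [Finset.disjoint_insert_left]
      exact ⟨fun h => hx.2.2 h, Finset.disjoint_of_subset_right hC'C hXC⟩
    · intro e he
      rcases Finset.mem_insert.1 he with rfl | he
      · rw [Finset.disjoint_left]
        intro y hy hy'
        have := h2 hy'
        simp_all
      · exact Finset.disjoint_of_subset_right hC'C (hEC e he)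
    · rw [Finset.disjoint_union_left]
      refine ⟨Finset.disjoint_of_subset_right hC'C hAC, ?_⟩
      exact Finset.disjoint_of_subset_right h2 Finset.disjoint_sdiff

/-- A connected hypergraph with bounded Berge-paths and at least about `D * |V|` edges has many
blocks attached to a bounded set. -/
theorem exists_hasBlocks (r k : ℕ) (hr : 0 < r) : ∃ N, ∀ c K D, ∃ n₀,
    ∀ (V : Type) [Fintype V] [DecidableEq V] (H : Finset (Finset V)), n₀ ≤ Fintype.card V →
    (∀ h ∈ H, h.card = r) → ¬ HasBergePath H k → BergeConnected H →
    D * Fintype.card V ≤ H.card + c →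
    ∃ A : Finset V, A.card ≤ N ∧ HasBlocks H A K D := by
  refine ⟨1 + r * k, fun c K D => ?_⟩
  obtain ⟨s, M, hs, hsM⟩ := edge_bound_of_path r k (1 + r * k) K D k
  refine ⟨(K * ((2 * s + 2 * M) * 2 ^ (2 * M + (1 + r * k)) + 2 * M) +
      (2 * s + 2 * M) * 2 ^ (1 + r * k) + (1 + r * k)) + (2 * s + 2 * M) * c + 1, ?_⟩
  intro V _ _ H hn hHr hk hconn hcard
  by_contra! hno
  obtain ⟨v⟩ : Nonempty V := Fintype.card_pos_iff.1 (by omega)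
  obtain ⟨P, hP, hPd, hPU⟩ := exists_pieces H (Finset.univ \ {v})
  have hloc' : ∀ C' ∈ P, ∀ e ∈ H, (e ∩ C').Nonempty → e ⊆ C' ∪ (∅ ∪ {v}) := by
    intro C' hC' e he hec x hx
    have h1 := (hP C' hC').2.2.2 e he hec
    by_cases h : x = v
    · simp [h]
    · exact Finset.mem_union_left _ (h1 (by simp [hx, h]))
  have key := edge_bound_of_pieces (H := H) (A := ∅) (W := {v}) (C := Finset.univ) (K := K)
    (D := D) (N := 1 + r * k) (fun C' hC' => ⟨(hP C' hC').1, (hP C' hC').2.1⟩) hPd hPU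
    (Finset.subset_univ _) (Finset.disjoint_empty_left _) (by simp) (by simp) hloc'
    (hno _ (by simp)) (fun C' hC' => ?_) (s := s) (M := M)
  · have hall : edgesMeeting H Finset.univ = H := by
      refine Finset.filter_true_of_mem fun e he => ?_
      rw [Finset.inter_univ, ← Finset.card_pos, hHr e he]
      exact hr
    rw [hall, Finset.card_univ] at key
    have h1 := Nat.mul_le_mul_left (2 * s + 2 * M) hcard
    rw [mul_add, ← mul_assoc] at h1
    omega
  · obtain ⟨h1, h2, h3, h4⟩ := hP C' hC'
    have hvC : v ∉ C' := fun h => by simpa using h2 h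
    obtain ⟨f, hf, hf1, x, hx⟩ := hconn.cutConnected_univ C' (Finset.subset_univ _) h1
      (fun h => hvC (h ▸ Finset.mem_univ _))
    simp only [Finset.mem_inter, Finset.mem_sdiff, Finset.mem_univ, true_and] at hx
    have hxv : x = v := by
      have := hloc' C' hC' f hf hf1 hx.1
      simpa [hx.2] using this
    subst hxv
    refine hsM V H {x} C' {x} x x ∅ f hHr hk hno (.single x) (by simp) hf hx.1 (by simpa)
      (by simp) hf1 h3 ?_ (by simpa) (by simp)
    simpa using hloc' C' hC'

end Blocks

section Binomials

theorem le_choose_of_lt {b m : ℕ} (hm : 1 ≤ m) (hb : m < b) : b ≤ b.choose m := by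
  induction b with
  | zero => omega
  | succ b ih =>
    obtain ⟨m, rfl⟩ : ∃ m', m = m' + 1 := ⟨m - 1, by omega⟩
    rw [Nat.choose_succ_succ']
    rcases Nat.lt_succ_iff_lt_or_eq.1 hb with h | h
    · have := ih h
      have := Nat.choose_pos (n := b) (k := m) (by omega)
      omega
    · subst h
      simp [Nat.choose_succ_self_right]

theorem choose_add_le {b m g : ℕ} (hm : 1 ≤ m) (hb : m < b) (hg : g ≤ b) :
    g.choose m + b ≤ b.choose m + g := by
  by_cases hgm : g < m
  · rw [Nat.choose_eq_zero_of_lt hgm]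
    have := le_choose_of_lt hm hb
    omega
  · clear hb
    induction b, hg using Nat.le_induction with
    | base => rfl
    | succ b hgb ih =>
      obtain ⟨m, rfl⟩ : ∃ m', m = m' + 1 := ⟨m - 1, by omega⟩
      rw [Nat.choose_succ_succ' b m]
      have := Nat.choose_pos (n := b) (k := m) (by omega)
      omega

theorem two_mul_le_choose {a r : ℕ} (hr : 3 ≤ r) (ha : r + 30 ≤ a) :
    2 * a ≤ (a - 1).choose (r - 1) + 4 := by
  obtain ⟨b, rfl⟩ : ∃ b, a = b + 2 := ⟨a - 2, by omega⟩
  obtain ⟨m, rfl⟩ : ∃ m, r = m + 2 := ⟨r - 2, by omega⟩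
  rw [show b + 2 - 1 = b + 1 by omega, show m + 2 - 1 = m + 1 by omega, Nat.choose_succ_succ']
  have h1 := le_choose_of_lt (b := b) (m := m) (by omega) (by omega)
  have h2 := le_choose_of_lt (b := b) (m := m + 1) (by omega) (by omega)
  omega

theorem choose_sub_four_lt {a r : ℕ} (hr : 3 ≤ r) (ha : r + 30 ≤ a) :
    (a - 4).choose (r - 1) + a < (a - 1).choose (r - 1) := by
  obtain ⟨b, rfl⟩ : ∃ b, a = b + 4 := ⟨a - 4, by omega⟩
  obtain ⟨m, rfl⟩ : ∃ m, r = m + 2 := ⟨r - 2, by omega⟩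
  rw [show b + 4 - 1 = b + 1 + 1 + 1 by omega, show m + 2 - 1 = m + 1 by omega,
    Nat.choose_succ_succ', Nat.choose_succ_succ' (b + 1), Nat.choose_succ_succ' b,
    show b + 4 - 4 = b by omega]
  have h1 := le_choose_of_lt (b := b) (m := m) (by omega) (by omega)
  have h2 := le_choose_of_lt (b := b + 1) (m := m) (by omega) (by omega)
  have h3 := le_choose_of_lt (b := b + 1 + 1) (m := m) (by omega) (by omega)
  omega

theorem choose_succ_add_lt {a r : ℕ} (hr : 3 ≤ r) (ha : r + 30 ≤ a) :
    (a + 1).choose r + a < (a - 1).choose (r - 1) * (a - 3) := by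
  have hD := two_mul_le_choose hr ha
  obtain ⟨b, rfl⟩ : ∃ b, a = b + 1 := ⟨a - 1, by omega⟩
  obtain ⟨m, rfl⟩ : ∃ m, r = m + 1 := ⟨r - 1, by omega⟩
  simp only [Nat.add_sub_cancel] at hD ⊢
  have h1 := Nat.add_one_mul_choose_eq (b + 1) m
  have h2 := Nat.choose_mul_succ_eq b m
  obtain ⟨t, rfl⟩ : ∃ t, b = m + t := ⟨b - m, by omega⟩
  rw [show m + t + 1 - m = t + 1 by omega] at h2
  obtain ⟨s, hs⟩ : ∃ s, m + t + 1 - 3 = s ∧ m + t + 1 = s + 3 := ⟨_, rfl, by omega⟩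
  rw [hs.1]
  set D := (m + t).choose m
  set C := (m + t + 1 + 1).choose (m + 1)
  set C' := (m + t + 1).choose m
  have h3 : 2 * (m + t + 2) ≤ (m + 1) * (t + 1) := by nlinarith
  have h4 : C * ((m + 1) * (t + 1)) = (m + t + 2) * ((m + t + 1) * D) := by
    calc C * ((m + 1) * (t + 1)) = (C * (m + 1)) * (t + 1) := by ring
      _ = (m + t + 2) * (C' * (t + 1)) := by rw [← h1]; ring
      _ = _ := by rw [← h2]; ring
  have h5 : 2 * C ≤ (m + t + 1) * D := by
    have := Nat.mul_le_mul_left C h3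
    rw [h4] at this
    have h6 : (m + t + 2) * (2 * C) ≤ (m + t + 2) * ((m + t + 1) * D) := by
      calc _ = C * (2 * (m + t + 2)) := by ring
        _ ≤ _ := this
    exact Nat.le_of_mul_le_mul_left h6 (by omega)
  have h7 : 28 ≤ s := by omega
  rw [hs.2] at h5 hD ⊢
  nlinarith

end Binomials

section Block

variable {V : Type*} [DecidableEq V]

theorem card_le_choose_of_forall_mem {F : Finset (Finset V)} {v : V} {U : Finset V} {r : ℕ}
    (hF : ∀ g ∈ F, g.card = r ∧ v ∈ g ∧ g.erase v ⊆ U) : F.card ≤ U.card.choose (r - 1) := by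
  rw [← Finset.card_powersetCard]
  refine Finset.card_le_card_of_injOn (fun g => g.erase v) ?_ ?_
  · intro g hg
    obtain ⟨h1, h2, h3⟩ := hF g hg
    rw [Finset.mem_coe, Finset.mem_powersetCard]
    exact ⟨h3, by rw [Finset.card_erase_of_mem h2, h1]⟩
  · intro g hg g' hg' h
    rw [← Finset.insert_erase (hF g hg).2.1, ← Finset.insert_erase (hF g' hg').2.1]
    exact congrArg _ h

/-- A set `S` with at least two elements whose edges, all in `S ∪ A`, are spread out densely. -/
structure IsDenseBlock (G : Finset (Finset V)) (A S : Finset V) (r D : ℕ) : Prop where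
  disjoint : Disjoint S A
  card_edge : ∀ e ∈ G, e.card = r
  subset : ∀ e ∈ G, e ⊆ S ∪ A
  meets : ∀ e ∈ G, (e ∩ S).Nonempty
  dense : ∀ T ⊆ S, T.Nonempty → D * T.card ≤ (G.filter fun e => (e ∩ T).Nonempty).card
  two_le : ∀ x ∈ S, ∃ e ∈ G, ∃ e' ∈ G, e ≠ e' ∧ x ∈ e ∧ x ∈ e' ∧ (e ∩ S.erase x).Nonempty ∧
    (e' ∩ S.erase x).Nonempty

theorem IsDenseBlock.exists_path {G : Finset (Finset V)} {A S : Finset V} {a r : ℕ}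
    (hr : 3 ≤ r) (ha : r + 30 ≤ a) (h : IsDenseBlock G A S r ((a - 1).choose (r - 1))) {z : V}
    (hz : z ∈ S ∨ z ∈ A ∧ ∃ e ∈ G, z ∈ e) :
    ∃ v ∈ S, ∃ X E, PathOn G z v X E ∧ X.erase z ⊆ S ∧ ∃ Z ⊆ A.erase z,
      (∀ y ∈ Z, ∃ g ∈ G, g ∉ E ∧ v ∈ g ∧ y ∈ g) ∧ a ≤ X.card + Z.card + 2 ∧
      (z ∈ A → 3 ≤ X.card) ∧ (Z = ∅ → a + 2 ≤ X.card) := by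
  classical
  set D := (a - 1).choose (r - 1) with hD
  let Q : ℕ → Prop := fun n => ∃ v ∈ S, ∃ X E, PathOn G z v X E ∧ X.erase z ⊆ S ∧ X.card = n
  have hbd : ∀ n, Q n → n ≤ S.card + 1 := by
    rintro n ⟨v, -, X, E, -, hX, rfl⟩
    have := Finset.card_le_card hX
    have := Finset.pred_card_le_card_erase (s := X) (a := z)
    omega
  have hQ3 : z ∈ A → Q 3 := by
    intro hzA
    have hzS : z ∉ S := fun hzS => Finset.disjoint_left.1 h.disjoint hzS hzA
    obtain ⟨-, e, he, hze⟩ := hz.resolve_left hzS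
    obtain ⟨x, hx⟩ := h.meets e he
    rw [Finset.mem_inter] at hx
    obtain ⟨g, hg, hge, hxg, y, hy⟩ : ∃ g ∈ G, g ≠ e ∧ x ∈ g ∧ (g ∩ S.erase x).Nonempty := by
      obtain ⟨g, hg, g', hg', hne, h1, h2, h3, h4⟩ := h.two_le x hx.2
      by_cases hge : g = e
      · exact ⟨g', hg', fun h' => hne (hge.trans h'.symm), h2, h4⟩
      · exact ⟨g, hg, hge, h1, h3⟩
    simp only [Finset.mem_inter, Finset.mem_erase] at hy
    have hzx : z ≠ x := by rintro rfl; exact hzS hx.2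
    have hzy : z ≠ y := by rintro rfl; exact hzS hy.2.2
    refine ⟨y, hy.2.2, _, _, .cons (.cons (.single y) hg hxg hy.1 ?_ ?_) he hze hx.1 ?_ ?_, ?_, ?_⟩
    · simpa using hy.2.1.symm
    · simp
    · simp [hzx, hzy]
    · simpa using hge.symm
    · intro t; simp only [Finset.mem_erase, Finset.mem_insert, Finset.mem_singleton]
      rintro ⟨h1, rfl | rfl | rfl⟩
      exacts [absurd rfl h1, hx.2, hy.2.2]
    · rw [Finset.card_insert_of_notMem (by simp [hzx, hzy]),
        Finset.card_insert_of_notMem (by simpa using hy.2.1.symm), Finset.card_singleton]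
  have hQ : ∃ n, Q n := by
    rcases hz with hzS | ⟨hzA, -⟩
    · exact ⟨1, z, hzS, {z}, ∅, .single z, by simp, by simp⟩
    · exact ⟨3, hQ3 hzA⟩
  obtain ⟨n, hn, hmax⟩ : ∃ n, Q n ∧ ∀ m, Q m → m ≤ n := by
    obtain ⟨n₀, hn₀⟩ := hQ
    exact ⟨Nat.findGreatest Q (S.card + 1), Nat.findGreatest_spec (hbd _ hn₀) hn₀,
      fun m hm => Nat.le_findGreatest (hbd _ hm) hm⟩
  by_contra! hcon
  have hna : n ≤ a + 1 := by
    by_contra! hlt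
    obtain ⟨v, hv, X, E, hp, hX, hXn⟩ := hn
    obtain ⟨-, h2⟩ := hcon v hv X E hp hX ∅ (by simp) (by simp) (by simp; omega)
      (fun hzA => by omega)
    omega
  -- every longest path has all new edges at its end inside its vertex set
  have key : ∀ v ∈ S, ∀ X E, PathOn G z v X E → X.erase z ⊆ S → X.card = n →
      (∀ g ∈ G, v ∈ g → g ∉ E → g ⊆ X) ∧ ∃ N ⊆ X.erase v, a ≤ N.card + 3 ∧
        ∀ y ∈ N, ∃ g ∈ G, g ∉ E ∧ v ∈ g ∧ y ∈ g := by
    intro v hv X E hp hX hXn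
    set F := G.filter (fun g => v ∈ g ∧ g ∉ E) with hF
    have hFD : D ≤ F.card + a := by
      have h1 := h.dense {v} (by simpa) (by simp)
      have h2 : G.filter (fun e => (e ∩ {v}).Nonempty) ⊆ F ∪ E := by
        intro e he
        simp only [Finset.mem_filter, hF, Finset.mem_union, Finset.inter_singleton] at he ⊢
        by_cases hve : v ∈ e <;> simp_all; tauto
      have h3 := (Finset.card_le_card h2).trans (Finset.card_union_le _ _)
      have := hp.card_eq
      simp at h1
      omega
    have hext : ∀ g ∈ F, g ∩ S ⊆ X := by
      intro g hg y hy
      rw [hF, Finset.mem_filter] at hg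
      rw [Finset.mem_inter] at hy
      by_contra hyX
      have := hmax (n + 1) ⟨y, hy.2, _, _, hp.snoc hg.1 hg.2.1 hy.1 hyX hg.2.2, ?_, ?_⟩
      · omega
      · intro t ht
        rw [Finset.mem_erase, Finset.mem_insert] at ht
        rcases ht.2 with rfl | h'
        · exact hy.2
        · exact hX (by simp [ht.1, h'])
      · rw [Finset.card_insert_of_notMem hyX, hXn]
    set N := (F.biUnion id).erase v with hN
    have hNg : ∀ y ∈ N, ∃ g ∈ G, g ∉ E ∧ v ∈ g ∧ y ∈ g := by
      intro y hy
      rw [hN, Finset.mem_erase, Finset.mem_biUnion] at hy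
      obtain ⟨-, g, hg, hyg⟩ := hy
      rw [hF, Finset.mem_filter] at hg
      exact ⟨g, hg.1, hg.2.2, hg.2.1, hyg⟩
    have hNcard : a ≤ N.card + 3 := by
      by_contra! hlt
      have h1 : F.card ≤ N.card.choose (r - 1) := card_le_choose_of_forall_mem (v := v)
        fun g hg => ⟨h.card_edge g (Finset.mem_filter.1 hg).1, (Finset.mem_filter.1 hg).2.1,
          Finset.erase_subset_erase _ (Finset.subset_biUnion_of_mem id hg)⟩
      have h2 := Nat.choose_le_choose (r - 1) (show N.card ≤ a - 4 by omega)
      have := choose_sub_four_lt hr ha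
      omega
    set Z := N.filter (fun y => y ∈ A.erase z) with hZ
    have hNX : N ⊆ X.erase v ∪ Z := by
      intro y hy
      have hyv : y ≠ v := (Finset.mem_erase.1 hy).1
      obtain ⟨-, hy'⟩ := Finset.mem_erase.1 hy
      rw [Finset.mem_biUnion] at hy'
      obtain ⟨g, hg, hyg⟩ := hy'
      rcases Finset.mem_union.1 (h.subset g (Finset.mem_filter.1 hg).1 hyg) with h1 | h1
      · exact Finset.mem_union_left _ (Finset.mem_erase.2
          ⟨hyv, hext g hg (Finset.mem_inter.2 ⟨hyg, h1⟩)⟩)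
      · by_cases hyz : y = z
        · exact Finset.mem_union_left _ (Finset.mem_erase.2 ⟨hyv, hyz ▸ hp.head_mem⟩)
        · exact Finset.mem_union_right _ (by simp [hZ, hy, hyz, h1])
    have hcard : a ≤ X.card + Z.card + 2 := by
      have h1 := (Finset.card_le_card hNX).trans (Finset.card_union_le _ _)
      rw [Finset.card_erase_of_mem hp.last_mem] at h1
      have := Finset.card_pos.2 ⟨v, hp.last_mem⟩
      omega
    obtain ⟨hZ0, -⟩ := hcon v hv X E hp hX Z (fun y hy => (Finset.mem_filter.1 hy).2)
      (fun y hy => hNg y (Finset.mem_filter.1 hy).1) hcard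
      (fun hzA => hXn ▸ hmax 3 (hQ3 hzA))
    rw [hZ0, Finset.union_empty] at hNX
    refine ⟨fun g hg hvg hgE y hy => ?_, N, hNX, hNcard, hNg⟩
    by_cases hyv : y = v
    · exact hyv ▸ hp.last_mem
    · refine Finset.mem_of_mem_erase (hNX (Finset.mem_erase.2 ⟨hyv, Finset.mem_biUnion.2
        ⟨g, by simp [hF, hg, hvg, hgE], hy⟩⟩))
  obtain ⟨v, hv, X, E, hp, hX, hXn⟩ := hn
  obtain ⟨h1, N, hNX, hNa, hNg⟩ := key v hv X E hp hX hXn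
  obtain ⟨s, hs, hsx⟩ := hp.exists_succ
  have hTS : N.image s ⊆ S := by
    intro t ht
    obtain ⟨x, hx, rfl⟩ := Finset.mem_image.1 ht
    have hx' := Finset.mem_erase.1 (hNX hx)
    obtain ⟨h2, h3, -⟩ := hsx x hx'.2 hx'.1
    exact hX (Finset.mem_erase.2 ⟨h3, h2⟩)
  have hTcard : (N.image s).card = N.card :=
    Finset.card_image_of_injOn (hs.mono (by exact_mod_cast hNX))
  have hTne : (N.image s).Nonempty := by
    rw [← Finset.card_pos]; omega
  have hle := h.dense _ hTS hTne
  have hsub : G.filter (fun e => (e ∩ N.image s).Nonempty) ⊆ E ∪ X.powersetCard r := by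
    intro g hg
    rw [Finset.mem_filter] at hg
    obtain ⟨hg, t, ht⟩ := hg
    rw [Finset.mem_inter, Finset.mem_image] at ht
    obtain ⟨htg, x, hx, rfl⟩ := ht
    by_cases hgE : g ∈ E
    · exact Finset.mem_union_left _ hgE
    refine Finset.mem_union_right _ (Finset.mem_powersetCard.2 ⟨?_, h.card_edge g hg⟩)
    have hx' := Finset.mem_erase.1 (hNX hx)
    obtain ⟨h2, h3, X₁, X₂, E₁, E₂, e, p1, p2, d1, d2, e1, e2, hxe, hse, rfl, rfl⟩ :=
      hsx x hx'.2 hx'.1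
    obtain ⟨f, hf, hfE, hvf, hxf⟩ := hNg x hx
    by_cases hgf : g = f
    · exact hgf ▸ h1 f hf hvf hfE
    simp only [Finset.mem_insert, Finset.mem_union, not_or] at hfE hgE
    have hp' := p1.append p2.reverse hf hxf hvf d1 d2 hfE.2.1 hfE.2.2
    exact (key _ (hX (Finset.mem_erase.2 ⟨h3, h2⟩)) _ _ hp' hX hXn).1 g hg htg (by
      simp [hgf, hgE])
  have hle2 := (Finset.card_le_card hsub).trans (Finset.card_union_le _ _)
  rw [Finset.card_powersetCard] at hle2
  have hle3 := Nat.choose_le_choose r (show X.card ≤ a + 1 by omega)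
  have hle4 := choose_succ_add_lt hr ha
  rw [← hD] at hle4
  have hle5 := Nat.mul_le_mul_left D (show a - 3 ≤ (N.image s).card by omega)
  have := hp.card_eq
  omega

end Block

section LargeBlocks

variable {V : Type*} [DecidableEq V]

theorem PathOn.glue {H : Finset (Finset V)} {u z w : V} {X Y : Finset V} {E F : Finset (Finset V)}
    (h : PathOn H u z X E) (h' : PathOn H z w Y F) (hXY : ∀ x ∈ X, x ∈ Y → x = z)
    (hEF : Disjoint E F) : PathOn H u w (X ∪ Y) (E ∪ F) := by
  induction h with
  | single v =>
    rw [Finset.empty_union, Finset.union_eq_right.2 (by simpa using h'.head_mem)]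
    exact h'
  | @cons a b c X' E' f hp hf ha hb haX hfE ih =>
    rw [Finset.disjoint_insert_left] at hEF
    rw [Finset.insert_union, Finset.insert_union]
    refine .cons (ih h' (fun x hx => hXY x (Finset.mem_insert_of_mem hx)) hEF.2) hf ha hb ?_ ?_
    · rw [Finset.mem_union, not_or]
      refine ⟨haX, fun haY => haX ?_⟩
      rw [hXY a (Finset.mem_insert_self _ _) haY]
      exact hp.last_mem
    · simp [hfE, hEF.1]

theorem PathOn.card_glue {H : Finset (Finset V)} {u z w : V} {X Y : Finset V}
    {E F : Finset (Finset V)} (h : PathOn H u z X E) (h' : PathOn H z w Y F)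
    (hXY : ∀ x ∈ X, x ∈ Y → x = z) : (X ∪ Y).card + 1 = X.card + Y.card := by
  have : X ∩ Y = {z} := by
    ext x
    rw [Finset.mem_inter, Finset.mem_singleton]
    exact ⟨fun hx => hXY x hx.1 hx.2, by rintro rfl; exact ⟨h.last_mem, h'.head_mem⟩⟩
  rw [← Finset.card_union_add_card_inter, this, Finset.card_singleton]

theorem PathOn.exists_two_of_mem {H : Finset (Finset V)} {u w : V} {X : Finset V}
    {E : Finset (Finset V)} (h : PathOn H u w X E) {e : Finset V} (he : e ∈ E) :
    ∃ x ∈ X, ∃ y ∈ X, x ≠ y ∧ x ∈ e ∧ y ∈ e := by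
  induction h with
  | single => simp at he
  | @cons a b c X' E' f hp hf ha hb haX hfE ih =>
    rcases Finset.mem_insert.1 he with rfl | he
    · exact ⟨a, by simp, b, by simp [hp.head_mem], fun h => haX (h ▸ hp.head_mem), ha, hb⟩
    · obtain ⟨x, hx, y, hy, h⟩ := ih he
      exact ⟨x, by simp [hx], y, by simp [hy], h⟩

theorem exists_minimal_block {H : Finset (Finset V)} {A S : Finset V} {D : ℕ} (hS : S.Nonempty)
    (hD : D * S.card ≤ (blockEdges H A S).card) :
    ∃ T ⊆ S, T.Nonempty ∧ D * T.card ≤ (blockEdges H A T).card ∧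
      ∀ T' ⊂ T, T'.Nonempty → (blockEdges H A T').card < D * T'.card := by
  induction S using Finset.strongInduction with
  | H S ih =>
    by_cases h : ∀ T' ⊂ S, T'.Nonempty → (blockEdges H A T').card < D * T'.card
    · exact ⟨S, subset_rfl, hS, hD, h⟩
    · push Not at h
      obtain ⟨T', hT', hne, hle⟩ := h
      obtain ⟨T, hT, h⟩ := ih T' hT' hne hle
      exact ⟨T, hT.trans hT'.1, h⟩

theorem isDenseBlock_of_minimal {H : Finset (Finset V)} {A S : Finset V} {r D : ℕ}
    (hr : ∀ e ∈ H, e.card = r) (hSA : Disjoint S A) (hS2 : 2 ≤ S.card)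
    (hD : D * S.card ≤ (blockEdges H A S).card)
    (hmin : ∀ T ⊂ S, T.Nonempty → (blockEdges H A T).card < D * T.card) :
    IsDenseBlock (blockEdges H A S) (A.filter fun z => ∃ e ∈ blockEdges H A S, z ∈ e) S r D where
  disjoint := Finset.disjoint_of_subset_right (Finset.filter_subset _ _) hSA
  card_edge e he := hr e (Finset.mem_filter.1 he).1
  subset e he x hx := by
    have := (Finset.mem_filter.1 he).2.1 hx
    rw [Finset.mem_union] at this ⊢
    exact this.imp_right fun h => Finset.mem_filter.2 ⟨h, e, he, hx⟩
  meets e he := (Finset.mem_filter.1 he).2.2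
  dense T hT hne := by
    rcases eq_or_ne T S with rfl | hTS
    · rwa [Finset.filter_true_of_mem fun e he => (Finset.mem_filter.1 he).2.2]
    have h1 := hmin (S \ T) (Finset.sdiff_ssubset hT hne) (by
      rw [Finset.sdiff_nonempty]; exact fun h => hTS (hT.antisymm h))
    have h2 : (blockEdges H A S).filter (fun e => ¬ (e ∩ T).Nonempty) ⊆
        blockEdges H A (S \ T) := by
      intro e he
      simp only [blockEdges, Finset.mem_filter] at he ⊢
      obtain ⟨⟨he, hsub, x, hx⟩, hT'⟩ := he
      rw [Finset.not_nonempty_iff_eq_empty] at hT'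
      have h3 : ∀ y ∈ e, y ∉ T := fun y hy hyT => by
        have : y ∈ e ∩ T := Finset.mem_inter.2 ⟨hy, hyT⟩
        simp [hT'] at this
      rw [Finset.mem_inter] at hx
      refine ⟨he, fun y hy => ?_, x, by simp [hx.1, hx.2, h3 x hx.1]⟩
      have := hsub hy
      simp only [Finset.mem_union, Finset.mem_sdiff] at this ⊢
      exact this.imp_left fun h => ⟨h, h3 y hy⟩
    have h3 := Finset.card_filter_add_card_filter_not (s := blockEdges H A S)
      (fun e => (e ∩ T).Nonempty)
    have h4 := Finset.card_le_card h2
    have h5 : D * S.card = D * T.card + D * (S \ T).card := by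
      rw [← mul_add, ← Finset.card_sdiff_add_card_eq_card hT, add_comm]
    omega
  two_le x hx := by
    have hx1 : ({x} : Finset V) ⊂ S := by
      refine Finset.ssubset_iff_subset_ne.2 ⟨by simpa, fun h => ?_⟩
      rw [← h] at hS2; simp at hS2
    have hx2 : S.erase x ⊂ S := Finset.erase_ssubset hx
    have h1 := hmin _ hx1 (by simp)
    have h2 := hmin _ hx2 (by
      rw [← Finset.card_pos, Finset.card_erase_of_mem hx]; omega)
    set F := (blockEdges H A S).filter (fun e => x ∈ e ∧ (e ∩ S.erase x).Nonempty) with hF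
    have h3 : blockEdges H A S ⊆ F ∪ (blockEdges H A {x} ∪ blockEdges H A (S.erase x)) := by
      intro e he
      have he' := he
      simp only [blockEdges, Finset.mem_filter] at he'
      obtain ⟨heH, hsub, y, hy⟩ := he'
      rw [Finset.mem_inter] at hy
      by_cases hxe : x ∈ e
      · by_cases hne : (e ∩ S.erase x).Nonempty
        · exact Finset.mem_union_left _ (Finset.mem_filter.2 ⟨he, hxe, hne⟩)
        · refine Finset.mem_union_right _ (Finset.mem_union_left _
            (Finset.mem_filter.2 ⟨heH, fun t ht => ?_, x, by simp [hxe]⟩))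
          have := hsub ht
          rw [Finset.mem_union] at this ⊢
          refine this.imp_left fun h => ?_
          by_contra htx
          exact hne ⟨t, Finset.mem_inter.2 ⟨ht, Finset.mem_erase.2 ⟨by simpa using htx, h⟩⟩⟩
      · refine Finset.mem_union_right _ (Finset.mem_union_right _
          (Finset.mem_filter.2 ⟨heH, fun t ht => ?_, y, ?_⟩))
        · have := hsub ht
          rw [Finset.mem_union] at this ⊢
          refine this.imp_left fun h => Finset.mem_erase.2 ⟨?_, h⟩
          rintro rfl; exact hxe ht
        · simp only [Finset.mem_inter, Finset.mem_erase]
          refine ⟨hy.1, ?_, hy.2⟩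
          rintro rfl; exact hxe hy.1
    have h4 := (Finset.card_le_card h3).trans ((Finset.card_union_le _ _).trans
      (add_le_add_right (Finset.card_union_le _ _) _))
    have h5 : D * S.card = D * (S.erase x).card + D * ({x} : Finset V).card := by
      rw [← mul_add, Finset.card_singleton, Finset.card_erase_add_one hx]
    obtain ⟨e, he, e', he', hne⟩ := Finset.one_lt_card.1 (show 1 < F.card by omega)
    rw [hF, Finset.mem_filter] at he he'
    exact ⟨e, he.1, e', he'.1, hne, he.2.1, he'.2.1, he.2.2, he'.2.2⟩

theorem disjoint_blockEdges {H : Finset (Finset V)} {A S S' : Finset V} (hSS : Disjoint S S')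
    (hSA : Disjoint S' A) : Disjoint (blockEdges H A S) (blockEdges H A S') := by
  rw [Finset.disjoint_left]
  intro e he he'
  simp only [blockEdges, Finset.mem_filter] at he he'
  obtain ⟨x, hx⟩ := he'.2.2
  rw [Finset.mem_inter] at hx
  rcases Finset.mem_union.1 (he.2.1 hx.1) with h | h
  · exact Finset.disjoint_left.1 hSS h hx.2
  · exact Finset.disjoint_left.1 hSA hx.2 h

theorem false_of_isolated_blocks {H : Finset (Finset V)} {A S T : Finset V} {a r : ℕ}
    (hr : 3 ≤ r) (ha : r + 30 ≤ a) (hconn : BergeConnected H) (hk : ¬ HasBergePath H (2 * a + 1))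
    (hS : IsDenseBlock (blockEdges H A S) ∅ S r ((a - 1).choose (r - 1)))
    (hT : IsDenseBlock (blockEdges H A T) ∅ T r ((a - 1).choose (r - 1)))
    (hSne : S.Nonempty) (hTne : T.Nonempty) (hST : Disjoint S T) (hTA : Disjoint T A) : False := by
  obtain ⟨s, hs⟩ := hSne
  obtain ⟨t, ht, X', E', hp', hX'⟩ := hconn.exists_path hTne s
  obtain ⟨s', hs', X, hXX, E, hEE, hp, hX⟩ := hp'.reverse.exists_first hs
  have hE : ∀ e ∈ E, e ∉ blockEdges H A S ∧ e ∉ blockEdges H A T := by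
    intro e he
    obtain ⟨x, hx, y, hy, hxy, hxe, hye⟩ := hp.exists_two_of_mem he
    refine ⟨fun h => hxy ?_, fun h => hxy ?_⟩
    · have := hS.subset e h
      rw [Finset.union_empty] at this
      rw [hX x hx (this hxe), hX y hy (this hye)]
    · have := hT.subset e h
      rw [Finset.union_empty] at this
      rw [hX' x (hXX hx) (this hxe), hX' y (hXX hy) (this hye)]
  obtain ⟨v, hv, Y, F, q, hY, Z, hZ, -, -, -, hYc⟩ := hS.exists_path hr ha (Or.inl hs')
  obtain ⟨v', hv', Y', F', q', hY', Z', hZ', -, -, -, hYc'⟩ := hT.exists_path hr ha (Or.inl ht)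
  replace hYc := hYc (by simpa using hZ)
  replace hYc' := hYc' (by simpa using hZ')
  have hYS : Y ⊆ S := fun y hy => by
    by_cases h : y = s'
    · exact h ▸ hs'
    · exact hY (Finset.mem_erase.2 ⟨h, hy⟩)
  have hYT : Y' ⊆ T := fun y hy => by
    by_cases h : y = t
    · exact h ▸ ht
    · exact hY' (Finset.mem_erase.2 ⟨h, hy⟩)
  have hmono := q.mono (H' := H) (q.edges_subset.trans (Finset.filter_subset _ _))
  have hmono' := q'.mono (H' := H) (q'.edges_subset.trans (Finset.filter_subset _ _))
  have hXY : ∀ x ∈ X, x ∈ Y → x = s' := fun x hx hy => hX x hx (hYS hy)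
  have g1 := hp.glue hmono hXY (Finset.disjoint_left.2 fun e he he' =>
    (hE e he).1 (q.edges_subset he'))
  have c1 := hp.card_glue hmono hXY
  have hXY' : ∀ x ∈ X ∪ Y, x ∈ Y' → x = t := by
    intro x hx hy
    rcases Finset.mem_union.1 hx with hx | hx
    · exact hX' x (hXX hx) (hYT hy)
    · exact absurd (hYT hy) (Finset.disjoint_left.1 hST (hYS hx))
  have g2 := hmono'.reverse.glue g1 (fun x h h' => hXY' x h' h) (by
    rw [Finset.disjoint_right]
    intro e he he'
    rcases Finset.mem_union.1 he with he | he
    · exact (hE e he).2 (q'.edges_subset he')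
    · exact Finset.disjoint_left.1 (disjoint_blockEdges hST hTA) (q.edges_subset he)
        (q'.edges_subset he'))
  have c2 := hmono'.reverse.card_glue g1 (fun x h h' => hXY' x h' h)
  have := g2.card_le hk
  have := Finset.card_pos.2 ⟨_, hp.head_mem⟩
  omega

/-- A path from the hub `z` through a block ending near `h` further hubs. -/
def BlockPath (G : Finset (Finset V)) (A S : Finset V) (a : ℕ) (z : V) (h : ℕ) : Prop :=
  ∃ v ∈ S, ∃ X E, PathOn G z v X E ∧ X.erase z ⊆ S ∧ ∃ Z ⊆ A.erase z,
    (∀ y ∈ Z, ∃ g ∈ G, g ∉ E ∧ v ∈ g ∧ y ∈ g) ∧ Z.card = h ∧ a ≤ X.card + h + 2 ∧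
    3 ≤ X.card ∧ (h = 0 → a + 2 ≤ X.card)

theorem IsDenseBlock.exists_blockPath {G : Finset (Finset V)} {A S : Finset V} {a r : ℕ}
    (hr : 3 ≤ r) (ha : r + 30 ≤ a) (h : IsDenseBlock G A S r ((a - 1).choose (r - 1))) {z : V}
    (hz : z ∈ A) (hzG : ∃ e ∈ G, z ∈ e) : ∃ m, BlockPath G A S a z m := by
  obtain ⟨v, hv, X, E, hp, hX, Z, hZ, hZg, h1, h2, h3⟩ := h.exists_path hr ha (Or.inr ⟨hz, hzG⟩)
  exact ⟨Z.card, v, hv, X, E, hp, hX, Z, hZ, hZg, rfl, h1, h2 hz,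
    fun h => h3 (Finset.card_eq_zero.1 h)⟩

theorem false_of_linked_blocks {H : Finset (Finset V)} {A A₀ : Finset V} {a : ℕ} (ha : 12 ≤ a)
    (hk : ¬ HasBergePath H (2 * a + 1)) (hA : A ⊆ A₀) {𝒮 : Finset (Finset V)}
    (hcard : A.card + 2 ≤ 𝒮.card) (hdisj : (𝒮 : Set (Finset V)).PairwiseDisjoint id)
    (hSA : ∀ S ∈ 𝒮, Disjoint S A₀) {z : V} {h : ℕ} (hz : z ∈ A)
    (hzh : ∀ S ∈ 𝒮, BlockPath (blockEdges H A₀ S) A S a z h)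
    (hex : ∀ S ∈ 𝒮, ∀ y ∈ A, ∃ m, BlockPath (blockEdges H A₀ S) A S a y m)
    (hmin : ∀ S ∈ 𝒮, ∀ y ∈ A, ∀ m, BlockPath (blockEdges H A₀ S) A S a y m → h ≤ m) :
    False := by
  have hmono : ∀ {S u w X E}, PathOn (blockEdges H A₀ S) u w X E → PathOn H u w X E :=
    fun q => q.mono (q.edges_subset.trans (Finset.filter_subset _ _))
  have hglue : ∀ S ∈ 𝒮, ∀ 𝒰 ⊆ 𝒮, S ∉ 𝒰 → ∀ {y w v X E Y F}, PathOn H y w X E →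
      X ⊆ A ∪ 𝒰.biUnion id → E ⊆ 𝒰.biUnion (blockEdges H A₀) →
      PathOn (blockEdges H A₀ S) y v Y F → Y.erase y ⊆ S →
      PathOn H v w (Y ∪ X) (F ∪ E) ∧ (Y ∪ X).card + 1 = Y.card + X.card := by
    intro S hS 𝒰 h𝒰 hS𝒰 y w v X E Y F hp hX hE hq hY
    have h1 : ∀ x ∈ Y, x ∈ X → x = y := by
      intro x hxY hxX
      by_contra hxy
      have hxS := hY (Finset.mem_erase.2 ⟨hxy, hxY⟩)
      rcases Finset.mem_union.1 (hX hxX) with hxA | hxU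
      · exact Finset.disjoint_left.1 (hSA S hS) hxS (hA hxA)
      · obtain ⟨T, hT, hxT⟩ := Finset.mem_biUnion.1 hxU
        exact Finset.disjoint_left.1 (hdisj hS (h𝒰 hT) (fun h => hS𝒰 (h ▸ hT))) hxS hxT
    refine ⟨(hmono hq).reverse.glue hp h1 ?_, (hmono hq).reverse.card_glue hp h1⟩
    rw [Finset.disjoint_left]
    intro e he he'
    obtain ⟨T, hT, heT⟩ := Finset.mem_biUnion.1 (hE he')
    exact Finset.disjoint_left.1 (disjoint_blockEdges
      (hdisj (h𝒰 hT) hS (fun h => hS𝒰 (h ▸ hT))) (hSA S hS)) heT (hq.edges_subset he)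
  obtain ⟨S₀, hS₀, S₁, hS₁, hne⟩ := Finset.one_lt_card.1 (show 1 < 𝒮.card by omega)
  obtain ⟨v₀, hv₀, X₀, E₀, p₀, hX₀, Z₀, hZ₀, hg₀, hc₀, ha₀, h3₀, h0₀⟩ := hzh S₀ hS₀
  obtain ⟨v₁, hv₁, X₁, E₁, p₁, hX₁, Z₁, hZ₁, hg₁, hc₁, ha₁, h3₁, h0₁⟩ := hzh S₁ hS₁
  have hsub₀ : X₀ ⊆ A ∪ ({S₀} : Finset (Finset V)).biUnion id := by
    intro x hx
    by_cases hxz : x = z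
    · simp [hxz, hz]
    · have := hX₀ (Finset.mem_erase.2 ⟨hxz, hx⟩)
      simp [this]
  obtain ⟨p, pc⟩ := hglue S₁ hS₁ {S₀} (by simpa) (by simpa using hne.symm) (hmono p₀) hsub₀
    (by simpa using p₀.edges_subset) p₁ hX₁
  have hAX : ∀ S ∈ 𝒮, ∀ {Y : Finset V} {y : V}, Y.erase y ⊆ S → ∀ x ∈ A, x ∈ Y → x = y := by
    intro S hS Y y hY x hxA hxY
    by_contra hxy
    exact Finset.disjoint_left.1 (hSA S hS) (hY (Finset.mem_erase.2 ⟨hxy, hxY⟩)) (hA hxA)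
  rcases Nat.eq_zero_or_pos h with rfl | hpos
  · have := p.card_le hk
    have := h0₀ rfl
    have := h0₁ rfl
    omega
  have hstate : ∀ m, ∃ y ∈ A, ∃ w X E, ∃ 𝒰 ⊆ 𝒮, PathOn H y w X E ∧ X ⊆ A ∪ 𝒰.biUnion id ∧
      E ⊆ 𝒰.biUnion (blockEdges H A₀) ∧ (X ∩ A).card = m + 2 ∧ 𝒰.card = m + 2 ∧
      X₀.card + X₁.card + 3 * m ≤ X.card := by
    intro m
    induction m with
    | zero =>
      obtain ⟨y, hy⟩ := Finset.card_pos.1 (hc₁.symm ▸ hpos)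
      obtain ⟨g, hg, hgE, hvg, hyg⟩ := hg₁ y hy
      have hy' := Finset.mem_erase.1 (hZ₁ hy)
      have hyX : y ∉ X₁ ∪ X₀ := by
        rw [Finset.mem_union, not_or]
        exact ⟨fun h => hy'.1 (hAX S₁ hS₁ hX₁ y hy'.2 h),
          fun h => hy'.1 (hAX S₀ hS₀ hX₀ y hy'.2 h)⟩
      have hgE₀ : g ∉ E₀ := fun h => Finset.disjoint_left.1 (disjoint_blockEdges
        (hdisj hS₀ hS₁ hne) (hSA S₁ hS₁)) (p₀.edges_subset h) hg
      refine ⟨y, hy'.2, _, _, _, {S₀, S₁}, ?_,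
        .cons p (Finset.mem_filter.1 hg).1 hyg hvg hyX (by simp [hgE, hgE₀]), ?_, ?_, ?_, ?_, ?_⟩
      · intro S; simp; rintro (rfl | rfl) <;> assumption
      · intro x hx
        simp only [Finset.mem_insert, Finset.mem_union] at hx
        by_cases hxz : x = z
        · simp [hxz, hz]
        rcases hx with rfl | hx | hx
        · simp [hy'.2]
        · have := hX₁ (Finset.mem_erase.2 ⟨hxz, hx⟩)
          simp [this]
        · have := hX₀ (Finset.mem_erase.2 ⟨hxz, hx⟩)
          simp [this]
      · intro e he
        simp only [Finset.mem_insert, Finset.mem_union] at he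
        rcases he with rfl | he | he
        · simp [hg]
        · simp [p₁.edges_subset he]
        · simp [p₀.edges_subset he]
      · have : insert y (X₁ ∪ X₀) ∩ A = {y, z} := by
          ext x
          simp only [Finset.mem_inter, Finset.mem_insert, Finset.mem_union, Finset.mem_singleton]
          constructor
          · rintro ⟨rfl | hx | hx, hxA⟩
            exacts [Or.inl rfl, Or.inr (hAX S₁ hS₁ hX₁ x hxA hx),
              Or.inr (hAX S₀ hS₀ hX₀ x hxA hx)]
          · rintro (rfl | rfl)
            exacts [⟨Or.inl rfl, hy'.2⟩, ⟨Or.inr (Or.inl p₁.head_mem), hz⟩]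
        rw [this, Finset.card_pair hy'.1]
      · rw [Finset.card_pair hne]
      · rw [Finset.card_insert_of_notMem hyX]
        omega
    | succ m ih =>
      obtain ⟨y, hyA, w, X, E, 𝒰, h𝒰, hp, hX, hE, hXA, h𝒰c, hXc⟩ := ih
      have hmA : m + 2 ≤ A.card := hXA ▸ Finset.card_le_card Finset.inter_subset_right
      obtain ⟨S, hS, hS𝒰⟩ : ∃ S ∈ 𝒮, S ∉ 𝒰 := by
        by_contra! hcon
        by_cases hlt : 𝒰.card < 𝒮.card
        · exact absurd (Finset.card_le_card (show 𝒮 ⊆ 𝒰 from hcon)) (by omega)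
        · omega
      obtain ⟨j, hj⟩ := hex S hS y hyA
      have hhj := hmin S hS y hyA j hj
      obtain ⟨v, hv, Y, F, hq, hY, Z, hZ, hZg, hZc, hYa, hY3, -⟩ := hj
      obtain ⟨hg, hgc⟩ := hglue S hS 𝒰 h𝒰 hS𝒰 hp hX hE hq hY
      by_cases hZX : Z ⊆ X
      · exfalso
        have h1 : insert y Z ⊆ X ∩ A := by
          intro x hx
          rw [Finset.mem_inter]
          rcases Finset.mem_insert.1 hx with rfl | hx
          · exact ⟨hp.head_mem, hyA⟩
          · exact ⟨hZX hx, Finset.mem_of_mem_erase (hZ hx)⟩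
        have h2 := Finset.card_le_card h1
        rw [Finset.card_insert_of_notMem (fun h => by simpa using hZ h)] at h2
        have := hg.card_le hk
        omega
      · obtain ⟨x, hx, hxX⟩ := Finset.not_subset.1 hZX
        have hx' := Finset.mem_erase.1 (hZ hx)
        obtain ⟨g, hgG, hgF, hvg, hxg⟩ := hZg x hx
        have hxYX : x ∉ Y ∪ X := by
          rw [Finset.mem_union, not_or]
          exact ⟨fun h => hx'.1 (hAX S hS hY x hx'.2 h), hxX⟩
        have hgE : g ∉ E := by
          intro hgE
          obtain ⟨T, hT, heT⟩ := Finset.mem_biUnion.1 (hE hgE)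
          exact Finset.disjoint_left.1 (disjoint_blockEdges
            (hdisj (h𝒰 hT) hS (fun h => hS𝒰 (h ▸ hT))) (hSA S hS)) heT hgG
        refine ⟨x, hx'.2, _, _, _, insert S 𝒰, ?_,
          .cons hg (Finset.mem_filter.1 hgG).1 hxg hvg hxYX (by simp [hgF, hgE]), ?_, ?_, ?_, ?_,
          ?_⟩
        · exact Finset.insert_subset hS h𝒰
        · intro t ht
          rw [Finset.biUnion_insert]
          simp only [Finset.mem_insert, Finset.mem_union] at ht
          rcases ht with rfl | ht | ht
          · simp [hx'.2]
          · by_cases hty : t = y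
            · simp [hty, hyA]
            · have := hY (Finset.mem_erase.2 ⟨hty, ht⟩)
              simp [this]
          · have := hX ht
            simp only [Finset.mem_union] at this ⊢
            tauto
        · intro e he
          rw [Finset.biUnion_insert]
          simp only [Finset.mem_insert, Finset.mem_union] at he
          rcases he with rfl | he | he
          · simp [hgG]
          · simp [hq.edges_subset he]
          · exact Finset.mem_union_right _ (hE he)
        · have : insert x (Y ∪ X) ∩ A = insert x (X ∩ A) := by
            ext t
            simp only [Finset.mem_inter, Finset.mem_insert, Finset.mem_union]
            constructor
            · rintro ⟨rfl | ht | ht, htA⟩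
              · exact Or.inl rfl
              · rw [hAX S hS hY t htA ht]
                exact Or.inr ⟨hp.head_mem, hyA⟩
              · exact Or.inr ⟨ht, htA⟩
            · rintro (rfl | ⟨h1, h2⟩)
              exacts [⟨Or.inl rfl, hx'.2⟩, ⟨Or.inr (Or.inr h1), h2⟩]
          rw [this, Finset.card_insert_of_notMem (by simp [hxX]), hXA]
        · rw [Finset.card_insert_of_notMem hS𝒰, h𝒰c]
        · rw [Finset.card_insert_of_notMem hxYX]
          omega
  obtain ⟨y, -, w, X, E, 𝒰, -, -, -, -, hXA, -⟩ := hstate A.card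
  have := Finset.card_le_card (Finset.inter_subset_right : X ∩ A ⊆ A)
  omega

theorem false_of_large_blocks {H : Finset (Finset V)} {A₀ : Finset V} {a r N : ℕ} (hr : 3 ≤ r)
    (ha : r + 30 ≤ a) (hconn : BergeConnected H) (hk : ¬ HasBergePath H (2 * a + 1))
    (hN : A₀.card ≤ N) {𝒮 : Finset (Finset V)}
    (hcard : 2 ^ N * (N * (N + 1)) * (N + 1) + 3 ≤ 𝒮.card)
    (hdisj : (𝒮 : Set (Finset V)).PairwiseDisjoint id)
    (hS : ∀ S ∈ 𝒮, S.Nonempty ∧ Disjoint S A₀ ∧ IsDenseBlock (blockEdges H A₀ S)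
      (A₀.filter fun z => ∃ e ∈ blockEdges H A₀ S, z ∈ e) S r ((a - 1).choose (r - 1))) :
    False := by
  classical
  set B : Finset V → Finset V := fun S => A₀.filter fun z => ∃ e ∈ blockEdges H A₀ S, z ∈ e with hB
  have hiso : (𝒮.filter fun S => B S = ∅).card ≤ 1 := by
    by_contra! hlt
    obtain ⟨S, hS1, T, hT1, hne⟩ := Finset.one_lt_card.1 hlt
    rw [Finset.mem_filter] at hS1 hT1
    obtain ⟨s1, s2, s3⟩ := hS S hS1.1
    obtain ⟨t1, t2, t3⟩ := hS T hT1.1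
    change IsDenseBlock _ (B S) _ _ _ at s3
    change IsDenseBlock _ (B T) _ _ _ at t3
    rw [hS1.2] at s3
    rw [hT1.2] at t3
    exact false_of_isolated_blocks hr ha hconn hk s3 t3 s1 t1 (hdisj hS1.1 hT1.1 hne) t2
  have hsplit := Finset.card_filter_add_card_filter_not (s := 𝒮) (fun S => B S = ∅)
  set 𝒯 := 𝒮.filter fun S => ¬ B S = ∅ with h𝒯
  have hex : ∀ S ∈ 𝒮, ∀ y ∈ B S, ∃ m, BlockPath (blockEdges H A₀ S) (B S) S a y m :=
    fun S h y hy => (hS S h).2.2.exists_blockPath hr ha hy (Finset.mem_filter.1 hy).2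
  have hbest : ∀ S ∈ 𝒯, ∃ z : V, ∃ h : ℕ, z ∈ B S ∧ h < N + 1 ∧
      BlockPath (blockEdges H A₀ S) (B S) S a z h ∧
      ∀ y ∈ B S, ∀ m, BlockPath (blockEdges H A₀ S) (B S) S a y m → h ≤ m := by
    intro S hS𝒯
    rw [h𝒯, Finset.mem_filter] at hS𝒯
    obtain ⟨y, hy⟩ := Finset.nonempty_iff_ne_empty.2 hS𝒯.2
    have hP : ∃ m, ∃ y ∈ B S, BlockPath (blockEdges H A₀ S) (B S) S a y m := by
      obtain ⟨m, hm⟩ := hex S hS𝒯.1 y hy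
      exact ⟨m, y, hy, hm⟩
    obtain ⟨z, hz, hp⟩ := Nat.find_spec hP
    refine ⟨z, Nat.find hP, hz, ?_, hp, fun y hy m hm => Nat.find_min' hP ⟨y, hy, hm⟩⟩
    obtain ⟨v, hv, X, E, hp, hX, Z, hZ, hZg, hZc, -⟩ := hp
    have := Finset.card_le_card ((hZ.trans (Finset.erase_subset _ _)).trans
      (Finset.filter_subset _ _))
    omega
  have : Nonempty V := by
    obtain ⟨S, hS1⟩ := Finset.card_pos.1 (show 0 < 𝒮.card by omega)
    exact ⟨(hS S hS1).1.choose⟩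
  choose! z h hzB hhN hzh hmin using hbest
  have hmaps : ∀ S ∈ 𝒯, (B S, z S, h S) ∈ A₀.powerset ×ˢ A₀ ×ˢ Finset.range (N + 1) := by
    intro S hS𝒯
    simp only [Finset.mem_product, Finset.mem_powerset, Finset.mem_range]
    exact ⟨Finset.filter_subset _ _, (Finset.mem_filter.1 (hzB S hS𝒯)).1, hhN S hS𝒯⟩
  obtain ⟨⟨A, y, m⟩, -, hlt⟩ := Finset.exists_lt_card_fiber_of_mul_lt_card_of_maps_to hmaps
    (n := N + 1) (by
      rw [Finset.card_product, Finset.card_product, Finset.card_powerset, Finset.card_range]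
      have : 2 ^ A₀.card * (A₀.card * (N + 1)) * (N + 1) ≤ 2 ^ N * (N * (N + 1)) * (N + 1) := by
        gcongr
        norm_num
      omega)
  set ℱ := 𝒯.filter fun S => (B S, z S, h S) = (A, y, m) with hℱ
  have hmem : ∀ S ∈ ℱ, S ∈ 𝒮 ∧ S ∈ 𝒯 ∧ B S = A ∧ z S = y ∧ h S = m := by
    intro S hS
    rw [hℱ, Finset.mem_filter] at hS
    simp only [Prod.mk.injEq] at hS
    exact ⟨(Finset.mem_filter.1 hS.1).1, hS⟩
  obtain ⟨S, hSF⟩ := Finset.card_pos.1 (show 0 < ℱ.card by omega)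
  obtain ⟨h1, h2, h3, h4, h5⟩ := hmem S hSF
  have hAA : A ⊆ A₀ := h3 ▸ Finset.filter_subset _ _
  refine false_of_linked_blocks (by omega) hk hAA (𝒮 := ℱ) (z := y) (h := m) ?_
    (hdisj.subset fun T hT => (hmem T hT).1) (fun T hT => (hS T (hmem T hT).1).2.1)
    (h3 ▸ h4 ▸ hzB S h2) ?_ ?_ ?_
  · have := Finset.card_le_card hAA
    omega
  · intro T hT
    obtain ⟨-, t2, t3, t4, t5⟩ := hmem T hT
    have := hzh T t2
    rwa [t3, t4, t5] at this
  · intro T hT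
    obtain ⟨t1, -, t3, -⟩ := hmem T hT
    have := hex T t1
    rwa [t3] at this
  · intro T hT
    obtain ⟨-, t2, t3, t4, t5⟩ := hmem T hT
    have := hmin T t2
    rwa [t3, t5] at this

end LargeBlocks

section Connectors

variable {V : Type*} [DecidableEq V]

/-- The vertex `c`, outside `A₀`, can link any two hubs of `A` by two distinct edges in
`A₀ ∪ {c}`. -/
def IsConnector (H : Finset (Finset V)) (A₀ A : Finset V) (c : V) : Prop :=
  c ∉ A₀ ∧ ∀ z ∈ A, ∀ z' ∈ A, z ≠ z' → ∃ f ∈ blockEdges H A₀ {c}, ∃ f' ∈ blockEdges H A₀ {c},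
    f ≠ f' ∧ z ∈ f ∧ z' ∈ f'

theorem mem_blockEdges_singleton {H : Finset (Finset V)} {A : Finset V} {c : V} {f : Finset V} :
    f ∈ blockEdges H A {c} ↔ f ∈ H ∧ f ⊆ {c} ∪ A ∧ c ∈ f := by
  rw [blockEdges, Finset.mem_filter, Finset.inter_singleton]
  by_cases h : c ∈ f <;> simp [h]

theorem exists_isConnector {H : Finset (Finset V)} {A₀ : Finset V} {b r : ℕ} {c : V} (hr : 2 ≤ r)
    (hb : r ≤ b) (hH : ∀ e ∈ H, e.card = r) (hc : c ∉ A₀)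
    (hcard : b.choose (r - 1) ≤ (blockEdges H A₀ {c}).card) :
    ∃ A ⊆ A₀, A.card = b ∧ IsConnector H A₀ A c := by
  classical
  set F := blockEdges H A₀ {c} with hF
  have hFmem : ∀ f ∈ F, f.card = r ∧ f.erase c ⊆ A₀ ∧ c ∈ f := by
    intro f hf
    rw [hF, mem_blockEdges_singleton] at hf
    refine ⟨hH f hf.1, fun x hx => ?_, hf.2.2⟩
    have := hf.2.1 (Finset.mem_of_mem_erase hx)
    simpa [Finset.ne_of_mem_erase hx] using this
  set B := A₀.filter fun z => 2 ≤ (F.filter fun f => z ∈ f).card with hB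
  have hF' : ∀ f ∈ F.filter (fun f => ¬ f.erase c ⊆ B), ∃ z, z ∈ f.erase c ∧ z ∉ B := by
    intro f hf
    obtain ⟨z, hz⟩ := Finset.not_subset.1 (Finset.mem_filter.1 hf).2
    exact ⟨z, hz⟩
  have : Nonempty V := ⟨c⟩
  choose! s hs hsB using hF'
  set F' := F.filter (fun f => ¬ f.erase c ⊆ B) with hFF'
  have hFsub : F' ⊆ F := Finset.filter_subset _ _
  have huniq : ∀ f ∈ F', ∀ f' ∈ F, s f ∈ f' → f' = f := by
    intro f hf f' hf' hsf
    by_contra hne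
    refine hsB f hf (Finset.mem_filter.2 ⟨(hFmem f (hFsub hf)).2.1 (hs f hf), ?_⟩)
    exact Finset.one_lt_card.2 ⟨f, Finset.mem_filter.2
      ⟨hFsub hf, Finset.mem_of_mem_erase (hs f hf)⟩, f', Finset.mem_filter.2 ⟨hf', hsf⟩,
      Ne.symm hne⟩
  have hinj : Set.InjOn s F' := by
    intro f hf f' hf' h
    refine huniq f' hf' f (hFsub hf) ?_
    rw [← h]
    exact Finset.mem_of_mem_erase (hs f hf)
  have hYcard : b ≤ (B ∪ F'.image s).card := by
    by_cases hg : b ≤ B.card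
    · exact hg.trans (Finset.card_le_card Finset.subset_union_left)
    · rw [Finset.card_union_of_disjoint, Finset.card_image_of_injOn hinj]
      · have h1 : (F.filter fun f => f.erase c ⊆ B).card ≤ B.card.choose (r - 1) :=
          card_le_choose_of_forall_mem (v := c) fun f hf => by
            rw [Finset.mem_filter] at hf
            exact ⟨(hFmem f hf.1).1, (hFmem f hf.1).2.2, hf.2⟩
        have h2 : (F.filter fun f => f.erase c ⊆ B).card + F'.card = F.card :=
          Finset.card_filter_add_card_filter_not _
        have h3 := choose_add_le (b := b) (m := r - 1) (g := B.card) (by omega) (by omega)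
          (by omega)
        omega
      · rw [Finset.disjoint_right]
        intro x hx
        obtain ⟨f, hf, rfl⟩ := Finset.mem_image.1 hx
        exact hsB f hf
  obtain ⟨A, hA, hAb⟩ := Finset.exists_subset_card_eq hYcard
  have hdeg : ∀ z ∈ A, ∃ f ∈ F, z ∈ f := by
    intro z hz
    rcases Finset.mem_union.1 (hA hz) with h | h
    · obtain ⟨f, hf⟩ := Finset.card_pos.1 (zero_lt_two.trans_le (Finset.mem_filter.1 h).2)
      exact ⟨f, Finset.mem_filter.1 hf⟩
    · obtain ⟨f, hf, rfl⟩ := Finset.mem_image.1 h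
      exact ⟨f, hFsub hf, Finset.mem_of_mem_erase (hs f hf)⟩
  have htwo : ∀ z ∈ B, ∀ g, ∃ f ∈ F, f ≠ g ∧ z ∈ f := by
    intro z hz g
    obtain ⟨f, hf, hfg⟩ := Finset.exists_mem_ne (Finset.mem_filter.1 hz).2 g
    exact ⟨f, (Finset.mem_filter.1 hf).1, hfg, (Finset.mem_filter.1 hf).2⟩
  refine ⟨A, fun x hx => ?_, hAb, hc, ?_⟩
  · rcases Finset.mem_union.1 (hA hx) with h | h
    · exact (Finset.mem_filter.1 h).1
    · obtain ⟨f, hf, rfl⟩ := Finset.mem_image.1 h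
      exact (hFmem f (hFsub hf)).2.1 (hs f hf)
  · intro z hz z' hz' hne
    rcases Finset.mem_union.1 (hA hz) with h | h
    · obtain ⟨f', hf', hzf'⟩ := hdeg z' hz'
      obtain ⟨f, hf, hff, hzf⟩ := htwo z h f'
      exact ⟨f, hf, f', hf', hff, hzf, hzf'⟩
    · obtain ⟨f, hf, rfl⟩ := Finset.mem_image.1 h
      rcases Finset.mem_union.1 (hA hz') with h' | h'
      · obtain ⟨f', hf', hff, hzf⟩ := htwo z' h' f
        exact ⟨f, hFsub hf, f', hf', hff.symm, Finset.mem_of_mem_erase (hs f hf), hzf⟩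
      · obtain ⟨f', hf', rfl⟩ := Finset.mem_image.1 h'
        exact ⟨f, hFsub hf, f', hFsub hf', fun h => hne (h ▸ rfl),
          Finset.mem_of_mem_erase (hs f hf), Finset.mem_of_mem_erase (hs f' hf')⟩

theorem exists_connectors {H : Finset (Finset V)} {A₀ : Finset V} {a r N M : ℕ} (hr : 3 ≤ r)
    (ha : r + 30 ≤ a) (hH : ∀ e ∈ H, e.card = r) (hconn : BergeConnected H)
    (hk : ¬ HasBergePath H (2 * a + 1)) (hN : A₀.card ≤ N)
    (hblocks : HasBlocks H A₀ (2 ^ N * M + (2 ^ N * (N * (N + 1)) * (N + 1) + 4))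
      ((a - 1).choose (r - 1))) :
    ∃ A ⊆ A₀, A.card = a - 1 ∧ ∃ C : Finset V, M ≤ C.card ∧ ∀ c ∈ C, IsConnector H A₀ A c := by
  classical
  obtain ⟨𝒮, hcard, hdisj, hS⟩ := hblocks
  have hmin : ∀ S ∈ 𝒮, ∃ T ⊆ S, T.Nonempty ∧
      (a - 1).choose (r - 1) * T.card ≤ (blockEdges H A₀ T).card ∧
      ∀ T' ⊂ T, T'.Nonempty → (blockEdges H A₀ T').card < (a - 1).choose (r - 1) * T'.card :=
    fun S h => exists_minimal_block (hS S h).1 (hS S h).2.2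
  choose! T hTS hTne hTD hTmin using hmin
  have hTdisj : ∀ S ∈ 𝒮, ∀ S' ∈ 𝒮, S ≠ S' → Disjoint (T S) (T S') := fun S h S' h' hne =>
    Finset.disjoint_of_subset_left (hTS S h) (Finset.disjoint_of_subset_right (hTS S' h')
      (hdisj h h' hne))
  have hTA : ∀ S ∈ 𝒮, Disjoint (T S) A₀ := fun S h =>
    Finset.disjoint_of_subset_left (hTS S h) (hS S h).2.1
  have hTinj : Set.InjOn T 𝒮 := by
    intro S h S' h' hT
    by_contra hne
    obtain ⟨x, hx⟩ := hTne S h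
    exact Finset.disjoint_left.1 (hTdisj S h S' h' hne) hx (hT ▸ hx)
  set 𝒮₂ := 𝒮.filter fun S => 2 ≤ (T S).card with h𝒮₂
  set 𝒮₁ := 𝒮.filter fun S => ¬ 2 ≤ (T S).card with h𝒮₁
  have hsplit : 𝒮₂.card + 𝒮₁.card = 𝒮.card := Finset.card_filter_add_card_filter_not _
  have hlarge : 𝒮₂.card < 2 ^ N * (N * (N + 1)) * (N + 1) + 3 := by
    by_contra! hlt
    have hsub : 𝒮₂ ⊆ 𝒮 := Finset.filter_subset _ _
    refine false_of_large_blocks hr ha hconn hk hN (𝒮 := 𝒮₂.image T) ?_ ?_ ?_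
    · rwa [Finset.card_image_of_injOn (hTinj.mono (by exact_mod_cast hsub))]
    · intro X hX Y hY hne
      rw [Finset.mem_coe, Finset.mem_image] at hX hY
      obtain ⟨S, h, rfl⟩ := hX
      obtain ⟨S', h', rfl⟩ := hY
      exact hTdisj S (hsub h) S' (hsub h') fun h => hne (h ▸ rfl)
    · intro X hX
      obtain ⟨S, h, rfl⟩ := Finset.mem_image.1 hX
      have h' := hsub h
      exact ⟨hTne S h', hTA S h', isDenseBlock_of_minimal hH (hTA S h')
        (Finset.mem_filter.1 h).2 (hTD S h') (hTmin S h')⟩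
  have hone : ∀ S ∈ 𝒮₁, ∃ (c : V) (A : Finset V), T S = {c} ∧ A ⊆ A₀ ∧ A.card = a - 1 ∧
      IsConnector H A₀ A c := by
    intro S hS'
    obtain ⟨h, h2⟩ := Finset.mem_filter.1 hS'
    have hpos := Finset.card_pos.2 (hTne S h)
    obtain ⟨c, hc⟩ := Finset.card_eq_one.1 (show (T S).card = 1 by omega)
    have hD := hTD S h
    rw [hc, Finset.card_singleton, mul_one] at hD
    have hcA : c ∉ A₀ := Finset.disjoint_left.1 (hTA S h) (by simp [hc])
    obtain ⟨A, hA, hAc, hconn⟩ := exists_isConnector (b := a - 1) (by omega) (by omega) hH hcA hD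
    exact ⟨c, A, hc, hA, hAc, hconn⟩
  have : Nonempty V := by
    obtain ⟨S, h⟩ := Finset.card_pos.1 (show 0 < 𝒮.card by omega)
    exact ⟨(hTne S h).choose⟩
  choose! c B hcT hBA hBc hBconn using hone
  have hmaps : ∀ S ∈ 𝒮₁, B S ∈ A₀.powerset := fun S h => Finset.mem_powerset.2 (hBA S h)
  obtain ⟨A, -, hlt⟩ := Finset.exists_lt_card_fiber_of_mul_lt_card_of_maps_to hmaps (n := M) (by
    rw [Finset.card_powerset]
    have : 2 ^ A₀.card * M ≤ 2 ^ N * M := by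
      gcongr
      norm_num
    omega)
  have hsub : ∀ S ∈ 𝒮₁.filter (fun S => B S = A), S ∈ 𝒮₁ ∧ B S = A := fun S h =>
    Finset.mem_filter.1 h
  obtain ⟨S, hS0⟩ := Finset.card_pos.1 (Nat.zero_lt_of_lt hlt)
  obtain ⟨hS1, rfl⟩ := hsub S hS0
  refine ⟨B S, hBA S hS1, hBc S hS1, (𝒮₁.filter (fun S' => B S' = B S)).image c, ?_, ?_⟩
  · rw [Finset.card_image_of_injOn]
    · exact hlt.le
    · intro S' h' S'' h'' hc
      have e1 := (hsub S' h').1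
      have e2 := (hsub S'' h'').1
      refine hTinj (Finset.mem_filter.1 e1).1 (Finset.mem_filter.1 e2).1 ?_
      rw [hcT S' e1, hcT S'' e2, hc]
  · intro x hx
    obtain ⟨S', h', rfl⟩ := Finset.mem_image.1 hx
    obtain ⟨h1, h2⟩ := hsub S' h'
    exact h2 ▸ hBconn S' h1

end Connectors

section Joining

variable {V : Type*} [DecidableEq V] {H : Finset (Finset V)} {A₀ A : Finset V}

/-- Neither a vertex of `X` nor covered by an edge of `E`. -/
def IsFresh (X : Finset V) (E : Finset (Finset V)) (c : V) : Prop :=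
  c ∉ X ∧ ∀ e ∈ E, c ∉ e

theorem exists_fresh {C : Finset V} {X : Finset V} {E : Finset (Finset V)} {m r : ℕ}
    (hE : ∀ e ∈ E, e.card ≤ r) (h : m + X.card + E.card * r ≤ C.card) :
    ∃ C' ⊆ C, m ≤ C'.card ∧ ∀ c ∈ C', IsFresh X E c := by
  refine ⟨C \ (X ∪ E.biUnion id), Finset.sdiff_subset, ?_, ?_⟩
  · have h1 := Finset.le_card_sdiff (X ∪ E.biUnion id) C
    have h2 := Finset.card_union_le X (E.biUnion id)
    have h3 := Finset.card_biUnion_le_card_mul E id r hE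
    omega
  · intro c hc
    simp only [Finset.mem_sdiff, Finset.mem_union, Finset.mem_biUnion, id, not_or, not_exists,
      not_and] at hc
    exact ⟨hc.2.1, hc.2.2⟩

theorem IsConnector.link {c z z' w w' : V} {X Y : Finset V} {E F : Finset (Finset V)}
    (hc : IsConnector H A₀ A c) (hP : PathOn H z w X E) (hQ : PathOn H z' w' Y F) (hz : z ∈ A)
    (hz' : z' ∈ A) (hX : IsFresh X E c) (hY : IsFresh Y F c) (hXY : Disjoint X Y)
    (hEF : Disjoint E F) :
    ∃ G, PathOn H w' w (insert c (X ∪ Y)) G ∧ (∀ g ∈ G, g ∈ E ∨ g ∈ F ∨ c ∈ g) ∧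
      ∀ c', c' ∉ A₀ → c' ≠ c → IsFresh X E c' → IsFresh Y F c' →
        IsFresh (insert c (X ∪ Y)) G c' := by
  have hne : z ≠ z' := fun h => Finset.disjoint_left.1 hXY hP.head_mem (h ▸ hQ.head_mem)
  obtain ⟨f, hf, f', hf', hff, hzf, hzf'⟩ := hc.2 z hz z' hz' hne
  rw [mem_blockEdges_singleton] at hf hf'
  have h1 := hP.cons hf.1 hf.2.2 hzf hX.1 fun h => hX.2 f h hf.2.2
  have h2 := hQ.reverse.append h1 hf'.1 hzf' hf'.2.2 (by simp [hXY.symm, hY.1])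
    (by simp only [Finset.disjoint_insert_right]; exact ⟨fun h => hY.2 f h hf.2.2, hEF.symm⟩)
    (fun h => hY.2 f' h hf'.2.2)
    (by simp only [Finset.mem_insert, not_or]; exact ⟨hff.symm, fun h => hX.2 f' h hf'.2.2⟩)
  refine ⟨insert f' (F ∪ insert f E), ?_, ?_, ?_⟩
  · convert h2 using 1
    rw [Finset.union_insert, Finset.union_comm]
  · intro g hg
    simp only [Finset.mem_insert, Finset.mem_union] at hg
    rcases hg with rfl | hg | rfl | hg
    · exact .inr (.inr hf'.2.2)
    · exact .inr (.inl hg)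
    · exact .inr (.inr hf.2.2)
    · exact .inl hg
  · intro c' hcA hcc hX' hY'
    have hnot : ∀ g, g ⊆ {c} ∪ A₀ → c' ∉ g := by
      intro g hg hcg
      have := hg hcg
      simp only [Finset.mem_union, Finset.mem_singleton] at this
      exact this.elim hcc hcA
    constructor
    · simp [hcc, hX'.1, hY'.1]
    · intro e he
      simp only [Finset.mem_insert, Finset.mem_union] at he
      rcases he with rfl | he | rfl | he
      · exact hnot _ hf'.2.1
      · exact hY'.2 e he
      · exact hnot _ hf.2.1
      · exact hX'.2 e he

/-- Two disjoint paths starting at hubs can be linked through all hubs of `B`, using one connector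
for each of them. -/
theorem PathOn.card_add_card_le {k : ℕ} (hk : ¬ HasBergePath H k) (hAA : A ⊆ A₀) {z' w' : V}
    {Y : Finset V} {F : Finset (Finset V)} (hQ : PathOn H z' w' Y F) (hz' : z' ∈ A)
    (B : Finset V) : ∀ {z w : V} {X : Finset V} {E : Finset (Finset V)} (C : Finset V),
    PathOn H z w X E → z ∈ A → B ⊆ A → Disjoint B X → Disjoint B Y → Disjoint X Y →
    Disjoint E F → (∀ c ∈ C, IsConnector H A₀ A c ∧ IsFresh X E c ∧ IsFresh Y F c) →
    B.card < C.card → X.card + Y.card + 2 * B.card + 1 ≤ k := by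
  induction B using Finset.induction_on with
  | empty =>
    intro z w X E C hP hz _ _ _ hXY hEF hC hcard
    obtain ⟨c, hc⟩ := Finset.card_pos.1 (Nat.zero_lt_of_lt hcard)
    obtain ⟨h1, h2, h3⟩ := hC c hc
    obtain ⟨G, hG, -⟩ := h1.link hP hQ hz hz' h2 h3 hXY hEF
    have := hG.card_le hk
    rw [Finset.card_insert_of_notMem (by simp [h2.1, h3.1]),
      Finset.card_union_of_disjoint hXY] at this
    simpa using this
  | insert b B hb ih =>
    intro z w X E C hP hz hB hBX hBY hXY hEF hC hcard
    rw [Finset.card_insert_of_notMem hb] at hcard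
    obtain ⟨c, hc⟩ := Finset.card_pos.1 (Nat.zero_lt_of_lt hcard)
    obtain ⟨h1, h2, h3⟩ := hC c hc
    rw [Finset.disjoint_insert_left] at hBX hBY
    rw [Finset.insert_subset_iff] at hB
    have hbA : ∀ c ∈ C, c ≠ b := fun c hc h => (hC c hc).1.1 (hAA (h ▸ hB.1))
    have hfb : ∀ c ∈ C, IsFresh {b} ∅ c := fun c hc => ⟨by simpa using hbA c hc, by simp⟩
    obtain ⟨G, hG, hGE, hGC⟩ := h1.link hP (.single b) hz hB.1 h2 (hfb c hc) (by simp [hBX.1])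
      (by simp)
    have hlast := ih (C.erase c) hG hB.1 hB.2 ?_ hBY.2 ?_ ?_ ?_ ?_
    · rw [Finset.card_insert_of_notMem (by simp [h2.1, hbA c hc]),
        Finset.card_union_of_disjoint (by simp [hBX.1])] at hlast
      rw [Finset.card_insert_of_notMem hb]
      simp at hlast
      omega
    · rw [Finset.disjoint_insert_right, Finset.disjoint_union_right]
      exact ⟨fun h => h1.1 (hAA (hB.2 h)), hBX.2, by simpa using hb⟩
    · rw [Finset.disjoint_insert_left, Finset.disjoint_union_left]
      exact ⟨h3.1, hXY, by simpa using hBY.1⟩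
    · rw [Finset.disjoint_left]
      intro e he heF
      rcases hGE e he with h | h | h
      · exact Finset.disjoint_left.1 hEF h heF
      · simp at h
      · exact h3.2 e heF h
    · intro c' hc'
      obtain ⟨hne, hcC⟩ := Finset.mem_erase.1 hc'
      obtain ⟨h1', h2', h3'⟩ := hC c' hcC
      exact ⟨h1', hGC c' h1'.1 hne h2' (hfb c' hcC), h3'⟩
    · rw [Finset.card_erase_of_mem hc]
      omega

end Joining

section Tight

variable {V : Type*} [DecidableEq V] {H : Finset (Finset V)} {A₀ A : Finset V}

/-- Paths leaving the hub set `A` are short: these are the restrictions coming from a bound on the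
length of the paths of `H` when any two hubs can be linked in many ways. -/
structure IsTight (H : Finset (Finset V)) (A : Finset V) : Prop where
  card_le {z w : V} {X : Finset V} {E : Finset (Finset V)} (hP : PathOn H z w X E) (hz : z ∈ A)
    (hX : ∀ x ∈ X, x ∈ A → x = z) : X.card ≤ 4
  card_add_card_le {z w z' w' : V} {X Y : Finset V} {E F : Finset (Finset V)}
    (hP : PathOn H z w X E) (hQ : PathOn H z' w' Y F) (hz : z ∈ A) (hz' : z' ∈ A)
    (hX : ∀ x ∈ X, x ∈ A → x = z) (hY : ∀ x ∈ Y, x ∈ A → x = z') (hXY : Disjoint X Y)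
    (hEF : Disjoint E F) : X.card + Y.card ≤ 6
  card_add_card_add_card_le {z w z' w' s t : V} {X Y W : Finset V} {E F G : Finset (Finset V)}
    (hP : PathOn H z w X E) (hQ : PathOn H z' w' Y F) (hR : PathOn H s t W G) (hz : z ∈ A)
    (hz' : z' ∈ A) (hs : s ∈ A) (ht : t ∈ A) (hX : ∀ x ∈ X, x ∈ A → x = z)
    (hY : ∀ x ∈ Y, x ∈ A → x = z') (hW : ∀ x ∈ W, x ∈ A → x = s ∨ x = t) (hXY : Disjoint X Y)
    (hXW : Disjoint X W) (hYW : Disjoint Y W) (hEF : Disjoint E F) (hEG : Disjoint E G)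
    (hFG : Disjoint F G) : X.card + Y.card + W.card ≤ 9

theorem isTight_of_connectors {C : Finset V} {a r : ℕ} (ha : 10 ≤ a)
    (hH : ∀ e ∈ H, e.card = r) (hk : ¬ HasBergePath H (2 * a + 1)) (hAA : A ⊆ A₀)
    (hA : A.card = a - 1) (hC : ∀ c ∈ C, IsConnector H A₀ A c)
    (hCcard : (6 * a + 10) * (r + 2) ≤ C.card) : IsTight H A := by
  have hfresh : ∀ (X : Finset V) (E : Finset (Finset V)), E ⊆ H → X.card ≤ 6 * a + 3 →
      E.card ≤ 6 * a → ∃ C' ⊆ C, a ≤ C'.card ∧ ∀ c ∈ C', IsFresh X E c := by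
    intro X E hE hX hEc
    refine exists_fresh (r := r) (fun e he => (hH e (hE he)).le) ?_
    have : E.card * r ≤ 6 * a * r := Nat.mul_le_mul_right r hEc
    nlinarith
  have hsize : ∀ {z w : V} {X : Finset V} {E : Finset (Finset V)}, PathOn H z w X E →
      X.card ≤ 2 * a + 1 ∧ E.card ≤ 2 * a ∧ E ⊆ H := by
    intro z w X E hP
    have := hP.card_le hk
    have := hP.card_eq
    exact ⟨by omega, by omega, hP.edges_subset⟩
  have hfr : ∀ {X Y : Finset V} {E F : Finset (Finset V)} {c : V},
      IsFresh (X ∪ Y) (E ∪ F) c → IsFresh X E c ∧ IsFresh Y F c := by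
    intro X Y E F c h
    simp only [IsFresh, Finset.mem_union, not_or] at h ⊢
    exact ⟨⟨h.1.1, fun e he => h.2 e (.inl he)⟩, h.1.2, fun e he => h.2 e (.inr he)⟩
  have herase : ∀ S : Finset V, a - 1 - S.card ≤ (A \ S).card := fun S => by
    rw [← hA]; exact Finset.le_card_sdiff S A
  have hCA : ∀ c ∈ C, c ∉ A := fun c hc h => (hC c hc).1 (hAA h)
  refine ⟨?_, ?_, ?_⟩
  · intro z w X E hP hz hX
    obtain ⟨hX1, hE1, hEH⟩ := hsize hP
    obtain ⟨C', hC', hCc, hf⟩ := hfresh X E hEH (by omega) (by omega)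
    obtain ⟨c, hc⟩ := Finset.card_pos.1 (show 0 < C'.card by omega)
    have h1 := herase {z}
    rw [Finset.card_singleton] at h1
    obtain ⟨z', hz'⟩ := Finset.card_pos.1 (show 0 < (A \ {z}).card by omega)
    simp only [Finset.mem_sdiff, Finset.mem_singleton] at hz'
    obtain ⟨f, hff, -, -, -, hzf, -⟩ := (hC c (hC' hc)).2 z' hz'.1 z hz hz'.2
    rw [mem_blockEdges_singleton] at hff
    have hzc : z' ≠ c := fun h => hCA c (hC' hc) (h ▸ hz'.1)
    have hQ := (PathOn.single (H := H) c).cons hff.1 hzf hff.2.2 (by simpa using hzc) (by simp)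
    have h2 := herase {z, z'}
    rw [Finset.card_pair (Ne.symm hz'.2)] at h2
    have hfz : z' ∉ X := fun h => hz'.2 (hX z' h hz'.1)
    have h3 := hQ.card_add_card_le hk hAA hz'.1 (A \ {z, z'}) (C'.erase c) hP hz
      Finset.sdiff_subset ?_ ?_ ?_ ?_ ?_ ?_
    · rw [Finset.card_pair hzc] at h3
      omega
    · rw [Finset.disjoint_left]
      intro x hx hxX
      simp only [Finset.mem_sdiff, Finset.mem_insert, Finset.mem_singleton, not_or] at hx
      exact hx.2.1 (hX x hxX hx.1)
    · simp [hCA c (hC' hc)]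
    · simp [hfz, (hf c hc).1]
    · simp only [insert_empty_eq, Finset.disjoint_singleton_right]
      exact fun h => (hf c hc).2 f h hff.2.2
    · intro c' hc'
      obtain ⟨hne, hc'⟩ := Finset.mem_erase.1 hc'
      refine ⟨hC c' (hC' hc'), hf c' hc', ?_, ?_⟩
      · simp only [Finset.mem_insert, Finset.mem_singleton, not_or]
        exact ⟨fun h => hCA c' (hC' hc') (h ▸ hz'.1), hne⟩
      · simp only [insert_empty_eq, Finset.mem_singleton, forall_eq]
        intro h
        have := hff.2.1 h
        simp only [Finset.mem_union, Finset.mem_singleton] at this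
        exact this.elim hne (hC c' (hC' hc')).1
    · rw [Finset.card_erase_of_mem hc]
      have h4 : (A \ {z, z'}).card + 2 ≤ a - 1 := by
        rw [← hA, ← Finset.card_pair (Ne.symm hz'.2), Finset.card_sdiff_add_card_eq_card]
        simp [Finset.insert_subset_iff, hz, hz'.1]
      omega
  · intro z w z' w' X Y E F hP hQ hz hz' hX hY hXY hEF
    obtain ⟨hX1, hE1, hEH⟩ := hsize hP
    obtain ⟨hY1, hF1, hFH⟩ := hsize hQ
    have hXYc := Finset.card_union_le X Y
    have hEFc := Finset.card_union_le E F
    obtain ⟨C', hC', hCc, hf⟩ := hfresh (X ∪ Y) (E ∪ F) (Finset.union_subset hEH hFH) (by omega)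
      (by omega)
    have hzz : z ≠ z' := fun h => Finset.disjoint_left.1 hXY hP.head_mem (h ▸ hQ.head_mem)
    have h2 := herase {z, z'}
    rw [Finset.card_pair hzz] at h2
    have h4 : (A \ {z, z'}).card + 2 ≤ a - 1 := by
      rw [← hA, ← Finset.card_pair hzz, Finset.card_sdiff_add_card_eq_card]
      simp [Finset.insert_subset_iff, hz, hz']
    have h3 := hQ.card_add_card_le hk hAA hz' (A \ {z, z'}) C' hP hz
      Finset.sdiff_subset ?_ ?_ hXY hEF (fun c hc => ⟨hC c (hC' hc), hfr (hf c hc)⟩) (by omega)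
    · omega
    · rw [Finset.disjoint_left]
      intro x hx hxX
      simp only [Finset.mem_sdiff, Finset.mem_insert, Finset.mem_singleton, not_or] at hx
      exact hx.2.1 (hX x hxX hx.1)
    · rw [Finset.disjoint_left]
      intro x hx hxY
      simp only [Finset.mem_sdiff, Finset.mem_insert, Finset.mem_singleton, not_or] at hx
      exact hx.2.2 (hY x hxY hx.1)
  · intro z w z' w' s t X Y W E F G hP hQ hR hz hz' hs ht hX hY hW hXY hXW hYW hEF hEG hFG
    obtain ⟨hX1, hE1, hEH⟩ := hsize hP
    obtain ⟨hY1, hF1, hFH⟩ := hsize hQ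
    obtain ⟨hW1, hG1, hGH⟩ := hsize hR
    have hXYc := Finset.card_union_le X Y
    have hEFc := Finset.card_union_le E F
    have hXYc' := Finset.card_union_le (X ∪ Y) W
    have hEFc' := Finset.card_union_le (E ∪ F) G
    obtain ⟨C', hC', hCc, hf⟩ := hfresh (X ∪ Y ∪ W) (E ∪ F ∪ G)
      (Finset.union_subset (Finset.union_subset hEH hFH) hGH) (by omega) (by omega)
    obtain ⟨c, hc⟩ := Finset.card_pos.1 (show 0 < C'.card by omega)
    obtain ⟨K, hK, hKE, hKC⟩ := (hC c (hC' hc)).link hP hR hz hs (hfr (hfr (hf c hc)).1).1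
      (hfr (hf c hc)).2 hXW hEG
    have hcY := (hfr (hfr (hf c hc)).1).2
    have hS : ({z, z', s, t} : Finset V) ⊆ A := by
      simp [Finset.insert_subset_iff, hz, hz', hs, ht]
    have hScard : ({z, z', s, t} : Finset V).card ≤ 4 := Finset.card_le_four
    have h2 := herase {z, z', s, t}
    have h4 := Finset.card_le_card (Finset.sdiff_subset : A \ {z, z', s, t} ⊆ A)
    have hz4 : (A \ {z, z', s, t}).card + 2 ≤ a - 1 := by
      rw [← hA, ← Finset.card_pair (show z ≠ z' from
        fun h => Finset.disjoint_left.1 hXY hP.head_mem (h ▸ hQ.head_mem))]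
      rw [← Finset.card_sdiff_add_card_eq_card hS]
      gcongr
      intro x
      simp only [Finset.mem_insert, Finset.mem_singleton]
      tauto
    have h3 := hQ.card_add_card_le hk hAA hz' (A \ {z, z', s, t}) (C'.erase c) hK ht
      Finset.sdiff_subset ?_ ?_ ?_ ?_ ?_ ?_
    · rw [Finset.card_insert_of_notMem, Finset.card_union_of_disjoint hXW] at h3
      · omega
      · simp [(hfr (hf c hc)).2.1, (hfr (hfr (hf c hc)).1).1.1]
    · rw [Finset.disjoint_left]
      intro x hx hxX
      simp only [Finset.mem_sdiff, Finset.mem_insert, Finset.mem_singleton, not_or] at hx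
      simp only [Finset.mem_insert, Finset.mem_union] at hxX
      rcases hxX with rfl | h | h
      · exact hCA x (hC' hc) hx.1
      · exact hx.2.1 (hX x h hx.1)
      · exact (hW x h hx.1).elim hx.2.2.2.1 hx.2.2.2.2
    · rw [Finset.disjoint_left]
      intro x hx hxY
      simp only [Finset.mem_sdiff, Finset.mem_insert, Finset.mem_singleton, not_or] at hx
      exact hx.2.2.1 (hY x hxY hx.1)
    · rw [Finset.disjoint_insert_left, Finset.disjoint_union_left]
      exact ⟨hcY.1, hXY, hYW.symm⟩
    · rw [Finset.disjoint_left]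
      intro g hg hgF
      rcases hKE g hg with h | h | h
      · exact Finset.disjoint_left.1 hEF h hgF
      · exact Finset.disjoint_left.1 hFG hgF h
      · exact hcY.2 g hgF h
    · intro c' hc'
      obtain ⟨hne, hc'⟩ := Finset.mem_erase.1 hc'
      have h1 := hfr (hf c' hc')
      exact ⟨hC c' (hC' hc'), hKC c' (hC c' (hC' hc')).1 hne (hfr h1.1).1 h1.2, (hfr h1.1).2⟩
    · rw [Finset.card_erase_of_mem hc]
      omega

end Tight

section Rich

variable {V : Type*} [DecidableEq V] {H : Finset (Finset V)} {A : Finset V}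

/-- The vertex `y` can be linked to `A` while avoiding a few hubs and a few edges. -/
def IsRich (H : Finset (Finset V)) (A : Finset V) (y : V) : Prop :=
  ∀ B : Finset V, B.card ≤ 3 → ∀ E : Finset (Finset V), E.card ≤ 10 →
    ∃ g ∈ H, g ∉ E ∧ y ∈ g ∧ ∃ z ∈ g, z ∈ A ∧ z ∉ B

theorem PathOn.of_two {x₁ x₂ x₃ : V} {f₁ f₂ : Finset V} (h₁ : f₁ ∈ H)
    (h₂ : f₂ ∈ H) (h₁₁ : x₁ ∈ f₁) (h₁₂ : x₂ ∈ f₁) (h₂₂ : x₂ ∈ f₂) (h₂₃ : x₃ ∈ f₂)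
    (hx : [x₁, x₂, x₃].Nodup) (hf : f₁ ≠ f₂) :
    PathOn H x₁ x₃ {x₁, x₂, x₃} {f₁, f₂} := by
  simp at hx
  exact .cons (.cons (.single _) h₂ h₂₂ h₂₃ (by simp; tauto) (by simp)) h₁ h₁₁ h₁₂
    (by simp; tauto) (by simpa)

theorem PathOn.of_three {x₁ x₂ x₃ x₄ : V} {f₁ f₂ f₃ : Finset V} (h₁ : f₁ ∈ H)
    (h₂ : f₂ ∈ H) (h₃ : f₃ ∈ H) (h₁₁ : x₁ ∈ f₁) (h₁₂ : x₂ ∈ f₁) (h₂₂ : x₂ ∈ f₂) (h₂₃ : x₃ ∈ f₂)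
    (h₃₃ : x₃ ∈ f₃) (h₃₄ : x₄ ∈ f₃) (hx : [x₁, x₂, x₃, x₄].Nodup) (hf : [f₁, f₂, f₃].Nodup) :
    PathOn H x₁ x₄ {x₁, x₂, x₃, x₄} {f₁, f₂, f₃} := by
  simp at hx hf
  exact .cons (.of_two h₂ h₃ h₂₂ h₂₃ h₃₃ h₃₄ (by simp; tauto) (by tauto)) h₁ h₁₁ h₁₂
    (by simp; tauto) (by simp; tauto)

/-- A path outside `A` starting at a rich vertex extends to a path starting in `A`. -/
theorem IsRich.exists_pathOn {x y : V} {X : Finset V} {E : Finset (Finset V)}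
    (hx : IsRich H A x) (hP : PathOn H x y X E) (hX : Disjoint X A) (B : Finset V)
    (hB : B.card ≤ 3) (E' : Finset (Finset V)) (hE : E.card + E'.card ≤ 10) :
    ∃ g ∈ H, g ∉ E' ∧ ∃ z ∈ A, z ∉ B ∧ PathOn H z y (insert z X) (insert g E) := by
  obtain ⟨g, hg, hgE, hxg, z, hzg, hz, hzB⟩ :=
    hx B hB (E ∪ E') ((Finset.card_union_le _ _).trans hE)
  simp only [Finset.mem_union, not_or] at hgE
  exact ⟨g, hg, hgE.2, z, hz, hzB,
    hP.cons hg hzg hxg (fun h => Finset.disjoint_left.1 hX h hz) hgE.1⟩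

theorem IsTight.card_le_three (hT : IsTight H A) {x y : V} {X : Finset V}
    {E : Finset (Finset V)} (hx : IsRich H A x) (hP : PathOn H x y X E) (hX : Disjoint X A)
    (hE : E.card ≤ 10) : X.card ≤ 3 := by
  obtain ⟨g, hg, -, z, hz, -, h⟩ := hx.exists_pathOn hP hX ∅ (by simp) ∅ (by simpa)
  have hzX : z ∉ X := fun h => Finset.disjoint_left.1 hX h hz
  have := hT.card_le h hz fun y hy hyA => by
    rcases Finset.mem_insert.1 hy with h | h
    · exact h
    · exact absurd hyA (Finset.disjoint_left.1 hX h)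
  rw [Finset.card_insert_of_notMem hzX] at this
  omega

theorem IsTight.false_of_four (hT : IsTight H A) {x₁ x₂ x₃ x₄ : V} {f₁ f₂ f₃ : Finset V}
    (hx₁ : IsRich H A x₁) (h₁ : f₁ ∈ H)
    (h₂ : f₂ ∈ H) (h₃ : f₃ ∈ H) (h₁₁ : x₁ ∈ f₁) (h₁₂ : x₂ ∈ f₁) (h₂₂ : x₂ ∈ f₂) (h₂₃ : x₃ ∈ f₂)
    (h₃₃ : x₃ ∈ f₃) (h₃₄ : x₄ ∈ f₃) (hx : [x₁, x₂, x₃, x₄].Nodup) (hf : [f₁, f₂, f₃].Nodup)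
    (hA : ∀ x ∈ [x₁, x₂, x₃, x₄], x ∉ A) : False := by
  have h := hT.card_le_three hx₁ (.of_three h₁ h₂ h₃ h₁₁ h₁₂ h₂₂ h₂₃ h₃₃ h₃₄ hx hf)
    (by simpa using hA) (Finset.card_le_three.trans (by norm_num))
  have : ({x₁, x₂, x₃, x₄} : Finset V).card = 4 := by
    simpa using List.toFinset_card_of_nodup hx
  omega

/-- Two rich vertices with a common neighbour outside `A`. -/
structure IsCherry (H : Finset (Finset V)) (A : Finset V) (f₁ f₂ : Finset V) (y₁ w y₂ : V) :
    Prop where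
  mem₁ : f₁ ∈ H
  mem₂ : f₂ ∈ H
  ne : f₁ ≠ f₂
  mem₁₁ : y₁ ∈ f₁
  mem₁₂ : w ∈ f₁
  mem₂₁ : w ∈ f₂
  mem₂₂ : y₂ ∈ f₂
  nodup : [y₁, w, y₂].Nodup
  notMem : ∀ x ∈ [y₁, w, y₂], x ∉ A
  rich₁ : IsRich H A y₁
  rich₂ : IsRich H A y₂

/-- A link between two vertices outside a cherry does not lead to the cherry. -/
theorem IsCherry.false_of_link (hT : IsTight H A) {f₁ f₂ e d : Finset V} {y₁ w y₂ x u q : V}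
    (h : IsCherry H A f₁ f₂ y₁ w y₂) (he : e ∈ H) (hd : d ∈ H) (hxu : x ≠ u) (hxe : x ∈ e)
    (hue : u ∈ e) (hud : u ∈ d) (hqd : q ∈ d) (hx : x ∉ A ∪ {y₁, w, y₂})
    (hu : u ∉ A ∪ {y₁, w, y₂}) (hq : q ∈ A ∪ {y₁, w, y₂}) (he₁ : e ≠ f₁) (he₂ : e ≠ f₂)
    (hed : e ≠ d) : False := by
  obtain ⟨m₁, m₂, hne, m₁₁, m₁₂, m₂₁, m₂₂, hnd, hA, hr₁, hr₂⟩ := h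
  simp at hnd hA hx hu hq
  by_cases hd₁ : d = f₁
  · subst hd₁
    exact hT.false_of_four hr₂ m₂ m₁ he m₂₂ m₂₁ m₁₂ hud hue hxe (by simp; grind) (by simp; grind)
      (by simp; grind)
  by_cases hd₂ : d = f₂
  · subst hd₂
    exact hT.false_of_four hr₁ m₁ m₂ he m₁₁ m₁₂ m₂₁ hud hue hxe (by simp; grind) (by simp; grind)
      (by simp; grind)
  rcases hq with rfl | rfl | rfl | hq
  · exact hT.false_of_four hr₂ m₂ m₁ hd m₂₂ m₂₁ m₁₂ m₁₁ hqd hud (by simp; grind) (by simp; grind)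
      (by simp; grind)
  · exact hT.false_of_four hr₁ m₁ hd he m₁₁ m₁₂ hqd hud hue hxe (by simp; grind) (by simp; grind)
      (by simp; grind)
  · exact hT.false_of_four hr₁ m₁ m₂ hd m₁₁ m₁₂ m₂₁ m₂₂ hqd hud (by simp; grind) (by simp; grind)
      (by simp; grind)
  · have hP : PathOn H y₁ y₂ {y₁, w, y₂} {f₁, f₂} :=
      .of_two m₁ m₂ m₁₁ m₁₂ m₂₁ m₂₂ (by simp; tauto) hne
    have hQ : PathOn H q x {q, u, x} {d, e} :=
      .of_two hd he hqd hud hue hxe (by simp; grind) (by grind)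
    obtain ⟨g, hg, hgE, z, hz, hzq, hP'⟩ := hr₁.exists_pathOn hP (by simpa using hA) {q} (by simp)
      {d, e} (by grind [Finset.card_le_two])
    have := hT.card_add_card_le hP' hQ hz hq (by simp; grind) (by simp; grind)
      (by simp at *; grind) (by simp at *; grind)
    have c₁ : ({z, y₁, w, y₂} : Finset V).card = 4 := by
      have : [z, y₁, w, y₂].Nodup := by simp; grind
      simpa using List.toFinset_card_of_nodup this
    have c₂ : ({q, u, x} : Finset V).card = 3 := by
      have : [q, u, x].Nodup := by simp; grind
      simpa using List.toFinset_card_of_nodup this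
    omega

end Rich

section Cherry

variable {V : Type*} [DecidableEq V] {H : Finset (Finset V)} {A : Finset V}

/-- An edge with two vertices outside the nonempty set `T` yields two linked vertices outside `T`,
one of which has a neighbour in `T`. -/
theorem BergeConnected.exists_link [Fintype V] (hconn : BergeConnected H)
    (hcard : ∀ e ∈ H, 2 ≤ e.card) {T : Finset V} (hT : T.Nonempty) {e d f₁ f₂ : Finset V} {u x : V}
    (he : e ∈ H) (hue : u ∈ e) (hxe : x ∈ e) (hxu : x ≠ u) (hu : u ∉ T) (hx : x ∉ T) (hd : d ∈ H)
    (hud : u ∈ d) (hde : d ≠ e) (hd₁ : d ≠ f₁) (hd₂ : d ≠ f₂) (he₁ : e ≠ f₁) (he₂ : e ≠ f₂)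
    (h₁ : (f₁ ∩ T).Nonempty) (h₂ : (f₂ ∩ T).Nonempty) :
    ∃ e' ∈ H, ∃ d' ∈ H, ∃ x' u' q : V, x' ≠ u' ∧ x' ∈ e' ∧ u' ∈ e' ∧ u' ∈ d' ∧ q ∈ d' ∧ x' ∉ T ∧
      u' ∉ T ∧ q ∈ T ∧ e' ≠ f₁ ∧ e' ≠ f₂ ∧ e' ≠ d' := by
  classical
  by_cases heT : (e ∩ T).Nonempty
  · obtain ⟨q, hq⟩ := heT
    obtain ⟨hqe, hqT⟩ := Finset.mem_inter.1 hq
    by_cases hdT : (d ∩ T).Nonempty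
    · obtain ⟨p, hp⟩ := hdT
      obtain ⟨hpd, hpT⟩ := Finset.mem_inter.1 hp
      exact ⟨e, he, d, hd, x, u, p, hxu, hxe, hue, hud, hpd, hx, hu, hpT, he₁, he₂, hde.symm⟩
    · obtain ⟨y, hyd, hyu⟩ := Finset.exists_mem_ne (hcard d hd) u
      exact ⟨d, hd, e, he, y, u, q, hyu, hyd, hud, hue, hqe,
        fun hy => hdT ⟨y, Finset.mem_inter.2 ⟨hyd, hy⟩⟩, hu, hqT, hd₁, hd₂, hde⟩
  · have key : ∀ e' ∈ H, ¬ (e' ∩ T).Nonempty → ∀ u' ∈ e', ∀ x' ∈ e', x' ≠ u' →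
        ∀ d' ∈ H, u' ∈ d' → (d' ∩ T).Nonempty → ∃ e' ∈ H, ∃ d' ∈ H, ∃ x' u' q : V, x' ≠ u' ∧
          x' ∈ e' ∧ u' ∈ e' ∧ u' ∈ d' ∧ q ∈ d' ∧ x' ∉ T ∧ u' ∉ T ∧ q ∈ T ∧ e' ≠ f₁ ∧ e' ≠ f₂ ∧
          e' ≠ d' := by
      intro e' he' heT' u' hu' x' hx' hne d' hd' hud' hdT'
      obtain ⟨q, hq⟩ := id hdT'
      obtain ⟨hqd, hqT⟩ := Finset.mem_inter.1 hq
      have hnot : ∀ y ∈ e', y ∉ T := fun y hy hyT => heT' ⟨y, Finset.mem_inter.2 ⟨hy, hyT⟩⟩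
      exact ⟨e', he', d', hd', x', u', q, hne, hx', hu', hud', hqd, hnot x' hx', hnot u' hu', hqT,
        fun h => heT' (h ▸ h₁), fun h => heT' (h ▸ h₂), fun h => heT' (h ▸ hdT')⟩
    set R := Finset.univ.filter fun v => v ∉ T → ∃ d' ∈ H, v ∈ d' ∧ (d' ∩ T).Nonempty with hR
    by_cases huR : u ∈ R
    · obtain ⟨d', hd', hud', hdT'⟩ := (Finset.mem_filter.1 huR).2 hu
      exact key e he heT u hue x hxe hxu d' hd' hud' hdT'
    · obtain ⟨t, ht⟩ := hT
      obtain ⟨e', he', ⟨v, hv⟩, ⟨s, hs⟩⟩ := hconn.cutConnected_univ R (Finset.subset_univ _)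
        ⟨t, Finset.mem_filter.2 ⟨Finset.mem_univ _, fun h => absurd ht h⟩⟩
        (fun h => huR (h ▸ Finset.mem_univ u))
      rw [Finset.mem_inter] at hv hs
      have hs' := (Finset.mem_sdiff.1 hs.2).2
      simp only [hR, Finset.mem_filter, Finset.mem_univ, true_and, Classical.not_imp,
        not_exists, not_and] at hs'
      have heT' := hs'.2 e' he' hs.1
      have hvT : v ∉ T := fun h => heT' ⟨v, Finset.mem_inter.2 ⟨hv.1, h⟩⟩
      obtain ⟨d', hd', hvd', hdT'⟩ := (Finset.mem_filter.1 hv.2).2 hvT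
      exact key e' he' heT' v hv.1 s hs.1 (fun h => (Finset.mem_sdiff.1 hs.2).2 (h ▸ hv.2))
        d' hd' hvd' hdT'

/-- An edge leaving a cherry does so in one vertex, and contains the centre of the cherry. -/
theorem IsCherry.sdiff_eq_of_mem [Fintype V] (hT : IsTight H A) (hconn : BergeConnected H)
    (hcard : ∀ e ∈ H, 2 ≤ e.card) {f₁ f₂ e : Finset V} {y₁ w y₂ u : V}
    (h : IsCherry H A f₁ f₂ y₁ w y₂) (he : e ∈ H) (he₁ : e ≠ f₁) (he₂ : e ≠ f₂)
    (hcard' : 2 ≤ (e \ A).card)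
    (hdeg : ∀ v ∈ e, v ∉ A ∪ {y₁, w, y₂} → ∃ d ∈ H, v ∈ d ∧ d ≠ e ∧ d ≠ f₁ ∧ d ≠ f₂)
    (hue : u ∈ e) (hu : u ∉ A ∪ {y₁, w, y₂}) : e \ A = {w, u} := by
  have huniq : ∀ x ∈ e, x ∉ A ∪ {y₁, w, y₂} → x = u := by
    intro x hxe hx
    by_contra hxu
    obtain ⟨d, hd, hud, hde, hd₁, hd₂⟩ := hdeg u hue hu
    obtain ⟨e', he', d', hd', x', u', q, h1, h2, h3, h4, h5, h6, h7, h8, h9, h10, h11⟩ :=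
      hconn.exists_link hcard (T := A ∪ {y₁, w, y₂}) ⟨w, by simp⟩ he hue hxe hxu hu hx hd hud hde
        hd₁ hd₂ he₁ he₂ ⟨w, by simp [h.mem₁₂]⟩ ⟨w, by simp [h.mem₂₁]⟩
    exact h.false_of_link hT he' hd' h1 h2 h3 h4 h5 h6 h7 h8 h9 h10 h11
  obtain ⟨m₁, m₂, hne, m₁₁, m₁₂, m₂₁, m₂₂, hnd, hA, hr₁, hr₂⟩ := h
  simp at hnd hA hu
  have hy₁ : y₁ ∉ e := fun hy => hT.false_of_four hr₂ m₂ m₁ he m₂₂ m₂₁ m₁₂ m₁₁ hy hue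
    (by simp; grind) (by simp; grind) (by simp; grind)
  have hy₂ : y₂ ∉ e := fun hy => hT.false_of_four hr₁ m₁ m₂ he m₁₁ m₁₂ m₂₁ m₂₂ hy hue
    (by simp; grind) (by simp; grind) (by simp; grind)
  have hsub : e \ A ⊆ {w, u} := by
    intro x hx
    obtain ⟨hxe, hxA⟩ := Finset.mem_sdiff.1 hx
    have := huniq x hxe
    simp at this ⊢
    grind
  exact Finset.eq_of_subset_of_card_le hsub (Finset.card_le_two.trans hcard')

/-- If the centre of a cherry has a further neighbour outside `A`, then all edges with several
vertices outside `A` contain the centre. -/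
theorem IsCherry.exists_sdiff_eq [Fintype V] (hT : IsTight H A) (hconn : BergeConnected H)
    (hcard : ∀ e ∈ H, 2 ≤ e.card) {f₁ f₂ e k : Finset V} {y₁ w y₂ y : V}
    (h : IsCherry H A f₁ f₂ y₁ w y₂) (hk : k ∈ H) (hwk : w ∈ k) (hyk : y ∈ k)
    (hy : y ∉ A ∪ {y₁, w, y₂}) (he : e ∈ H) (he₁ : e ≠ f₁) (he₂ : e ≠ f₂)
    (hcard' : 2 ≤ (e \ A).card)
    (hdeg : ∀ v ∈ e, v ∉ A ∪ {y₁, w, y₂} → ∃ d ∈ H, v ∈ d ∧ d ≠ e ∧ d ≠ f₁ ∧ d ≠ f₂) :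
    ∃ u, e \ A = {w, u} := by
  by_cases hu : ∃ u ∈ e, u ∉ A ∪ {y₁, w, y₂}
  · obtain ⟨u, hue, hu⟩ := hu
    exact ⟨u, h.sdiff_eq_of_mem hT hconn hcard he he₁ he₂ hcard' hdeg hue hu⟩
  push Not at hu
  obtain ⟨m₁, m₂, hne, m₁₁, m₁₂, m₂₁, m₂₂, hnd, hA, hr₁, hr₂⟩ := h
  have hke : k ≠ e := fun hke => hy (hu y (hke ▸ hyk))
  simp at hnd hA hy hu
  have hnot : ¬ (y₁ ∈ e ∧ y₂ ∈ e) := by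
    rintro ⟨hy₁, hy₂⟩
    by_cases hk₁ : k = f₁
    · subst hk₁
      exact hT.false_of_four hr₁ he m₂ hk hy₁ hy₂ m₂₂ m₂₁ hwk hyk (by simp; grind)
        (by simp; grind) (by simp; grind)
    by_cases hk₂ : k = f₂
    · subst hk₂
      exact hT.false_of_four hr₂ he m₁ hk hy₂ hy₁ m₁₁ m₁₂ hwk hyk (by simp; grind)
        (by simp; grind) (by simp; grind)
    exact hT.false_of_four hr₂ he m₁ hk hy₂ hy₁ m₁₁ m₁₂ hwk hyk (by simp; grind) (by simp; grind)
      (by simp; grind)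
  have hex : ∃ u, e \ A ⊆ {w, u} := by
    by_cases hy₁ : y₁ ∈ e
    · refine ⟨y₁, fun x hx => ?_⟩
      simp at hx ⊢
      grind
    · refine ⟨y₂, fun x hx => ?_⟩
      simp at hx ⊢
      grind
  obtain ⟨u, hsub⟩ := hex
  exact ⟨u, Finset.eq_of_subset_of_card_le hsub (Finset.card_le_two.trans hcard')⟩

end Cherry

section DenseCore

variable {V : Type*} [DecidableEq V] {H : Finset (Finset V)} {A Y : Finset V}

theorem IsCherry.subset_hnaEdges [Fintype V] (hT : IsTight H A) (hconn : BergeConnected H) {r : ℕ}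
    (hr : 2 ≤ r) (hH : ∀ e ∈ H, e.card = r)
    (hdeg : ∀ x : V, 2 ≤ (H.filter fun h => x ∈ h).card) {f₁ f₂ k : Finset V} {y₁ w y₂ y : V}
    (h : IsCherry H A f₁ f₂ y₁ w y₂) (hf₁ : f₁ \ A = {w, y₁}) (hf₂ : f₂ \ A = {w, y₂})
    (hk : k ∈ H) (hwk : w ∈ k) (hyk : y ∈ k) (hy : y ∉ A ∪ {y₁, w, y₂}) :
    H ⊆ HnaEdges r (insert w A) := by
  have key : ∀ e ∈ H, ∃ u, e \ A ⊆ {w, u} := by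
    intro e he
    by_cases he₁ : e = f₁
    · exact ⟨y₁, he₁ ▸ hf₁.subset⟩
    by_cases he₂ : e = f₂
    · exact ⟨y₂, he₂ ▸ hf₂.subset⟩
    by_cases hc : 2 ≤ (e \ A).card
    · obtain ⟨u, hu⟩ := h.exists_sdiff_eq hT hconn (fun e he => hr.trans_eq (hH e he).symm) hk hwk
        hyk hy he he₁ he₂ hc fun v _ hv => by
          obtain ⟨d, hd, hde⟩ := Finset.exists_mem_ne (hdeg v) e
          obtain ⟨hdH, hvd⟩ := Finset.mem_filter.1 hd
          simp only [Finset.mem_union, Finset.mem_insert, Finset.mem_singleton, not_or] at hv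
          refine ⟨d, hdH, hvd, hde, ?_, ?_⟩ <;> rintro rfl
          · have : v ∈ d \ A := Finset.mem_sdiff.2 ⟨hvd, hv.1⟩
            rw [hf₁] at this
            simp [hv.2] at this
          · have : v ∈ d \ A := Finset.mem_sdiff.2 ⟨hvd, hv.1⟩
            rw [hf₂] at this
            simp [hv.2] at this
      exact ⟨u, hu.subset⟩
    · have : Nonempty V := ⟨w⟩
      rcases Finset.card_le_one_iff_subset_singleton (s := e \ A).1 (by omega) with ⟨u, hu⟩
      exact ⟨u, hu.trans (by simp)⟩
  intro e he
  obtain ⟨u, hu⟩ := key e he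
  have hsub : e.erase u ⊆ insert w A := by
    intro x hx
    obtain ⟨hxu, hxe⟩ := Finset.mem_erase.1 hx
    by_contra hxA
    simp only [Finset.mem_insert, not_or] at hxA
    have := hu (Finset.mem_sdiff.2 ⟨hxe, hxA.2⟩)
    simp [hxA.1, hxu] at this
  rw [HnaEdges, Finset.mem_union]
  by_cases heA : e ⊆ insert w A
  · exact .inl (Finset.mem_powersetCard.2 ⟨heA, hH e he⟩)
  · have hue : u ∈ e := by
      by_contra hue
      exact heA (by rwa [Finset.erase_eq_of_notMem hue] at hsub)
    have huA : u ∉ insert w A := fun h => heA (by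
      rw [← Finset.insert_erase hue]
      exact Finset.insert_subset h hsub)
    refine .inr (Finset.mem_biUnion.2 ⟨u, Finset.mem_compl.2 huA, Finset.mem_image.2
      ⟨e.erase u, Finset.mem_powersetCard.2 ⟨hsub, ?_⟩, Finset.insert_erase hue⟩⟩)
    rw [Finset.card_erase_of_mem hue, hH e he]

theorem choose_le_ten {n m : ℕ} (hn : n ≤ 5) : n.choose m ≤ 10 :=
  (Nat.choose_le_choose m hn).trans ((Nat.choose_le_middle m 5).trans (by decide))

theorem isRich_of_card {G : Finset (Finset V)} {X : Finset V} {y : V} {r : ℕ}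
    (hH : ∀ e ∈ H, e.card = r) (hG : G ⊆ H) (hGy : ∀ e ∈ G, y ∈ e) (hX : X.card ≤ 2)
    (hGX : ∀ e ∈ G, ∀ x ∈ e, x ∈ A ∨ x ∈ X ∨ x = y) (hcard : 21 ≤ G.card) : IsRich H A y := by
  intro B hB E hE
  by_contra! hno
  have h1 : (G \ E).card ≤ (B ∪ X).card.choose (r - 1) :=
    card_le_choose_of_forall_mem (v := y) fun e he => by
      obtain ⟨heG, heE⟩ := Finset.mem_sdiff.1 he
      refine ⟨hH e (hG heG), hGy e heG, fun x hx => ?_⟩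
      obtain ⟨hxy, hxe⟩ := Finset.mem_erase.1 hx
      rcases hGX e heG x hxe with h | h | h
      · exact Finset.mem_union_left _ (hno e (hG heG) heE (hGy e heG) x hxe h)
      · exact Finset.mem_union_right _ h
      · exact absurd h hxy
  have h2 := choose_le_ten (n := (B ∪ X).card) (m := r - 1) ((Finset.card_union_le _ _).trans
    (by omega))
  have h3 := Finset.le_card_sdiff E G
  omega

/-- Every vertex of `Y` has many edges inside `A ∪ Y`. -/
def IsDenseCore (H : Finset (Finset V)) (A Y : Finset V) : Prop :=
  Disjoint Y A ∧ ∀ y ∈ Y, 30 ≤ (H.filter fun e => e ⊆ Y ∪ A ∧ y ∈ e).card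

theorem IsDenseCore.isRich_of_maximal (hY : IsDenseCore H A Y) {r : ℕ} (hT : IsTight H A)
    (hH : ∀ e ∈ H, e.card = r) {z y : V} {X : Finset V} {E : Finset (Finset V)}
    (hP : PathOn H z y X E) (hz : z ∈ A) (hX : ∀ x ∈ X, x ∈ A → x = z) (hy : y ∈ Y)
    (hmax : ∀ e ∈ H, e ⊆ Y ∪ A → y ∈ e → e ∉ E → e ⊆ A ∪ X) : IsRich H A y := by
  have h1 := hT.card_le hP hz hX
  have h2 := hP.card_eq
  have hzy : z ≠ y := fun h => Finset.disjoint_left.1 hY.1 hy (h ▸ hz)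
  have h3 := Finset.le_card_sdiff E (H.filter fun e => e ⊆ Y ∪ A ∧ y ∈ e)
  have h4 := hY.2 y hy
  refine isRich_of_card (G := (H.filter fun e => e ⊆ Y ∪ A ∧ y ∈ e) \ E)
    (X := (X.erase z).erase y) hH (Finset.sdiff_subset.trans (Finset.filter_subset _ _)) ?_ ?_ ?_
    (by omega)
  · intro e he
    exact (Finset.mem_filter.1 (Finset.mem_sdiff.1 he).1).2.2
  · rw [Finset.card_erase_of_mem (Finset.mem_erase.2 ⟨hzy.symm, hP.last_mem⟩),
      Finset.card_erase_of_mem hP.head_mem]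
    omega
  · intro e he x hx
    obtain ⟨he, heE⟩ := Finset.mem_sdiff.1 he
    obtain ⟨heH, heY, hye⟩ := Finset.mem_filter.1 he
    rcases Finset.mem_union.1 (hmax e heH heY hye heE hx) with h | h
    · exact .inl h
    · by_cases hxz : x = z
      · exact .inl (hxz ▸ hz)
      · by_cases hxy : x = y
        · exact .inr (.inr hxy)
        · exact .inr (.inl (by simp [hxy, hxz, h]))

theorem IsDenseCore.isRich_of_two (hY : IsDenseCore H A Y) {r : ℕ} (hT : IsTight H A)
    (hH : ∀ e ∈ H, e.card = r) {x₁ x₂ x₃ : V} {f₁ f₂ : Finset V} (hx₁ : IsRich H A x₁)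
    (h₁ : f₁ ∈ H) (h₂ : f₂ ∈ H) (h₁₁ : x₁ ∈ f₁) (h₁₂ : x₂ ∈ f₁) (h₂₂ : x₂ ∈ f₂) (h₂₃ : x₃ ∈ f₂)
    (hx : [x₁, x₂, x₃].Nodup) (hf : f₁ ≠ f₂) (hA₁ : x₁ ∉ A) (hA₂ : x₂ ∉ A) (h₃ : x₃ ∈ Y) :
    IsRich H A x₃ := by
  have hA₃ : x₃ ∉ A := Finset.disjoint_left.1 hY.1 h₃
  obtain ⟨g, hg, -, z, hz, -, hP⟩ := hx₁.exists_pathOn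
    (.of_two h₁ h₂ h₁₁ h₁₂ h₂₂ h₂₃ hx hf) (by simp [hA₁, hA₂, hA₃]) ∅ (by simp) ∅
    (by grind [Finset.card_le_two])
  have hX : ∀ x ∈ insert z ({x₁, x₂, x₃} : Finset V), x ∈ A → x = z := by
    simp
    grind
  refine hY.isRich_of_maximal hT hH hP hz hX h₃ fun e he _ hxe heE v hve => ?_
  by_contra hv
  simp only [Finset.mem_union, not_or] at hv
  have h := hP.snoc he hxe hve hv.2 heE
  have := hT.card_le h hz (by simp at hv ⊢; grind)
  have c : (insert v (insert z ({x₁, x₂, x₃} : Finset V))).card = 5 := by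
    have : [v, z, x₁, x₂, x₃].Nodup := by
      simp at hv hx ⊢
      grind
    simpa using List.toFinset_card_of_nodup this
  omega

end DenseCore

section NoCherry

variable {V : Type*} [DecidableEq V] {H : Finset (Finset V)} {A Y : Finset V}

theorem IsDenseCore.mem_of_no_cherry (hY : IsDenseCore H A Y) {r : ℕ} (hT : IsTight H A)
    (hH : ∀ e ∈ H, e.card = r) (hno : ∀ f₁ f₂ y₁ w y₂, ¬ IsCherry H A f₁ f₂ y₁ w y₂) {x y : V}
    {f : Finset V} (hy : IsRich H A y) (hyY : y ∈ Y) (hxY : x ∈ Y) (hxy : x ≠ y) (hf : f ∈ H)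
    (hyf : y ∈ f) (hxf : x ∈ f) {e : Finset V} (he : e ∈ H) (heY : e ⊆ Y ∪ A) (hxe : x ∈ e)
    (hef : e ≠ f) {v : V} (hv : v ∈ e) : v ∈ A ∨ v = y ∨ v = x := by
  by_contra! hcon
  have hvY : v ∈ Y := (Finset.mem_union.1 (heY hv)).resolve_right hcon.1
  have hxA := Finset.disjoint_left.1 hY.1 hxY
  have hyA := Finset.disjoint_left.1 hY.1 hyY
  have hnd : [y, x, v].Nodup := by simp; grind
  have hv' := hY.isRich_of_two hT hH hy hf he hyf hxf hxe hv hnd hef.symm hyA hxA hvY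
  exact hno f e y x v ⟨hf, he, hef.symm, hyf, hxf, hxe, hv, hnd, by simp; grind, hy, hv'⟩

theorem IsDenseCore.isRich_of_isRich (hY : IsDenseCore H A Y) {r : ℕ} (hT : IsTight H A)
    (hH : ∀ e ∈ H, e.card = r) (hno : ∀ f₁ f₂ y₁ w y₂, ¬ IsCherry H A f₁ f₂ y₁ w y₂) {x y : V}
    {f : Finset V} (hy : IsRich H A y) (hyY : y ∈ Y) (hxY : x ∈ Y) (hxy : x ≠ y) (hf : f ∈ H)
    (hyf : y ∈ f) (hxf : x ∈ f) : IsRich H A x := by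
  refine isRich_of_card (G := (H.filter fun e => e ⊆ Y ∪ A ∧ x ∈ e).erase f) (X := {y}) hH
    ((Finset.erase_subset _ _).trans (Finset.filter_subset _ _)) ?_ (by simp) ?_ ?_
  · intro e he
    exact (Finset.mem_filter.1 (Finset.mem_of_mem_erase he)).2.2
  · intro e he v hv
    obtain ⟨hef, he⟩ := Finset.mem_erase.1 he
    obtain ⟨heH, heY, hxe⟩ := Finset.mem_filter.1 he
    simpa using hY.mem_of_no_cherry hT hH hno hy hyY hxY hxy hf hyf hxf heH heY hxe hef hv
  · have := hY.2 x hxY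
    have := Finset.pred_card_le_card_erase (s := H.filter fun e => e ⊆ Y ∪ A ∧ x ∈ e) (a := f)
    omega

theorem IsDenseCore.isRich_of_pathOn (hY : IsDenseCore H A Y) {r : ℕ} (hT : IsTight H A)
    (hH : ∀ e ∈ H, e.card = r) (hno : ∀ f₁ f₂ y₁ w y₂, ¬ IsCherry H A f₁ f₂ y₁ w y₂) {z : V}
    (hz : z ∈ A) : ∀ m : ℕ, ∀ {y : V} {X : Finset V} {E : Finset (Finset V)}, PathOn H z y X E →
    (∀ x ∈ X, x ∈ A → x = z) → y ∈ Y → 5 ≤ X.card + m → IsRich H A y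
  | 0, y, X, E, hP, hX, hy, hm => by
    have := hT.card_le hP hz hX
    omega
  | m + 1, y, X, E, hP, hX, hy, hm => by
    by_cases hmax : ∀ e ∈ H, e ⊆ Y ∪ A → y ∈ e → e ∉ E → e ⊆ A ∪ X
    · exact hY.isRich_of_maximal hT hH hP hz hX hy hmax
    · push Not at hmax
      obtain ⟨e, he, heY, hye, heE, hsub⟩ := hmax
      obtain ⟨v, hve, hv⟩ := Finset.not_subset.1 hsub
      simp only [Finset.mem_union, not_or] at hv
      have hvY : v ∈ Y := (Finset.mem_union.1 (heY hve)).resolve_right hv.1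
      have hP' := hP.snoc he hye hve hv.2 heE
      have := hY.isRich_of_pathOn hT hH hno hz m hP' (fun x hx hxA => by
        rcases Finset.mem_insert.1 hx with rfl | hx
        · exact absurd hxA hv.1
        · exact hX x hx hxA) hvY (by rw [Finset.card_insert_of_notMem hv.2]; omega)
      exact hY.isRich_of_isRich hT hH hno this hvY hy (fun h => hv.2 (h ▸ hP.last_mem)) he hve hye

theorem IsDenseCore.isRich (hY : IsDenseCore H A Y) {r : ℕ} (hT : IsTight H A)
    (hH : ∀ e ∈ H, e.card = r) (hconn : BergeConnected H) (hA : A.Nonempty)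
    (hno : ∀ f₁ f₂ y₁ w y₂, ¬ IsCherry H A f₁ f₂ y₁ w y₂) {y : V} (hy : y ∈ Y) :
    IsRich H A y := by
  obtain ⟨z, hz, X, E, hP, hX⟩ := hconn.exists_path hA y
  exact hY.isRich_of_pathOn hT hH hno hz 5 hP.reverse hX hy (by omega)

theorem card_le_choose_of_sdiff_eq {F : Finset (Finset V)} {S : Finset V} {r : ℕ}
    (hF : ∀ e ∈ F, e.card = r ∧ e \ A = S) (hS : S.card = 2) :
    F.card ≤ A.card.choose (r - 2) := by
  rw [← Finset.card_powersetCard]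
  refine Finset.card_le_card_of_injOn (fun e => e ∩ A) ?_ ?_
  · intro e he
    rw [Finset.mem_coe, Finset.mem_powersetCard]
    refine ⟨Finset.inter_subset_right, ?_⟩
    change (e ∩ A).card = r - 2
    have := Finset.card_sdiff_add_card_inter e A
    rw [(hF e he).1, (hF e he).2, hS] at this
    omega
  · intro e he e' he' h
    rw [← Finset.sdiff_union_inter e A, ← Finset.sdiff_union_inter e' A, (hF e he).2,
      (hF e' he').2]
    simp only at h
    rw [h]

/-- The edges inside `A ∪ Y` with at least two vertices in `Y`. -/
def coreEdges (H : Finset (Finset V)) (A Y : Finset V) : Finset (Finset V) :=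
  H.filter fun e => e ⊆ Y ∪ A ∧ 2 ≤ (e \ A).card

theorem IsDenseCore.card_meeting_le (hY : IsDenseCore H A Y) {r : ℕ} (hr : r - 2 ≤ A.card)
    (hT : IsTight H A) (hH : ∀ e ∈ H, e.card = r)
    (hno : ∀ f₁ f₂ y₁ w y₂, ¬ IsCherry H A f₁ f₂ y₁ w y₂) (hrich : ∀ y ∈ Y, IsRich H A y)
    {f : Finset V} (hf : f ∈ coreEdges H A Y) :
    ((coreEdges H A Y).filter fun e => ¬ Disjoint (e \ A) (f \ A)).card ≤
      A.card.choose (r - 2) := by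
  obtain ⟨hfH, hfY, hf2⟩ := Finset.mem_filter.1 hf
  have hmemY : ∀ e ⊆ Y ∪ A, ∀ x ∈ e \ A, x ∈ Y := fun e he x hx => by
    obtain ⟨h1, h2⟩ := Finset.mem_sdiff.1 hx
    exact (Finset.mem_union.1 (he h1)).resolve_right h2
  have key : ∀ e ∈ coreEdges H A Y, ¬ Disjoint (e \ A) (f \ A) → e ≠ f →
      e \ A = f \ A ∧ (f \ A).card = 2 := by
    intro e he hd hne
    obtain ⟨heH, heY, he2⟩ := Finset.mem_filter.1 he
    obtain ⟨s, hse, hsf⟩ := Finset.not_disjoint_iff.1 hd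
    have hsub : ∀ t ∈ f \ A, t ≠ s → e \ A = {t, s} := by
      intro t ht hts
      refine Finset.eq_of_subset_of_card_le (fun v hv => ?_) (Finset.card_le_two.trans he2)
      obtain ⟨hve, hvA⟩ := Finset.mem_sdiff.1 hv
      have := hY.mem_of_no_cherry hT hH hno (hrich t (hmemY f hfY t ht)) (hmemY f hfY t ht)
        (hmemY f hfY s hsf) hts.symm hfH (Finset.mem_sdiff.1 ht).1 (Finset.mem_sdiff.1 hsf).1
        heH heY (Finset.mem_sdiff.1 hse).1 hne hve
      simpa [hvA] using this
    obtain ⟨t, ht, hts⟩ := Finset.exists_mem_ne hf2 s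
    have he' := hsub t ht hts
    have hf' : f \ A ⊆ {t, s} := by
      intro v hv
      by_cases hvs : v = s
      · simp [hvs]
      · rw [← he', hsub v hv hvs]
        simp
    have hfe := Finset.eq_of_subset_of_card_le hf' (Finset.card_le_two.trans hf2)
    exact ⟨he'.trans hfe.symm, by rw [hfe, Finset.card_pair hts]⟩
  by_cases hex : ∃ e ∈ coreEdges H A Y, ¬ Disjoint (e \ A) (f \ A) ∧ e ≠ f
  · obtain ⟨e, he, hd, hne⟩ := hex
    have h2 := (key e he hd hne).2
    refine card_le_choose_of_sdiff_eq (S := f \ A) (fun e he => ?_) h2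
    obtain ⟨he, hd⟩ := Finset.mem_filter.1 he
    refine ⟨hH e (Finset.mem_filter.1 he).1, ?_⟩
    by_cases hne : e = f
    · rw [hne]
    · exact (key e he hd hne).1
  · push Not at hex
    refine (Finset.card_le_one.2 fun e he e' he' => ?_).trans (Nat.choose_pos hr)
    obtain ⟨he, hd⟩ := Finset.mem_filter.1 he
    obtain ⟨he', hd'⟩ := Finset.mem_filter.1 he'
    rw [hex e he hd, hex e' he' hd']

theorem IsTight.false_of_three_disjoint (hT : IsTight H A) {f₁ f₂ f₃ : Finset V}
    {x₁ y₁ x₂ y₂ x₃ y₃ : V} (h₁ : f₁ ∈ H) (h₂ : f₂ ∈ H) (h₃ : f₃ ∈ H) (hf : [f₁, f₂, f₃].Nodup)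
    (hx₁ : x₁ ∈ f₁) (hy₁ : y₁ ∈ f₁) (hx₂ : x₂ ∈ f₂) (hy₂ : y₂ ∈ f₂) (hx₃ : x₃ ∈ f₃) (hy₃ : y₃ ∈ f₃)
    (hnd : [x₁, y₁, x₂, y₂, x₃, y₃].Nodup) (hA : ∀ x ∈ [x₁, y₁, x₂, y₂, x₃, y₃], x ∉ A)
    (hr₁ : IsRich H A x₁) (hr₂ : IsRich H A x₂) (hr₃ : IsRich H A x₃) (hr₃' : IsRich H A y₃) :
    False := by
  simp at hf hnd hA
  have hP (x y : V) (f : Finset V) (hf : f ∈ H) (hx : x ∈ f) (hy : y ∈ f) (hxy : x ≠ y) :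
      PathOn H x y {x, y} {f} :=
    .cons (.single _) hf hx hy (by simpa using hxy) (by simp)
  obtain ⟨g₁, hg₁, hg₁E, z₁, hz₁, -, hP₁⟩ := hr₁.exists_pathOn (hP x₁ y₁ f₁ h₁ hx₁ hy₁ (by tauto))
    (by simp; tauto) ∅ (by simp) {f₂, f₃} (by grind [Finset.card_le_two, Finset.card_singleton])
  obtain ⟨g₂, hg₂, hg₂E, z₂, hz₂, hz₂', hP₂⟩ := hr₂.exists_pathOn
    (hP x₂ y₂ f₂ h₂ hx₂ hy₂ (by tauto)) (by simp; tauto) {z₁} (by simp) {f₁, f₃, g₁}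
    (by grind [Finset.card_le_three, Finset.card_singleton])
  obtain ⟨g₃, hg₃, hg₃E, z₃, hz₃, hz₃', hP₃⟩ := hr₃.exists_pathOn
    (hP x₃ y₃ f₃ h₃ hx₃ hy₃ (by tauto)) (by simp; tauto) {z₁, z₂}
    (by grind [Finset.card_le_two]) {f₁, f₂, g₁, g₂}
    (by grind [Finset.card_le_four, Finset.card_singleton])
  obtain ⟨g₄, hg₄, hg₄E, hy₃g, z₄, hz₄g, hz₄, hz₄'⟩ := hr₃' {z₁, z₂, z₃} Finset.card_le_three
    ({f₁, f₂, f₃, g₁, g₂, g₃} : Finset (Finset V)) (Finset.card_le_six.trans (by norm_num))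
  simp at hg₁E hg₂E hz₂' hg₃E hz₃' hg₄E hz₄'
  have hy₃z : z₄ ∉ insert z₃ ({x₃, y₃} : Finset V) := by simp; grind
  have hP₄ := hP₃.snoc hg₄ hy₃g hz₄g hy₃z (by simp; grind)
  have := hT.card_add_card_add_card_le hP₁ hP₂ hP₄ hz₁ hz₂ hz₃ hz₄ (by simp; grind)
    (by simp; grind) (by simp; grind) (by simp; grind) (by simp; grind) (by simp; grind)
    (by simp; grind) (by simp; grind) (by simp; grind)
  have c₁ : (insert z₁ ({x₁, y₁} : Finset V)).card = 3 := by
    have : [z₁, x₁, y₁].Nodup := by simp; grind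
    simpa using List.toFinset_card_of_nodup this
  have c₂ : (insert z₂ ({x₂, y₂} : Finset V)).card = 3 := by
    have : [z₂, x₂, y₂].Nodup := by simp; grind
    simpa using List.toFinset_card_of_nodup this
  have c₃ : (insert z₄ (insert z₃ ({x₃, y₃} : Finset V))).card = 4 := by
    have : [z₄, z₃, x₃, y₃].Nodup := by simp; grind
    simpa using List.toFinset_card_of_nodup this
  omega

theorem IsDenseCore.exists_isCherry (hY : IsDenseCore H A Y) {r : ℕ} (hr : r - 2 ≤ A.card)
    (hT : IsTight H A) (hH : ∀ e ∈ H, e.card = r) (hconn : BergeConnected H) (hA : A.Nonempty)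
    (hcard : 2 * A.card.choose (r - 2) < (coreEdges H A Y).card) :
    ∃ f₁ f₂ y₁ w y₂, IsCherry H A f₁ f₂ y₁ w y₂ := by
  by_contra! hno
  have hrich : ∀ y ∈ Y, IsRich H A y := fun y hy => hY.isRich hT hH hconn hA hno hy
  set F := coreEdges H A Y with hF
  have hmeet : ∀ f ∈ F, (F.filter fun e => ¬ Disjoint (e \ A) (f \ A)).card ≤
      A.card.choose (r - 2) := fun f hf => hY.card_meeting_le hr hT hH hno hrich hf
  obtain ⟨f₁, hf₁⟩ := Finset.card_pos.1 (show 0 < F.card by omega)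
  obtain ⟨f₂, hf₂, hf₂'⟩ := Finset.exists_mem_notMem_of_card_lt_card
    (s := F.filter fun e => ¬ Disjoint (e \ A) (f₁ \ A)) (t := F) (by have := hmeet f₁ hf₁; omega)
  obtain ⟨f₃, hf₃, hf₃'⟩ := Finset.exists_mem_notMem_of_card_lt_card
    (s := F.filter (fun e => ¬ Disjoint (e \ A) (f₁ \ A)) ∪
      F.filter fun e => ¬ Disjoint (e \ A) (f₂ \ A)) (t := F) (by
    have := hmeet f₁ hf₁
    have := hmeet f₂ hf₂
    have := Finset.card_union_le (F.filter fun e => ¬ Disjoint (e \ A) (f₁ \ A))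
      (F.filter fun e => ¬ Disjoint (e \ A) (f₂ \ A))
    omega)
  simp only [Finset.mem_union, Finset.mem_filter, hf₂, hf₃, true_and, not_not, not_or] at hf₂' hf₃'
  have hpair : ∀ f ∈ F, f ∈ H ∧ ∃ x y, x ≠ y ∧ x ∈ f \ A ∧ y ∈ f \ A ∧ x ∈ Y ∧ y ∈ Y := by
    intro f hf
    obtain ⟨hfH, hfY, hf2⟩ := Finset.mem_filter.1 hf
    obtain ⟨x, hx, y, hy, hxy⟩ := Finset.one_lt_card.1 hf2
    have hmem : ∀ x ∈ f \ A, x ∈ Y := fun x hx => by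
      obtain ⟨h1, h2⟩ := Finset.mem_sdiff.1 hx
      exact (Finset.mem_union.1 (hfY h1)).resolve_right h2
    exact ⟨hfH, x, y, hxy, hx, hy, hmem x hx, hmem y hy⟩
  obtain ⟨h₁, x₁, y₁, hxy₁, hx₁, hy₁, hx₁Y, -⟩ := hpair f₁ hf₁
  obtain ⟨h₂, x₂, y₂, hxy₂, hx₂, hy₂, hx₂Y, -⟩ := hpair f₂ hf₂
  obtain ⟨h₃, x₃, y₃, hxy₃, hx₃, hy₃, hx₃Y, hy₃Y⟩ := hpair f₃ hf₃
  rw [Finset.disjoint_left] at hf₂'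
  rw [Finset.disjoint_left, Finset.disjoint_left] at hf₃'
  have e₁₂ : f₁ ≠ f₂ := fun h => hf₂' (h ▸ hx₁) hx₁
  have e₁₃ : f₁ ≠ f₃ := fun h => hf₃'.1 (h ▸ hx₁) hx₁
  have e₂₃ : f₂ ≠ f₃ := fun h => hf₃'.2 (h ▸ hx₂) hx₂
  have d₁ := hf₂' hx₂
  have d₂ := hf₂' hy₂
  have d₃ := hf₃'.1 hx₃
  have d₄ := hf₃'.1 hy₃
  have d₅ := hf₃'.2 hx₃
  have d₆ := hf₃'.2 hy₃
  refine hT.false_of_three_disjoint h₁ h₂ h₃ (by simp; tauto) (Finset.mem_sdiff.1 hx₁).1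
    (Finset.mem_sdiff.1 hy₁).1 (Finset.mem_sdiff.1 hx₂).1 (Finset.mem_sdiff.1 hy₂).1
    (Finset.mem_sdiff.1 hx₃).1 (Finset.mem_sdiff.1 hy₃).1 ?_ ?_ (hrich x₁ hx₁Y) (hrich x₂ hx₂Y)
    (hrich x₃ hx₃Y) (hrich y₃ hy₃Y)
  · simp only [List.nodup_cons, List.mem_cons, List.not_mem_nil, or_false, not_or,
      not_false_eq_true, List.nodup_nil, and_true]
    have hne {f : Finset V} {x y : V} (hx : x ∈ f \ A) (hy : y ∉ f \ A) : x ≠ y :=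
      fun h => hy (h ▸ hx)
    exact ⟨⟨hxy₁, hne hx₁ d₁, hne hx₁ d₂, hne hx₁ d₃, hne hx₁ d₄⟩,
      ⟨hne hy₁ d₁, hne hy₁ d₂, hne hy₁ d₃, hne hy₁ d₄⟩,
      ⟨hxy₂, hne hx₂ d₅, hne hx₂ d₆⟩, ⟨hne hy₂ d₅, hne hy₂ d₆⟩, hxy₃⟩
  · simp at hx₁ hy₁ hx₂ hy₂ hx₃ hy₃ ⊢
    tauto

end NoCherry

section Star

variable {V : Type*} [DecidableEq V] {H : Finset (Finset V)} {A Y : Finset V}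

theorem exists_three_of_card_lt {α β : Type*} [DecidableEq α] [DecidableEq β] {F : Finset α}
    (g : α → β) {c : ℕ}
    (hc : ∀ b, (F.filter fun e => g e = b).card ≤ c) (hF : 2 * c < F.card) :
    ∃ a₁ ∈ F, ∃ a₂ ∈ F, ∃ a₃ ∈ F, g a₁ ≠ g a₂ ∧ g a₁ ≠ g a₃ ∧ g a₂ ≠ g a₃ := by
  obtain ⟨a₁, h₁⟩ := Finset.card_pos.1 (show 0 < F.card by omega)
  obtain ⟨a₂, h₂, h₂'⟩ := Finset.exists_mem_notMem_of_card_lt_card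
    (s := F.filter fun e => g e = g a₁) (t := F) (by have := hc (g a₁); omega)
  obtain ⟨a₃, h₃, h₃'⟩ := Finset.exists_mem_notMem_of_card_lt_card
    (s := (F.filter fun e => g e = g a₁) ∪ F.filter fun e => g e = g a₂) (t := F) (by
      have := hc (g a₁)
      have := hc (g a₂)
      have := Finset.card_union_le (F.filter fun e => g e = g a₁) (F.filter fun e => g e = g a₂)
      omega)
  simp only [Finset.mem_union, Finset.mem_filter, h₂, h₃, true_and, not_or] at h₂' h₃'
  exact ⟨a₁, h₁, a₂, h₂, a₃, h₃, Ne.symm h₂', Ne.symm h₃'.1, Ne.symm h₃'.2⟩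

theorem IsDenseCore.exists_mem_ne (hY : IsDenseCore H A Y) {y : V} (hy : y ∈ Y)
    (e₁ e₂ e₃ : Finset V) : ∃ d ∈ H, y ∈ d ∧ d ≠ e₁ ∧ d ≠ e₂ ∧ d ≠ e₃ := by
  obtain ⟨d, hd, hd'⟩ := Finset.exists_mem_notMem_of_card_lt_card
    (s := {e₁, e₂, e₃}) (t := H.filter fun e => e ⊆ Y ∪ A ∧ y ∈ e)
    (lt_of_le_of_lt Finset.card_le_three (lt_of_lt_of_le (by norm_num) (hY.2 y hy)))
  simp only [Finset.mem_insert, Finset.mem_singleton, not_or] at hd'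
  obtain ⟨hd, -, hyd⟩ := Finset.mem_filter.1 hd
  exact ⟨d, hd, hyd, hd'⟩

theorem IsDenseCore.subset_hnaEdges [Fintype V] (hY : IsDenseCore H A Y) (hT : IsTight H A)
    (hconn : BergeConnected H) {r : ℕ} (hr : 2 ≤ r) (hrA : r - 2 ≤ A.card) (hA : A.Nonempty)
    (hH : ∀ e ∈ H, e.card = r) (hdeg : ∀ x : V, 2 ≤ (H.filter fun h => x ∈ h).card)
    (hY4 : 4 ≤ Y.card) (hcov : ∀ y ∈ Y, ∃ e ∈ coreEdges H A Y, y ∈ e)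
    (hcard : 2 * A.card.choose (r - 2) + 2 < (coreEdges H A Y).card) :
    ∃ w ∉ A, H ⊆ HnaEdges r (insert w A) := by
  obtain ⟨f₁, f₂, y₁, w, y₂, h⟩ :=
    hY.exists_isCherry hrA hT hH hconn hA (by omega)
  have hcard2 : ∀ e ∈ H, 2 ≤ e.card := fun e he => hr.trans_eq (hH e he).symm
  have hmem : ∀ e ∈ coreEdges H A Y, ∀ x ∈ e, x ∉ A → x ∈ Y := fun e he x hx hxA =>
    (Finset.mem_union.1 ((Finset.mem_filter.1 he).2.1 hx)).resolve_right hxA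
  have hex : ∀ e ∈ coreEdges H A Y, ∀ v ∈ e, v ∉ A ∪ {y₁, w, y₂} →
      ∃ d ∈ H, v ∈ d ∧ d ≠ e ∧ d ≠ f₁ ∧ d ≠ f₂ := fun e he v hve hv =>
    hY.exists_mem_ne (hmem e he v hve fun hvA => hv (Finset.mem_union_left _ hvA)) e f₁ f₂
  have hnotMem : ∀ y ∈ Y, ∀ a b c : V, y ∉ ({a, b, c} : Finset V) → y ∉ A ∪ {a, b, c} :=
    fun y hy a b c hy' hyA => (Finset.mem_union.1 hyA).elim (Finset.disjoint_left.1 hY.1 hy) hy'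
  obtain ⟨y, hyY, hy⟩ := Finset.exists_mem_notMem_of_card_lt_card
    (s := {y₁, w, y₂}) (t := Y) (lt_of_le_of_lt Finset.card_le_three hY4)
  replace hy := hnotMem y hyY _ _ _ hy
  obtain ⟨k, hk, hyk⟩ := hcov y hyY
  obtain ⟨hkH, -, hk2⟩ := Finset.mem_filter.1 hk
  have hwk : w ∈ k := by
    by_cases hk₁ : k = f₁
    · exact hk₁ ▸ h.mem₁₂
    by_cases hk₂ : k = f₂
    · exact hk₂ ▸ h.mem₂₁
    have := h.sdiff_eq_of_mem hT hconn hcard2 hkH hk₁ hk₂ hk2 (hex k hk) hyk hy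
    have hw : w ∈ k \ A := by simp [this]
    exact (Finset.mem_sdiff.1 hw).1
  have hwA : w ∉ A := h.notMem w (by simp)
  set F := coreEdges H A Y \ {f₁, f₂} with hF
  have hstar : ∀ e ∈ F, e ∈ H ∧ ∃ u, e \ A = {w, u} ∧ w ≠ u ∧ w ∈ e ∧ u ∈ e ∧ u ∈ Y ∧ u ∉ A ∧
      IsRich H A u := by
    intro e he
    obtain ⟨heF, hne⟩ := Finset.mem_sdiff.1 he
    simp only [Finset.mem_insert, Finset.mem_singleton, not_or] at hne
    obtain ⟨heH, -, he2⟩ := Finset.mem_filter.1 heF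
    obtain ⟨u, hu⟩ := h.exists_sdiff_eq hT hconn hcard2 hkH hwk hyk hy heH hne.1 hne.2 he2
      (hex e heF)
    have hwu : w ≠ u := by
      rintro rfl
      simp [hu] at he2
    have hwe : w ∈ e \ A := by simp [hu]
    have hue : u ∈ e \ A := by simp [hu]
    rw [Finset.mem_sdiff] at hwe hue
    have huY := hmem e heF u hue.1 hue.2
    refine ⟨heH, u, hu, hwu, hwe.1, hue.1, huY, hue.2, ?_⟩
    by_cases hu₁ : u = y₁
    · exact hu₁ ▸ h.rich₁
    have hnd := h.nodup
    simp only [List.nodup_cons, List.mem_cons, List.not_mem_nil, or_false, not_or] at hnd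
    exact hY.isRich_of_two hT hH h.rich₁ h.mem₁ heH h.mem₁₁ h.mem₁₂ hwe.1 hue.1
      (by simp [hnd.1.1, Ne.symm hu₁, hwu]) (Ne.symm hne.1) (h.notMem y₁ (by simp)) hwA huY
  have hFcard : 2 * A.card.choose (r - 2) < F.card := by
    have := Finset.le_card_sdiff {f₁, f₂} (coreEdges H A Y)
    have := Finset.card_le_two (a := f₁) (b := f₂)
    rw [hF]
    omega
  obtain ⟨e₁, he₁, e₂, he₂, e₃, he₃, h₁₂, h₁₃, h₂₃⟩ :=
    exists_three_of_card_lt (fun e => e \ A) (c := A.card.choose (r - 2)) (fun S => by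
      by_cases hS : ∃ e ∈ F, e \ A = S
      · obtain ⟨e, he, rfl⟩ := hS
        obtain ⟨-, u, hu, hwu, -⟩ := hstar e he
        refine card_le_choose_of_sdiff_eq (S := e \ A) (fun e' he' => ?_)
          (by rw [hu, Finset.card_pair hwu])
        obtain ⟨h1, h2⟩ := Finset.mem_filter.1 he'
        exact ⟨hH e' (hstar e' h1).1, h2⟩
      · push Not at hS
        rw [Finset.filter_false_of_mem hS]
        simp) hFcard
  obtain ⟨m₁, u₁, s₁, w₁, w₁', i₁, -, n₁, r₁⟩ := hstar e₁ he₁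
  obtain ⟨m₂, u₂, s₂, w₂, w₂', i₂, -, n₂, r₂⟩ := hstar e₂ he₂
  obtain ⟨m₃, u₃, s₃, w₃, w₃', i₃, -, n₃, -⟩ := hstar e₃ he₃
  have d₁₂ : u₁ ≠ u₂ := fun h => h₁₂ (s₁.trans (h ▸ s₂.symm))
  have d₁₃ : u₁ ≠ u₃ := fun h => h₁₃ (s₁.trans (h ▸ s₃.symm))
  have d₂₃ : u₂ ≠ u₃ := fun h => h₂₃ (s₂.trans (h ▸ s₃.symm))
  have hC : IsCherry H A e₁ e₂ u₁ w u₂ :=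
    ⟨m₁, m₂, fun h => h₁₂ (congrArg (· \ A) h), i₁, w₁', w₂', i₂,
      by simp [d₁₂, w₁.symm, w₂], by simp [n₁, n₂, hwA], r₁, r₂⟩
  exact ⟨w, hwA, hC.subset_hnaEdges hT hconn hr hH hdeg s₁ s₂ m₃ w₃' i₃
    (by simp [n₃, d₁₃.symm, d₂₃.symm, w₃.symm])⟩

end Star

section Peeling

variable {V : Type*} [DecidableEq V] {H : Finset (Finset V)} {A Y : Finset V}

theorem card_filter_subset_le {r : ℕ} (hH : ∀ e ∈ H, e.card = r) (S : Finset V) :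
    (H.filter fun e => e ⊆ S).card ≤ S.card.choose r := by
  rw [← Finset.card_powersetCard]
  refine Finset.card_le_card fun e he => ?_
  obtain ⟨he, heS⟩ := Finset.mem_filter.1 he
  exact Finset.mem_powersetCard.2 ⟨heS, hH e he⟩

theorem card_filter_subset_union_le {r : ℕ} (hH : ∀ e ∈ H, e.card = r) :
    (H.filter fun e => e ⊆ Y ∪ A).card ≤
      (coreEdges H A Y).card + A.card.choose r + Y.card * A.card.choose (r - 1) := by
  have hsub : (H.filter fun e => e ⊆ Y ∪ A) ⊆ coreEdges H A Y ∪ (H.filter fun e => e ⊆ A) ∪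
      Y.biUnion fun y => H.filter fun e => y ∈ e ∧ e.erase y ⊆ A := by
    intro e he
    obtain ⟨heH, heY⟩ := Finset.mem_filter.1 he
    by_cases hc : 2 ≤ (e \ A).card
    · exact Finset.mem_union_left _ (Finset.mem_union_left _ (Finset.mem_filter.2 ⟨heH, heY, hc⟩))
    by_cases heA : e ⊆ A
    · exact Finset.mem_union_left _ (Finset.mem_union_right _ (Finset.mem_filter.2 ⟨heH, heA⟩))
    obtain ⟨y, hye, hyA⟩ := Finset.not_subset.1 heA
    refine Finset.mem_union_right _ (Finset.mem_biUnion.2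
      ⟨y, (Finset.mem_union.1 (heY hye)).resolve_right hyA, Finset.mem_filter.2
        ⟨heH, hye, fun x hx => ?_⟩⟩)
    obtain ⟨hxy, hxe⟩ := Finset.mem_erase.1 hx
    by_contra hxA
    exact hc (Finset.one_lt_card.2 ⟨x, by simp [hxe, hxA], y, by simp [hye, hyA], hxy⟩)
  refine (Finset.card_le_card hsub).trans ((Finset.card_union_le _ _).trans
    (add_le_add ((Finset.card_union_le _ _).trans
      (add_le_add le_rfl (card_filter_subset_le hH A))) ?_))
  refine Finset.card_biUnion_le_card_mul _ _ _ fun y _ => ?_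
  refine card_le_choose_of_forall_mem (v := y) fun e he => ?_
  obtain ⟨heH, hye, he⟩ := Finset.mem_filter.1 he
  exact ⟨hH e heH, hye, he⟩

theorem exists_isDenseCore [Fintype V] {b r : ℕ} (hr : 3 ≤ r) (hrb : r - 2 < b)
    (hH : ∀ e ∈ H, e.card = r) (hA : A.card = b) (hD : 30 ≤ b.choose (r - 1))
    (hn : b + 3 ≤ Fintype.card V)
    (hcard : (Fintype.card V - (b + 3)) * b.choose (r - 1) + (b + 3).choose r < H.card) :
    ∃ Y, IsDenseCore H A Y ∧ 4 ≤ Y.card ∧ (∀ y ∈ Y, ∃ e ∈ coreEdges H A Y, y ∈ e) ∧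
      2 * A.card.choose (r - 2) + 2 < (coreEdges H A Y).card := by
  set D := b.choose (r - 1) with hDdef
  obtain ⟨Y, hY, hmin⟩ := Finset.exists_min_image
    ((Aᶜ).powerset.filter fun Y => Y.card * D + (b + 3).choose r <
      (H.filter fun e => e ⊆ Y ∪ A).card + 3 * D) Finset.card ⟨Aᶜ, by
      have hall : (H.filter fun e => e ⊆ Aᶜ ∪ A) = H := by
        rw [Finset.union_comm, Finset.union_compl]
        exact Finset.filter_true_of_mem fun e _ => Finset.subset_univ e
      rw [Finset.mem_filter, hall, Finset.card_compl, hA]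
      refine ⟨Finset.mem_powerset.2 subset_rfl, ?_⟩
      obtain ⟨m, hm⟩ := Nat.exists_eq_add_of_le hn
      rw [hm, show b + 3 + m - b = m + 3 by omega]
      rw [hm, Nat.add_sub_cancel_left] at hcard
      linarith⟩
  obtain ⟨hYA, hYcard⟩ := Finset.mem_filter.1 hY
  rw [Finset.mem_powerset] at hYA
  have hdisj : Disjoint Y A := Finset.disjoint_left.2 fun y hy => Finset.mem_compl.1 (hYA hy)
  have hdeg : ∀ y ∈ Y, D < (H.filter fun e => e ⊆ Y ∪ A ∧ y ∈ e).card := by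
    intro y hy
    have hlt := Finset.card_erase_lt_of_mem hy
    have hnot := fun h => (hmin (Y.erase y) h).not_gt hlt
    rw [Finset.mem_filter, Finset.mem_powerset] at hnot
    have hle := not_lt.1 fun h => hnot ⟨(Finset.erase_subset _ _).trans hYA, h⟩
    have hsub : (H.filter fun e => e ⊆ Y ∪ A) ⊆
        (H.filter fun e => e ⊆ Y.erase y ∪ A) ∪ H.filter fun e => e ⊆ Y ∪ A ∧ y ∈ e := by
      intro e he
      obtain ⟨heH, heY⟩ := Finset.mem_filter.1 he
      by_cases hye : y ∈ e
      · exact Finset.mem_union_right _ (Finset.mem_filter.2 ⟨heH, heY, hye⟩)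
      · refine Finset.mem_union_left _ (Finset.mem_filter.2 ⟨heH, fun x hx => ?_⟩)
        have hxy : x ≠ y := fun h => hye (h ▸ hx)
        simpa [hxy] using heY hx
    have hsum := (Finset.card_le_card hsub).trans (Finset.card_union_le _ _)
    have hYe := Finset.card_erase_add_one hy
    have : Y.card * D = (Y.erase y).card * D + D := by rw [← hYe]; ring
    omega
  have hdense : IsDenseCore H A Y := ⟨hdisj, fun y hy => hD.trans (hdeg y hy).le⟩
  have hcov : ∀ y ∈ Y, ∃ e ∈ coreEdges H A Y, y ∈ e := by
    intro y hy
    by_contra! hno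
    refine (hdeg y hy).not_ge ?_
    rw [hDdef, ← hA]
    refine card_le_choose_of_forall_mem (v := y) fun e he => ?_
    obtain ⟨heH, heY, hye⟩ := Finset.mem_filter.1 he
    refine ⟨hH e heH, hye, fun x hx => ?_⟩
    obtain ⟨hxy, hxe⟩ := Finset.mem_erase.1 hx
    by_contra hxA
    exact hno e (Finset.mem_filter.2 ⟨heH, heY, Finset.one_lt_card.2
      ⟨x, by simp [hxe, hxA], y, by simp [hye, Finset.disjoint_left.1 hdisj hy], hxy⟩⟩) hye
  obtain ⟨t, rfl⟩ := Nat.exists_eq_add_of_le' hr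
  simp only [show t + 3 - 1 = t + 2 by omega, show t + 3 - 2 = t + 1 by omega] at *
  have p₁ (m s : ℕ) : (m + 1).choose (s + 1) = m.choose s + m.choose (s + 1) :=
    Nat.choose_succ_succ' m s
  refine ⟨Y, hdense, ?_, hcov, ?_⟩
  · by_contra! hlt
    have hle := card_filter_subset_le hH (Y ∪ A)
    rw [Finset.card_union_of_disjoint hdisj, hA] at hle
    have q₁ := p₁ (b + 2) (t + 2)
    have q₂ := p₁ (b + 1) (t + 2)
    have q₃ := p₁ b (t + 2)
    have m₁ : b.choose (t + 2) ≤ (b + 1).choose (t + 2) := Nat.choose_le_choose _ (by omega)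
    have m₂ : b.choose (t + 2) ≤ (b + 2).choose (t + 2) := Nat.choose_le_choose _ (by omega)
    simp only [add_assoc, Nat.reduceAdd] at q₁ q₂ q₃
    generalize Y.card = j at *
    interval_cases j <;> simp [add_comm _ b] at hle <;> omega
  · have hle := card_filter_subset_union_le (A := A) (Y := Y) hH
    rw [hA, show t + 3 - 1 = t + 2 by omega, ← hDdef] at hle
    have q₁ := p₁ (b + 2) (t + 2)
    have q₂ := p₁ (b + 1) (t + 2)
    have q₃ := p₁ b (t + 2)
    have q₄ := p₁ (b + 1) (t + 1)
    have q₅ := p₁ b (t + 1)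
    have q₆ := p₁ b t
    have c₁ : 0 < b.choose (t + 1) := Nat.choose_pos (by omega)
    have c₂ : 0 < b.choose t := Nat.choose_pos (by omega)
    rw [hA]
    simp only [add_assoc, Nat.reduceAdd] at q₁ q₂ q₃ q₄ q₅ q₆
    omega

end Peeling

/-- Stability theorem (odd case): for every `ε > 0` there exists `q` such that for all
`r ≥ 3` and `k ≥ (2+ε)r + q` with `k` odd, there is a threshold `n₀ = n_{k,r}` such
that any connected `n`-vertex `r`-uniform hypergraph (`n ≥ n₀`) with minimum degree at
least 2, no Berge-path of length `k`, and more than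
`(n - (k+3)/2)·C((k-3)/2, r-1) + C((k+3)/2, r)` hyperedges is a subhypergraph of
`H_{n,(k-1)/2}`. -/
theorem stability_odd :
    ∀ ε : ℝ, 0 < ε → ∃ q : ℕ, ∀ r k : ℕ, 3 ≤ r →
      (2 + ε) * (r : ℝ) + (q : ℝ) ≤ (k : ℝ) → Odd k →
      ∃ n₀ : ℕ, ∀ n : ℕ, n₀ ≤ n →
      ∀ (V : Type) [Fintype V] [DecidableEq V] (H : Finset (Finset V)),
        Fintype.card V = n →
        (∀ h ∈ H, h.card = r) →
        BergeConnected H →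
        (∀ x : V, 2 ≤ (H.filter (fun h => x ∈ h)).card) →
        ¬ HasBergePath H k →
        (n - (k + 3) / 2) * Nat.choose ((k - 3) / 2) (r - 1)
            + Nat.choose ((k + 3) / 2) r < H.card →
        ∃ A : Finset V, A.card = (k - 1) / 2 ∧ H ⊆ HnaEdges r A := by
  intro ε hε
  refine ⟨61, fun r k hr hk hodd => ?_⟩
  obtain ⟨a, rfl⟩ := hodd
  have hra : r + 30 ≤ a := by
    have h : (2 * r + 61 : ℝ) ≤ ((2 * a + 1 : ℕ) : ℝ) := by
      have : 0 ≤ ε * (r : ℝ) := by positivity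
      push_cast at hk ⊢
      linarith
    have : 2 * r + 61 ≤ 2 * a + 1 := by exact_mod_cast h
    omega
  simp only [show (2 * a + 1 + 3) / 2 = a + 2 by omega, show (2 * a + 1 - 3) / 2 = a - 1 by omega,
    show (2 * a + 1 - 1) / 2 = a by omega]
  set D := (a - 1).choose (r - 1) with hD
  obtain ⟨N, hN⟩ := exists_hasBlocks r (2 * a + 1) (by omega)
  obtain ⟨n₀, hn₀⟩ := hN ((a + 2) * D)
    (2 ^ N * ((6 * a + 10) * (r + 2)) + (2 ^ N * (N * (N + 1)) * (N + 1) + 4)) D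
  refine ⟨n₀ + a + 2, fun n hn V _ _ H hVn hH hconn hdeg hpath hcard => ?_⟩
  subst hVn
  obtain ⟨A₀, hA₀, hblocks⟩ := hn₀ V H (by omega) hH hpath hconn (by
    obtain ⟨m, hm⟩ := Nat.exists_eq_add_of_le (show a + 2 ≤ Fintype.card V by omega)
    rw [hm, Nat.add_sub_cancel_left] at hcard
    rw [hm]
    linarith)
  obtain ⟨A, hAA, hA, C, hCcard, hC⟩ := exists_connectors hr hra hH hconn hpath hA₀ hblocks
  have hT := isTight_of_connectors (by omega) hH hpath hAA hA hC hCcard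
  have h30 := two_mul_le_choose hr hra
  obtain ⟨Y, hY, hY4, hcov, hcore⟩ := exists_isDenseCore hr (by omega) hH hA (by omega) (by omega)
    (by rwa [show a - 1 + 3 = a + 2 by omega])
  obtain ⟨w, hwA, hsub⟩ := hY.subset_hnaEdges hT hconn (by omega) (by omega)
    (Finset.card_pos.1 (by omega)) hH hdeg hY4 hcov hcore
  exact ⟨insert w A, by rw [Finset.card_insert_of_notMem hwA]; omega, hsub⟩
end
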